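/- Let N ≥ 2 and δ₀ ∈ (0,1). There exist m₂ > 0 and c₀ > 0, depending only on N and δ₀, with the following property. Let 0 < s < t < 1 with t − s ≥ δ₀, let m ∈ (0, m₂), and let F ⊆ ℝ^N be measurable with |F| = m and P_t(F) < ∞ such that F_{s,t}(F) ≤ F_{s,t}(B_m), where B_m is a ball of volume m. Then the fractional isoperimetric deficit satisfies D_t(F) = (P_t(F) − P_t(B_m))/P_t(B_m) ≤ c₀·m^{(t−s)/N}, and moreover there exists x ∈ ℝ^N such that |(x + F) Δ B_m| ≤ c₀·m^{1 + (t−s)/(2N)}. -/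

import Mathlib

open MeasureTheory ENNReal

/-- Interaction energy `∫_A ∫_B |x-y|^{-(N+α)} dy dx` in `[0,∞]`. -/
noncomputable def interEnergy (N : ℕ) (α : ℝ)
    (A B : Set (EuclideanSpace ℝ (Fin N))) : ℝ≥0∞ :=
  ∫⁻ x in A, ∫⁻ y in B, ENNReal.ofReal (‖x - y‖ ^ (-((N : ℝ) + α))) ∂volume ∂volume

/-- The fractional `α`-perimeter `P_α(E) = ∫_E ∫_{Eᶜ} |x-y|^{-(N+α)} dy dx`. -/
noncomputable def fracPer (N : ℕ) (α : ℝ) (E : Set (EuclideanSpace ℝ (Fin N))) : ℝ≥0∞ :=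
  interEnergy N α E Eᶜ

/-- The free energy `F_{s,t}(E) = (1-t) P_t(E) - s P_s(E)`. -/
noncomputable def freeEnergy (N : ℕ) (s t : ℝ) (E : Set (EuclideanSpace ℝ (Fin N))) : ℝ :=
  (1 - t) * (fracPer N t E).toReal - s * (fracPer N s E).toReal

/-- The radius of the ball in `ℝ^N` of volume `m`. -/
noncomputable def ballRad (N : ℕ) (m : ℝ) : ℝ :=
  (m / (volume (Metric.ball (0 : EuclideanSpace ℝ (Fin N)) 1)).toReal) ^ ((1 : ℝ) / N)

open Set Filter Topology
set_option linter.all false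

local notation "oR" => ENNReal.ofReal
local notation "Bal" => Metric.ball
local notation "inn" => inner ℝ
local notation "fdv" => fderiv ℝ
local notation "frk" => Module.finrank ℝ

section main
variable {X : Type*} [NormedAddCommGroup X] [InnerProductSpace ℝ X] [FiniteDimensional ℝ X] [MeasurableSpace X] [BorelSpace X]


section P1
/-- indicator of membership as an extended nonnegative real -/

noncomputable def ind (E : Set X) (x : X) : ℝ≥0∞ := E.indicator 1 x
/-- generalized perimeter with kernel k -/

noncomputable def PK (k : ℝ → ℝ≥0∞) (E : Set X) : ℝ≥0∞ :=
  ∫⁻ x, ∫⁻ y, ind E x * ind Eᶜ y * k ‖x - y‖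

lemma ind_meas {E : Set X} (hE : MeasurableSet E) : Measurable (ind E) :=
  (measurable_const (a := (1:ℝ≥0∞))).indicator hE

structure Pol (σ : X → X) (H : Set X) : Prop where
  mp : MeasurePreserving σ volume volume
  inv : ∀ x, σ (σ x) = x
  iso : ∀ x y, ‖σ x - σ y‖ = ‖x - y‖
  Hm : MeasurableSet H
  cover : ∀ x, x ∈ H ∨ σ x ∈ H
  sep : ∀ x, x ∈ H → σ x ∈ H → σ x = x
  two : ∀ x y, x ∈ H → y ∈ H → ‖x - y‖ ≤ ‖x - σ y‖
  near : ∀ x, x ∈ H → ‖x‖ ≤ ‖σ x‖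

def pol (σ : X → X) (H E : Set X) : Set X := {x | (x ∈ E ∧ σ x ∈ E) ∨ ((x ∈ E ∨ σ x ∈ E) ∧ x ∈ H)}
variable {σ : X → X} {H : Set X}

lemma Pol.meas (h : Pol σ H) {E : Set X} (hE : MeasurableSet E) : MeasurableSet (pol σ H E) := by
  have h1 := h.mp.measurable hE
  exact (hE.inter h1).union ((hE.union h1).inter h.Hm)

lemma Pol.memH (h : Pol σ H) (E : Set X) {x : X} (hx : x ∈ H) :
    (x ∈ pol σ H E ↔ (x ∈ E ∨ σ x ∈ E)) ∧ (σ x ∈ pol σ H E ↔ (x ∈ E ∧ σ x ∈ E)) := by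
  constructor
  · simp only [pol, mem_setOf_eq]; tauto
  · simp only [pol, mem_setOf_eq, h.inv]
    constructor
    · rintro (h1 | ⟨h1, h2⟩)
      · exact h1.symm
      · have := h.sep x hx h2
        rw [this] at h1 ⊢; tauto
    · tauto

lemma Pol.lint (h : Pol σ H) (f : X → ℝ≥0∞) (hf : Measurable f) : ∫⁻ x, f (σ x) = ∫⁻ x, f x :=
  h.mp.lintegral_comp hf

lemma ind_of_mem {E : Set X} {x : X} (h : x ∈ E) : ind E x = 1 := by simp [ind, h]

lemma ind_of_not {E : Set X} {x : X} (h : x ∉ E) : ind E x = 0 := by simp [ind, h]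
/-- four point sum -/

noncomputable def S4 (σ : X → X) (k : ℝ → ℝ≥0∞) (E : Set X) (x y : X) : ℝ≥0∞ :=
  ind E x * ind Eᶜ y * k ‖x - y‖ + ind E (σ x) * ind Eᶜ y * k ‖σ x - y‖ +
  ind E x * ind Eᶜ (σ y) * k ‖x - σ y‖ + ind E (σ x) * ind Eᶜ (σ y) * k ‖σ x - σ y‖

lemma S4_sx (h : Pol σ H) (k : ℝ → ℝ≥0∞) (E : Set X) (x y : X) : S4 σ k E (σ x) y = S4 σ k E x y := by
  simp only [S4, h.inv]; ring

lemma S4_sy (h : Pol σ H) (k : ℝ → ℝ≥0∞) (E : Set X) (x y : X) : S4 σ k E x (σ y) = S4 σ k E x y := by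
  simp only [S4, h.inv]; ring

lemma S4_le (h : Pol σ H) {k : ℝ → ℝ≥0∞} (hk : Antitone k) (E : Set X) (x y : X) :
    S4 σ k (pol σ H E) x y ≤ S4 σ k E x y := by
  wlog hx : x ∈ H generalizing x
  · have := this (σ x) ((h.cover x).resolve_left hx)
    rwa [S4_sx h, S4_sx h] at this
  wlog hy : y ∈ H generalizing y
  · have := this (σ y) ((h.cover y).resolve_left hy)
    rwa [S4_sy h, S4_sy h] at this
  have e1 : ‖σ x - y‖ = ‖x - σ y‖ := by rw [← h.iso, h.inv]
  have hab : k ‖x - σ y‖ ≤ k ‖x - y‖ := hk (h.two x y hx hy)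
  simp only [S4, e1, h.iso x y]
  obtain ⟨hx1, hx2⟩ := h.memH E hx
  obtain ⟨hy1, hy2⟩ := h.memH E hy
  classical
  have key : ∀ z : X, ∀ F : Set X, ind F z = if z ∈ F then 1 else 0 := by
    intro z F; split_ifs with hz
    · exact ind_of_mem hz
    · exact ind_of_not hz
  simp only [key, mem_compl_iff, hx1, hx2, hy1, hy2]
  by_cases p : x ∈ E <;> by_cases q : σ x ∈ E <;> by_cases r : y ∈ E <;> by_cases s : σ y ∈ E <;>
    simp [p, q, r, s, hab, add_comm]

lemma meas_ker {k : ℝ → ℝ≥0∞} (hk : Measurable k) {E F : Set X} (hE : MeasurableSet E)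
    (hF : MeasurableSet F) : Measurable (fun p : X × X => ind E p.1 * ind F p.2 * k ‖p.1 - p.2‖) :=
  (((ind_meas hE).comp measurable_fst).mul ((ind_meas hF).comp measurable_snd)).mul
    (hk.comp (measurable_fst.sub measurable_snd).norm)

lemma PK_S4 (h : Pol σ H) {k : ℝ → ℝ≥0∞} (hk : Measurable k) {E : Set X} (hE : MeasurableSet E) :
    ∫⁻ x, ∫⁻ y, S4 σ k E x y = 4 * PK k E := by
  have m := meas_ker hk hE hE.compl
  have hσ := h.mp.measurable
  have m1 : Measurable (fun p : X × X => ind E (σ p.1) * ind Eᶜ p.2 * k ‖σ p.1 - p.2‖) :=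
    m.comp ((hσ.comp measurable_fst).prodMk measurable_snd)
  have m2 : Measurable (fun p : X × X => ind E p.1 * ind Eᶜ (σ p.2) * k ‖p.1 - σ p.2‖) :=
    m.comp (measurable_fst.prodMk (hσ.comp measurable_snd))
  have m3 : Measurable (fun p : X × X => ind E (σ p.1) * ind Eᶜ (σ p.2) * k ‖σ p.1 - σ p.2‖) :=
    m.comp ((hσ.comp measurable_fst).prodMk (hσ.comp measurable_snd))
  have i0 : Measurable fun x => ∫⁻ y, ind E x * ind Eᶜ y * k ‖x - y‖ := m.lintegral_prod_right'
  have c2 : ∀ x, ∫⁻ y, ind E x * ind Eᶜ (σ y) * k ‖x - σ y‖ =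
      ∫⁻ y, ind E x * ind Eᶜ y * k ‖x - y‖ := fun x =>
    h.lint (fun y => ind E x * ind Eᶜ y * k ‖x - y‖) (m.comp (measurable_const.prodMk measurable_id))
  have c1 : ∫⁻ x, ∫⁻ y, ind E (σ x) * ind Eᶜ y * k ‖σ x - y‖ = PK k E :=
    h.lint (fun x => ∫⁻ y, ind E x * ind Eᶜ y * k ‖x - y‖) i0
  have e : ∀ x, ∫⁻ y, S4 σ k E x y = (∫⁻ y, ind E x * ind Eᶜ y * k ‖x - y‖) +
      (∫⁻ y, ind E (σ x) * ind Eᶜ y * k ‖σ x - y‖) + (∫⁻ y, ind E x * ind Eᶜ y * k ‖x - y‖) +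
      (∫⁻ y, ind E (σ x) * ind Eᶜ y * k ‖σ x - y‖) := by
    intro x
    have hp : Measurable (fun y : X => (x, y)) := measurable_const.prodMk measurable_id
    simp only [S4]
    rw [lintegral_add_left, lintegral_add_left, lintegral_add_left, c2, c2]
    · exact m.comp hp
    · exact (m.comp hp).add (m1.comp hp)
    · exact ((m.comp hp).add (m1.comp hp)).add (m2.comp hp)
  have i1 : Measurable fun x => ∫⁻ y, ind E (σ x) * ind Eᶜ y * k ‖σ x - y‖ := m1.lintegral_prod_right'
  simp_rw [e]
  rw [lintegral_add_left, lintegral_add_left, lintegral_add_left i0, c1]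
  · change PK k E + PK k E + PK k E + PK k E = _; ring
  · exact i0.add i1
  · exact (i0.add i1).add i0

lemma PK_pol (h : Pol σ H) {k : ℝ → ℝ≥0∞} (hk : Antitone k) {E : Set X} (hE : MeasurableSet E) :
    PK k (pol σ H E) ≤ PK k E := by
  have h1 := PK_S4 h hk.measurable (h.meas hE)
  have h2 := PK_S4 h hk.measurable hE
  have : 4 * PK k (pol σ H E) ≤ 4 * PK k E := by
    rw [← h1, ← h2]
    exact lintegral_mono fun x => lintegral_mono fun y => S4_le h hk E x y
  exact (ENNReal.mul_le_mul_iff_right (by norm_num) (by norm_num)).1 this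
/-- two point averaging for sets weighted by radial sets -/

lemma Pol.vol2 (h : Pol σ H) {A : Set X} (hA : MeasurableSet A) :
    2 * volume A = ∫⁻ x, (ind A x + ind A (σ x)) := by
  rw [lintegral_add_left (ind_meas hA), h.lint _ (ind_meas hA)]
  have : ∫⁻ x, ind A x = volume A := by
    have := lintegral_indicator_one (μ := (volume : Measure X)) hA
    exact this
  rw [this, two_mul]

lemma Pol.vol (h : Pol σ H) {E : Set X} (hE : MeasurableSet E) : volume (pol σ H E) = volume E := by
  have h1 := h.vol2 hE
  have h2 := h.vol2 (h.meas hE)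
  have : 2 * volume (pol σ H E) = 2 * volume E := by
    rw [h1, h2]
    congr 1; ext x
    wlog hx : x ∈ H generalizing x
    · have := this (σ x) ((h.cover x).resolve_left hx)
      simp only [h.inv] at this
      rw [add_comm, this, add_comm]
    obtain ⟨a, b⟩ := h.memH E hx
    by_cases p : x ∈ E <;> by_cases q : σ x ∈ E <;>
      simp [ind, Set.indicator, a, b, p, q]
  exact (ENNReal.mul_right_inj (by norm_num) (by norm_num)).1 this
/-- mass in the ball increases, with the gain set. -/

lemma Pol.gain (h : Pol σ H) {E : Set X} (hE : MeasurableSet E) (R : ℝ) :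
    volume (E ∩ Bal 0 R) + volume {x | x ∈ E ∧ R ≤ ‖x‖ ∧ ‖σ x‖ < R ∧ σ x ∉ E}
      ≤ volume (pol σ H E ∩ Bal 0 R) := by
  have hσ := h.mp.measurable
  have mB : MeasurableSet (Bal (0:X) R) := measurableSet_ball
  have mG : MeasurableSet {x | x ∈ E ∧ R ≤ ‖x‖ ∧ ‖σ x‖ < R ∧ σ x ∉ E} :=
    hE.inter ((measurableSet_le measurable_const measurable_norm).inter
      ((measurableSet_lt hσ.norm measurable_const).inter (hσ hE.compl)))
  have h1 := h.vol2 (hE.inter mB)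
  have h2 := h.vol2 ((h.meas hE).inter mB)
  have h3 := h.vol2 mG
  have : 2 * (volume (E ∩ Bal 0 R) + volume {x | x ∈ E ∧ R ≤ ‖x‖ ∧ ‖σ x‖ < R ∧ σ x ∉ E})
      ≤ 2 * volume (pol σ H E ∩ Bal 0 R) := by
    rw [mul_add, h1, h2, h3, ← lintegral_add_left]
    swap; · exact (ind_meas (hE.inter mB)).add ((ind_meas (hE.inter mB)).comp hσ)
    refine lintegral_mono fun x => ?_
    simp only
    wlog hx : x ∈ H generalizing x
    · have := this (σ x) ((h.cover x).resolve_left hx)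
      simp only [h.inv] at this
      rw [add_comm (ind _ x), add_comm (ind _ x), add_comm (ind _ x)]
      exact this
    obtain ⟨a, b⟩ := h.memH E hx
    have hn := h.near x hx
    by_cases p : x ∈ E <;> by_cases q : σ x ∈ E <;> by_cases r : ‖x‖ < R <;> by_cases s : ‖σ x‖ < R <;>
      first
      | (exfalso; linarith)
      | simp [ind, Set.indicator, a, b, p, q, r, s, h.inv, not_le.2, not_lt.1]
  exact (ENNReal.mul_le_mul_iff_right (by norm_num) (by norm_num)).1 this
end P1

noncomputable def refl0 (z : X) : X →ₗ[ℝ] X :=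
  LinearMap.id - (2 / ‖z‖ ^ 2) • ((innerₛₗ ℝ z).smulRight z)

lemma refl0_apply (z x : X) : refl0 z x = x - (2 * inn z x / ‖z‖ ^ 2) • z := by
  simp [refl0, smul_smul]; congr 1; ring

lemma refl0_inner {z : X} (hz : z ≠ 0) (x : X) : inn z (refl0 z x) = - inn z x := by
  have : ‖z‖ ^ 2 ≠ 0 := by positivity
  rw [refl0_apply, inner_sub_right, inner_smul_right, real_inner_self_eq_norm_sq]
  field_simp; ring

lemma refl0_inv {z : X} (hz : z ≠ 0) (x : X) : refl0 z (refl0 z x) = x := by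
  rw [refl0_apply z (refl0 z x), refl0_inner hz, refl0_apply, sub_sub, ← add_smul]
  have : 2 * inn z x / ‖z‖ ^ 2 + 2 * -inn z x / ‖z‖ ^ 2 = 0 := by ring
  rw [this]; simp

lemma refl0_norm {z : X} (hz : z ≠ 0) (x : X) : ‖refl0 z x‖ = ‖x‖ := by
  have h : ‖z‖ ^ 2 ≠ 0 := by positivity
  have : ‖refl0 z x‖ ^ 2 = ‖x‖ ^ 2 := by
    rw [refl0_apply, norm_sub_sq_real, norm_smul, inner_smul_right, mul_pow, Real.norm_eq_abs, sq_abs,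
      real_inner_comm x z]
    field_simp; ring
  exact (sq_eq_sq₀ (norm_nonneg _) (norm_nonneg _)).1 this

noncomputable def reflI {z : X} (hz : z ≠ 0) : X ≃ₗᵢ[ℝ] X :=
  ⟨LinearEquiv.ofInvolutive (refl0 z) (refl0_inv hz), refl0_norm hz⟩
/-- affine reflection -/

noncomputable def rf (z : X) (κ : ℝ) (x : X) : X := refl0 z x + κ • z

lemma rf_eq (z : X) (κ : ℝ) (x : X) : rf z κ x = x + (κ - 2 * inn z x / ‖z‖ ^ 2) • z := by
  rw [rf, refl0_apply, sub_smul]; abel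

lemma rf_norm {z : X} (hz : z ≠ 0) (κ : ℝ) (x : X) :
    ‖rf z κ x‖ ^ 2 = ‖x‖ ^ 2 + (κ - 2 * inn z x / ‖z‖ ^ 2) * κ * ‖z‖ ^ 2 := by
  have h : ‖z‖ ^ 2 ≠ 0 := by positivity
  rw [rf_eq, norm_add_sq_real, norm_smul, inner_smul_right, mul_pow, Real.norm_eq_abs, sq_abs,
    real_inner_comm x z]
  field_simp; ring

lemma rf_pol {z : X} (hz : z ≠ 0) {κ : ℝ} (hκ : κ ≠ 0) : Pol (rf z κ) {p | ‖p‖ ≤ ‖rf z κ p‖} := by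
  have hz2 : 0 < ‖z‖ ^ 2 := by positivity
  have mp : MeasurePreserving (rf z κ) volume volume :=
    (measurePreserving_add_right volume (κ • z)).comp (reflI hz).measurePreserving
  have inv : ∀ x, rf z κ (rf z κ x) = x := by
    intro x
    have e : refl0 z (κ • z) = -(κ • z) := by
      rw [refl0_apply, inner_smul_right, real_inner_self_eq_norm_sq, mul_left_comm,
        mul_div_assoc, mul_div_cancel_right₀ _ hz2.ne']
      module
    rw [rf, rf, map_add, refl0_inv hz, e]; abel
  have memH : ∀ p, ‖p‖ ≤ ‖rf z κ p‖ ↔ 0 ≤ (κ - 2 * inn z p / ‖z‖ ^ 2) * κ := by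
    intro p
    rw [← sq_le_sq₀ (norm_nonneg _) (norm_nonneg _), rf_norm hz, le_add_iff_nonneg_right,
      mul_nonneg_iff_of_pos_right hz2]
  refine ⟨mp, inv, ?_, ?_, ?_, ?_, ?_, ?_⟩
  · intro x y
    rw [rf, rf, add_sub_add_right_eq_sub, ← map_sub, refl0_norm hz]
  · exact measurableSet_le measurable_norm mp.measurable.norm
  · intro x
    simp only [mem_setOf_eq, inv]; exact le_total _ _
  · intro x h1 h2
    simp only [mem_setOf_eq, inv] at h1 h2
    have h3 : ‖rf z κ x‖ = ‖x‖ := le_antisymm h2 h1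
    have h4 := rf_norm hz κ x
    rw [h3] at h4
    have h5 : (κ - 2 * inn z x / ‖z‖ ^ 2) = 0 := by
      have : (κ - 2 * inn z x / ‖z‖ ^ 2) * κ * ‖z‖ ^ 2 = 0 := by linarith
      simpa [hκ, hz2.ne'] using this
    rw [rf_eq, h5]; simp
  · intro x y hx hy
    simp only [mem_setOf_eq] at hx hy
    rw [memH] at hx hy
    rw [← sq_le_sq₀ (norm_nonneg _) (norm_nonneg _), rf_eq, ← sub_sub, norm_sub_sq_real (x - y), norm_smul,
      inner_smul_right, mul_pow, Real.norm_eq_abs, sq_abs, real_inner_comm z (x - y), inner_sub_right]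
    set a := inn z x
    set b := inn z y
    have key : 0 ≤ (κ - 2 * a / ‖z‖ ^ 2) * (κ - 2 * b / ‖z‖ ^ 2) := by
      have := mul_nonneg hx hy
      have hk2 : 0 < κ ^ 2 := by positivity
      have e : (κ - 2 * a / ‖z‖ ^ 2) * κ * ((κ - 2 * b / ‖z‖ ^ 2) * κ) =
        (κ - 2 * a / ‖z‖ ^ 2) * (κ - 2 * b / ‖z‖ ^ 2) * κ ^ 2 := by ring
      rw [e] at this
      exact (mul_nonneg_iff_of_pos_right hk2).1 this
    have e2 : -(2 * ((κ - 2 * b / ‖z‖ ^ 2) * (a - b))) + (κ - 2 * b / ‖z‖ ^ 2) ^ 2 * ‖z‖ ^ 2 =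
      (κ - 2 * a / ‖z‖ ^ 2) * (κ - 2 * b / ‖z‖ ^ 2) * ‖z‖ ^ 2 := by
      field_simp; ring
    have := mul_nonneg key hz2.le
    linarith
  · intro x hx; exact hx

lemma rf_meas : Measurable (fun p : X × ℝ × X => rf p.1 p.2.1 p.2.2) := by
  simp only [rf_eq]
  have h1 : Measurable (fun p : X × ℝ × X => (inn p.1 p.2.2 : ℝ)) :=
    (continuous_fst.inner (continuous_snd.comp continuous_snd)).measurable
  have h2 : Measurable (fun p : X × ℝ × X => ‖p.1‖ ^ 2) := (measurable_fst.norm).pow_const 2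
  have h3 : Measurable (fun p : X × ℝ × X => p.2.1) := measurable_snd.fst
  exact measurable_snd.snd.add ((h3.sub ((h1.const_mul 2).div h2)).smul measurable_fst)
attribute [irreducible] rf

lemma rf_meas' {B : Set X} (hB : MeasurableSet B) {Z : Type*} [MeasurableSpace Z] {f : Z → X} {g : Z → ℝ} {h : Z → X}
    (hf : Measurable f) (hg : Measurable g) (hh : Measurable h) : Measurable fun p => ind B (rf (f p) (g p) (h p)) := by
  have h1 : Measurable fun p => (f p, g p, h p) := hf.prodMk (hg.prodMk hh)
  have h2 : Measurable fun p => rf (f p) (g p) (h p) := rf_meas.comp h1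
  exact (ind_meas hB).comp h2

lemma vol_ind {A : Set X} (hA : MeasurableSet A) : volume A = ∫⁻ x, ind A x :=
  (lintegral_indicator_one hA).symm
set_option maxHeartbeats 1000000 in

lemma exists_gain [Nontrivial X] {L : ℝ} (hL : 0 < L) {δ : ℝ≥0∞} (hδ : δ ≠ 0) : ∃ c : ℝ≥0∞, c ≠ 0 ∧
    ∀ A B : Set X, MeasurableSet A → MeasurableSet B → A ⊆ Bal 0 L → B ⊆ Bal 0 L →
      δ ≤ volume A → δ ≤ volume B →
      ∃ z : X, z ≠ 0 ∧ ∃ κ : ℝ, c ≤ volume {x | x ∈ A ∧ rf z κ x ∈ B} := by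
  by_cases hδt : δ = ⊤
  · refine ⟨1, one_ne_zero, fun A B hA hB hAL hBL h1 h2 => ?_⟩
    have := (measure_mono (μ := volume) hAL).trans_lt (Metric.isBounded_ball (x := (0:X)) (r := L)).measure_lt_top
    rw [hδt] at h1; exact absurd (h1.trans_lt this) (by simp)
  set n := frk X
  set η : ℝ≥0∞ := oR ((2 ^ n)⁻¹) * δ with hη
  have hη0 : η ≠ 0 := mul_ne_zero (by simp) hδ
  have hηt : η ≠ ⊤ := ENNReal.mul_ne_top (by simp) hδt
  obtain ⟨ρ, hρ, hρη⟩ : ∃ ρ : ℝ, 0 < ρ ∧ volume (Bal (0:X) ρ) ≤ η / 2 := by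
    have h1 : Tendsto (fun r : ℝ => volume (Metric.closedBall (0:X) r)) (𝓝[>] 0) (𝓝 (volume {(0:X)})) := by
      have := tendsto_measure_biInter_gt (μ := (volume : Measure X)) (s := fun r : ℝ => Metric.closedBall (0:X) r)
        (a := 0) (fun r _ => Metric.isClosed_closedBall.measurableSet.nullMeasurableSet)
        (fun i j _ hij => Metric.closedBall_subset_closedBall hij)
        ⟨1, one_pos, (Metric.isBounded_closedBall).measure_lt_top.ne⟩
      have hs : {(0:X)} = ⋂ r > (0:ℝ), Metric.closedBall (0:X) r := ?_
      · rw [hs]; exact this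
      ext x; simp only [mem_singleton_iff, mem_iInter, Metric.mem_closedBall, dist_zero_right]
      constructor
      · rintro rfl r hr; simpa using hr.le
      · intro h; exact norm_le_zero_iff.1 (le_of_forall_gt_imp_ge_of_dense h)
    rw [measure_singleton] at h1
    have h2 := (h1.eventually (gt_mem_nhds (ENNReal.half_pos hη0))).and self_mem_nhdsWithin
    obtain ⟨ρ, h3, h4⟩ := h2.exists
    exact ⟨ρ, h4, (measure_mono Metric.ball_subset_closedBall).trans h3.le⟩
  set M : ℝ := 2 + 2 * L / ρ with hM
  set D : Set X := Metric.closedBall 0 (2 * L) \ Bal 0 ρ with hD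
  have mD : MeasurableSet D := Metric.isClosed_closedBall.measurableSet.diff measurableSet_ball
  have hDt : volume D < ⊤ := (measure_mono diff_subset).trans_lt (Metric.isBounded_closedBall).measure_lt_top
  set K : Set ℝ := Icc (-M) M
  set V : ℝ≥0∞ := volume D * volume K
  have hV : V ≠ ⊤ := ENNReal.mul_ne_top hDt.ne (by simp [K])
  obtain ⟨c, hc0, hcV⟩ : ∃ c : ℝ≥0∞, c ≠ 0 ∧ c * V < δ * (η / 2) := by
    have hp : δ * (η / 2) ≠ 0 := mul_ne_zero hδ (ENNReal.half_pos hη0).ne'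
    by_cases hV0 : V = 0
    · exact ⟨1, one_ne_zero, by rw [hV0, mul_zero]; exact pos_iff_ne_zero.2 hp⟩
    refine ⟨δ * (η / 2) / 2 / V, ?_, ?_⟩
    · exact (ENNReal.div_pos (ENNReal.half_pos hp).ne' hV).ne'
    · rw [ENNReal.div_mul_cancel hV0 hV]
      exact ENNReal.half_lt_self hp (ENNReal.mul_ne_top hδt (ENNReal.div_ne_top hηt (by norm_num)))
  refine ⟨c, hc0, fun A B hA hB hAL hBL h1 h2 => ?_⟩
  by_contra hcon
  push Not at hcon
  have hvol : ∀ z κ, volume {x | x ∈ A ∧ rf z κ x ∈ B} = ∫⁻ x, ind A x * ind B (rf z κ x) := by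
    intro z κ
    have mz : Measurable (fun x : X => rf z κ x) :=
      Measurable.comp (g := fun p : X × ℝ × X => rf p.1 p.2.1 p.2.2) (f := fun x => (z, κ, x)) rf_meas (by fun_prop)
    have : MeasurableSet {x | x ∈ A ∧ rf z κ x ∈ B} := hA.inter (mz hB)
    rw [vol_ind this]
    congr 1; ext x
    by_cases p : x ∈ A <;> by_cases q : rf z κ x ∈ B <;> simp [ind, Set.indicator, p, q]
  have up : ∫⁻ z in D, ∫⁻ κ in K, ∫⁻ x, ind A x * ind B (rf z κ x) ≤ c * V := by
    calc _ ≤ ∫⁻ z in D, ∫⁻ κ in K, c := by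
          refine setLIntegral_mono' mD fun z hz => lintegral_mono fun κ => ?_
          rw [← hvol]
          refine (hcon z ?_ κ).le
          rintro rfl; exact hz.2 (by simpa using hρ)
      _ = c * V := by simp [V, mul_comm, mul_left_comm]
  have swap : ∫⁻ z in D, ∫⁻ κ in K, ∫⁻ x, ind A x * ind B (rf z κ x) =
      ∫⁻ x, ind A x * ∫⁻ z in D, ∫⁻ κ in K, ind B (rf z κ x) := by
    have e1 : ∀ z, ∫⁻ κ in K, ∫⁻ x, ind A x * ind B (rf z κ x) =
        ∫⁻ x, ∫⁻ κ in K, ind A x * ind B (rf z κ x) := fun z => by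
      rw [lintegral_lintegral_swap]
      exact (((ind_meas hA).comp measurable_snd).mul
        (rf_meas' hB measurable_const measurable_fst measurable_snd)).aemeasurable
    simp_rw [e1]
    rw [lintegral_lintegral_swap]
    · congr 1; ext x
      rw [← lintegral_const_mul]
      · congr 1; ext z
        rw [lintegral_const_mul]
        exact rf_meas' hB measurable_const measurable_id measurable_const
      · exact Measurable.lintegral_prod_right' (f := fun p : X × ℝ => ind B (rf p.1 p.2 x))
          (rf_meas' hB measurable_fst measurable_snd measurable_const)
    · apply Measurable.aemeasurable
      exact Measurable.lintegral_prod_right' (f := fun q : (X × X) × ℝ => ind A q.1.2 * ind B (rf q.1.1 q.2 q.1.2))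
        (((ind_meas hA).comp measurable_fst.snd).mul (rf_meas' hB measurable_fst.fst measurable_snd measurable_fst.snd))
  have low : ∀ x ∈ A, η / 2 ≤ ∫⁻ z in D, ∫⁻ κ in K, ind B (rf z κ x) := by
    intro x hx
    have hxL : ‖x‖ < L := by simpa using hAL hx
    have a1 : ∀ z ∈ D, ∫⁻ l in Icc (1:ℝ) 2, ind B (x + l • z) ≤ ∫⁻ κ in K, ind B (rf z κ x) := by
      intro z hz
      have hzρ : ρ ≤ ‖z‖ := by simpa using hz.2
      have hz0 : 0 < ‖z‖ := hρ.trans_le hzρ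
      set τ := 2 * inn z x / ‖z‖ ^ 2 with hτ
      have hτb : |τ| ≤ 2 * L / ρ := by
        rw [hτ, abs_div, abs_mul, abs_of_pos (by positivity : (0:ℝ) < ‖z‖ ^ 2), abs_two,
          div_le_div_iff₀ (by positivity) hρ]
        have := abs_real_inner_le_norm z x
        nlinarith [mul_le_mul hzρ hxL.le (norm_nonneg x) hz0.le, abs_nonneg (inn z x : ℝ), norm_nonneg x,
          mul_le_mul_of_nonneg_left this hρ.le, mul_nonneg hz0.le (mul_nonneg hz0.le hL.le), mul_le_mul_of_nonneg_left (mul_le_mul hzρ hxL.le (norm_nonneg x) hz0.le) hz0.le]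
      rw [← lintegral_indicator measurableSet_Icc, ← lintegral_indicator measurableSet_Icc,
        ← lintegral_add_right_eq_self (fun κ => (Icc (-M) M).indicator (fun κ => ind B (rf z κ x)) κ) τ]
      refine lintegral_mono fun l => ?_
      by_cases hl : l ∈ Icc (1:ℝ) 2
      · have : l + τ ∈ K := by
          have := abs_le.1 hτb
          constructor <;> linarith [hl.1, hl.2]
        rw [indicator_of_mem hl, indicator_of_mem this, rf_eq, ← hτ, add_sub_cancel_right]
      · rw [indicator_of_notMem hl]; exact zero_le
    have a2 : ∀ l ∈ Icc (1:ℝ) 2, η / 2 ≤ ∫⁻ z in D, ind B (x + l • z) := by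
      intro l hl
      have hl0 : (0:ℝ) < l := by linarith [hl.1]
      have mS : MeasurableSet ((fun z : X => x + l • z) ⁻¹' B) :=
        (measurable_const.add (measurable_id.const_smul l)) hB
      have v1 : η ≤ volume ((fun z : X => x + l • z) ⁻¹' B) := by
        have : (fun z : X => x + l • z) ⁻¹' B = (fun z => l • z) ⁻¹' ((fun y => x + y) ⁻¹' B) := rfl
        rw [this, Measure.addHaar_preimage_smul _ hl0.ne', measure_preimage_add, hη]
        refine mul_le_mul' (ENNReal.ofReal_le_ofReal ?_) h2
        rw [abs_of_pos (by positivity)]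
        exact inv_anti₀ (by positivity) (pow_le_pow_left₀ hl0.le hl.2 n)
      have v2 : ∫⁻ z in D, ind B (x + l • z) = volume (((fun z : X => x + l • z) ⁻¹' B) ∩ D) := by
        rw [← Measure.restrict_apply mS, ← lintegral_indicator_one mS]; rfl
      have v3 : (fun z : X => x + l • z) ⁻¹' B ⊆ (((fun z : X => x + l • z) ⁻¹' B) ∩ D) ∪ Bal 0 ρ := by
        intro z hz
        by_cases hzr : z ∈ Bal (0:X) ρ
        · exact Or.inr hzr
        refine Or.inl ⟨hz, ?_, hzr⟩
        have : ‖x + l • z‖ < L := by simpa using hBL hz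
        have h5 : ‖l • z‖ ≤ ‖x + l • z‖ + ‖x‖ := by
          have := norm_sub_le (x + l • z) x; rwa [add_sub_cancel_left] at this
        rw [norm_smul, Real.norm_of_nonneg hl0.le] at h5
        simp only [Metric.mem_closedBall, dist_zero_right]
        nlinarith [norm_nonneg z, hl.1]
      rw [v2]
      have v4 := v1.trans ((measure_mono v3).trans (measure_union_le _ _))
      have v5 : η / 2 + η / 2 ≤ volume ((fun z : X => x + l • z) ⁻¹' B ∩ D) + η / 2 := by
        rw [ENNReal.add_halves]; exact v4.trans (by gcongr)
      exact (ENNReal.add_le_add_iff_right (ENNReal.div_ne_top hηt (by norm_num))).1 v5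
    calc η / 2 = ∫⁻ l in Icc (1:ℝ) 2, η / 2 := by simp; norm_num
      _ ≤ ∫⁻ l in Icc (1:ℝ) 2, ∫⁻ z in D, ind B (x + l • z) := setLIntegral_mono' measurableSet_Icc a2
      _ = ∫⁻ z in D, ∫⁻ l in Icc (1:ℝ) 2, ind B (x + l • z) := by
          apply lintegral_lintegral_swap
          apply Measurable.aemeasurable
          exact (ind_meas hB).comp (measurable_const.add (measurable_fst.smul measurable_snd))
      _ ≤ _ := setLIntegral_mono' mD a1
  have : δ * (η / 2) ≤ c * V := by
    refine le_trans ?_ (swap ▸ up)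
    calc δ * (η / 2) ≤ volume A * (η / 2) := by gcongr
      _ = ∫⁻ x, ind A x * (η / 2) := by
          rw [lintegral_mul_const _ (ind_meas hA)]
          congr 1; exact (lintegral_indicator_one hA).symm
      _ ≤ _ := by
          refine lintegral_mono fun x => ?_
          by_cases hx : x ∈ A
          · gcongr; exact low x hx
          · simp [ind_of_not hx]
  exact absurd this (not_le.2 hcV)

lemma vol_ball_lt_top (x : X) (r : ℝ) : volume (Bal x r) < ⊤ := Metric.isBounded_ball.measure_lt_top

lemma exists_tail {E : Set X} (hE : MeasurableSet E) (hfin : volume E ≠ ⊤) {δ : ℝ≥0∞} (hδ : δ ≠ 0) :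
    ∃ L : ℝ, ∀ L' ≥ L, volume (E \ Bal 0 L') ≤ δ := by
  have h1 : Tendsto (fun n : ℕ => volume (E \ Bal 0 n)) atTop (𝓝 (volume (⋂ n : ℕ, E \ Bal (0:X) n))) :=
    tendsto_measure_iInter_atTop (fun n => (hE.diff measurableSet_ball).nullMeasurableSet)
      (fun m n hmn => diff_subset_diff_right (Metric.ball_subset_ball (by exact_mod_cast hmn)))
      ⟨0, ((measure_mono diff_subset).trans_lt hfin.lt_top).ne⟩
  have h2 : (⋂ n : ℕ, E \ Bal (0:X) n) = ∅ := by
    ext x; simp only [mem_iInter, mem_empty_iff_false, iff_false, not_forall]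
    obtain ⟨n, hn⟩ := exists_nat_gt ‖x‖
    exact ⟨n, fun h => h.2 (by simpa using hn)⟩
  rw [h2, measure_empty] at h1
  obtain ⟨n, hn⟩ := (h1.eventually (gt_mem_nhds (pos_iff_ne_zero.2 hδ))).exists
  exact ⟨n, fun L' hL' => (measure_mono (diff_subset_diff_right (Metric.ball_subset_ball hL'))).trans hn.le⟩

theorem pol_conv [Nontrivial X] (Q : Set X → Prop)
    (hQ : ∀ (σ : X → X) (H : Set X), Pol σ H → ∀ E, MeasurableSet E → Q E → Q (pol σ H E))
    {E : Set X} (hE : MeasurableSet E) (hQE : Q E) {R : ℝ}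
    (hv : volume E = volume (Bal (0:X) R)) {δ : ℝ≥0∞} (hδ : δ ≠ 0) :
    ∃ E', MeasurableSet E' ∧ Q E' ∧ volume E' = volume E ∧ volume (E' \ Bal 0 R) ≤ δ := by
  by_contra hcon
  push Not at hcon
  have hEt : volume E ≠ ⊤ := hv ▸ (vol_ball_lt_top _ _).ne
  have mB : ∀ r, MeasurableSet (Bal (0:X) r) := fun r => measurableSet_ball
  by_cases hδt : δ = ⊤
  · exact absurd (hcon E hE hQE rfl) (by simp [hδt])
  have hδ2 : δ / 2 ≠ 0 := (ENNReal.half_pos hδ).ne'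
  have hδ2t : δ / 2 ≠ ⊤ := ENNReal.div_ne_top hδt (by norm_num)
  obtain ⟨L0, hL0⟩ := exists_tail hE hEt hδ2
  set L := max L0 (max R 1) with hLdef
  have hLR : R ≤ L := le_max_of_le_right (le_max_left _ _)
  have hL : 0 < L := lt_of_lt_of_le one_pos (le_max_of_le_right (le_max_right _ _))
  have hLt := hL0 L (le_max_left _ _)
  obtain ⟨c, hc0, hc⟩ := exists_gain (X := X) hL hδ2
  have step : ∀ n : ℕ, ∃ E', MeasurableSet E' ∧ Q E' ∧ volume E' = volume E ∧
      volume (E ∩ Bal 0 L) ≤ volume (E' ∩ Bal 0 L) ∧ n * c ≤ volume (E' ∩ Bal 0 R) := by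
    intro n
    induction n with
    | zero => exact ⟨E, hE, hQE, rfl, le_rfl, by simp⟩
    | succ n ih =>
      obtain ⟨E', mE', qE', vE', tE', nE'⟩ := ih
      have hE't : volume E' ≠ ⊤ := vE' ▸ hEt
      have big := hcon E' mE' qE' vE'
      have hsub : ∀ {F : Set X} (r : ℝ), MeasurableSet F → volume (F ∩ Bal 0 r) + volume (F \ Bal 0 r) = volume F :=
        fun r hF => measure_inter_add_diff _ (mB r)
      have tail : volume (E' \ Bal 0 L) ≤ δ / 2 := by
        have h1 := hsub L mE'; have h2 := hsub L hE
        have fin : volume (E' ∩ Bal 0 L) ≠ ⊤ := ((measure_mono inter_subset_left).trans_lt hE't.lt_top).ne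
        refine le_trans ?_ hLt
        rw [vE', ← h2] at h1
        have : volume (E ∩ Bal 0 L) + volume (E' \ Bal 0 L) ≤
            volume (E ∩ Bal 0 L) + volume (E \ Bal 0 L) := by
          rw [← h1]; gcongr
        exact (ENNReal.add_le_add_iff_left ((measure_mono inter_subset_left).trans_lt hEt.lt_top).ne).1 this
      have hA : δ / 2 ≤ volume ((E' \ Bal 0 R) ∩ Bal 0 L) := by
        have h1 := hsub L (mE'.diff (mB R))
        have h2 : volume ((E' \ Bal 0 R) \ Bal 0 L) ≤ δ / 2 :=
          (measure_mono (diff_subset_diff_left diff_subset)).trans tail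
        have : δ / 2 + δ / 2 ≤ volume ((E' \ Bal 0 R) ∩ Bal 0 L) + δ / 2 := by
          rw [ENNReal.add_halves]; refine big.le.trans ?_; rw [← h1]; gcongr
        exact (ENNReal.add_le_add_iff_right hδ2t).1 this
      have hB : δ / 2 ≤ volume (Bal 0 R \ E') := by
        have h1 : volume (Bal 0 R ∩ E') + volume (Bal 0 R \ E') = volume (Bal (0:X) R) :=
          measure_inter_add_diff _ mE'
        have h2 := hsub R mE'
        rw [vE', hv, ← h1, inter_comm] at h2
        have h3 := (ENNReal.add_right_inj ((measure_mono inter_subset_left).trans_lt (vol_ball_lt_top _ _)).ne).1 h2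
        rw [← h3]; exact ENNReal.half_le_self.trans big.le
      obtain ⟨z, hz, κ, hκ⟩ := hc _ _ ((mE'.diff (mB R)).inter (mB L)) ((mB R).diff mE') inter_subset_right
        (diff_subset.trans (Metric.ball_subset_ball hLR)) hA hB
      have hκ0 : κ ≠ 0 := by
        rintro rfl
        have : {x | x ∈ (E' \ Bal 0 R) ∩ Bal 0 L ∧ rf z 0 x ∈ Bal 0 R \ E'} = ∅ := by
          ext x; simp only [mem_setOf_eq, mem_empty_iff_false, iff_false]
          rintro ⟨⟨⟨-, h1⟩, -⟩, ⟨h2, -⟩⟩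
          have h3 := rf_norm hz 0 x
          simp only [mul_zero, zero_mul, add_zero] at h3
          have h4 := (sq_eq_sq₀ (norm_nonneg _) (norm_nonneg _)).1 h3
          apply h1; simpa [h4] using h2
        rw [this, measure_empty] at hκ
        exact hc0 (le_antisymm hκ zero_le)
      have P := rf_pol hz hκ0
      refine ⟨_, P.meas mE', hQ _ _ P _ mE' qE', (P.vol mE').trans vE', tE'.trans ?_, ?_⟩
      · exact le_trans le_self_add (P.gain mE' L)
      · refine le_trans ?_ (P.gain mE' R)
        push_cast; rw [add_mul, one_mul]
        refine add_le_add nE' (hκ.trans (measure_mono ?_))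
        rintro x ⟨⟨⟨h1, h2⟩, -⟩, h3, h4⟩
        exact ⟨h1, by simpa using h2, by simpa using h3, h4⟩
  have hfin := vol_ball_lt_top (0:X) R
  obtain ⟨n, hn⟩ : ∃ n : ℕ, volume (Bal (0:X) R) < n * c := by
    by_cases hct : c = ⊤
    · exact ⟨1, by simpa [hct] using hfin⟩
    obtain ⟨n, hn⟩ := ENNReal.exists_nat_gt (ENNReal.div_lt_top hfin.ne hc0).ne
    exact ⟨n, (ENNReal.div_lt_iff (Or.inl hc0) (Or.inl hct)).1 hn⟩
  obtain ⟨E', -, -, -, -, h⟩ := step n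
  exact absurd (h.trans (measure_mono inter_subset_right)) (not_le.2 hn)

noncomputable def kM (k : ℝ → ℝ≥0∞) (M : ℕ) (r : ℝ) : ℝ≥0∞ := if r < M then min (k r) M else 0

lemma kM_anti {k : ℝ → ℝ≥0∞} (hk : Antitone k) (M : ℕ) : Antitone (kM k M) := by
  intro a b hab
  simp only [kM]
  split_ifs with h1 h2
  · exact min_le_min_right _ (hk hab)
  · exact absurd (hab.trans_lt h1) h2
  · exact zero_le
  · exact le_rfl

lemma kM_mono (k : ℝ → ℝ≥0∞) (r : ℝ) : Monotone (fun M : ℕ => kM k M r) := by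
  intro a b hab
  have : (a:ℝ) ≤ b := by exact_mod_cast hab
  simp only [kM]
  split_ifs with h1 h2
  · exact min_le_min_left _ (by exact_mod_cast hab)
  · exact absurd (h1.trans_le this) h2
  · exact zero_le
  · exact le_rfl

lemma kM_sup (k : ℝ → ℝ≥0∞) (r : ℝ) : ⨆ M : ℕ, kM k M r = k r := by
  apply le_antisymm
  · refine iSup_le fun M => ?_
    simp only [kM]; split_ifs
    · exact min_le_left _ _
    · exact zero_le
  · refine le_of_forall_lt fun c hc => ?_
    obtain ⟨M1, h1⟩ := ENNReal.exists_nat_gt hc.ne_top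
    obtain ⟨M2, h2⟩ := exists_nat_gt r
    have h3 : r < (max M1 M2 : ℕ) := h2.trans_le (by exact_mod_cast le_max_right _ _)
    refine lt_of_lt_of_le ?_ (le_iSup _ (max M1 M2))
    simp only [kM, if_pos h3]
    exact lt_min hc (h1.trans_le (by exact_mod_cast le_max_left _ _))

lemma PK_sup {k : ℝ → ℝ≥0∞} (hk : Antitone k) {E : Set X} (hE : MeasurableSet E) :
    PK k E = ⨆ M : ℕ, PK (kM k M) E := by
  have mM : ∀ M, Measurable (kM k M) := fun M => (kM_anti hk M).measurable
  have m := fun M => meas_ker (X := X) (mM M) hE hE.compl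
  simp only [PK]
  rw [← lintegral_iSup (fun M => (m M).lintegral_prod_right')]
  · congr 1; ext x
    refine Eq.trans ?_ (lintegral_iSup (f := fun M y => ind E x * ind Eᶜ y * kM k M ‖x - y‖) (fun M => (m M).comp measurable_prodMk_left) ?_)
    · congr 1; ext y
      rw [← ENNReal.mul_iSup, kM_sup]
    · intro a b hab y
      exact mul_le_mul_right (kM_mono k _ hab) _
  · intro a b hab x
    exact lintegral_mono fun y => mul_le_mul_right (kM_mono k _ hab) _

theorem riesz [Nontrivial X] {k : ℝ → ℝ≥0∞} (hk : Antitone k) {E : Set X} (hE : MeasurableSet E) {R : ℝ}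
    (hv : volume E = volume (Bal (0:X) R)) : PK k (Bal (0:X) R) ≤ PK k E := by
  have mB : MeasurableSet (Bal (0:X) R) := measurableSet_ball
  rw [PK_sup hk hE, PK_sup hk mB]
  refine iSup_mono fun M => ?_
  set j := kM k M with hj
  have hja : Antitone j := kM_anti hk M
  set C : ℝ≥0∞ := M * volume (Bal (0:X) M)
  have hC : C ≠ ⊤ := ENNReal.mul_ne_top (by simp) (vol_ball_lt_top _ _).ne
  have jb : ∀ x : X, ∫⁻ y, j ‖x - y‖ ≤ C := by
    intro x
    rw [lintegral_sub_left_eq_self (fun y => j ‖y‖) x]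
    calc ∫⁻ y, j ‖y‖ ≤ ∫⁻ y, (Bal (0:X) M).indicator (fun _ => (M:ℝ≥0∞)) y := by
          refine lintegral_mono fun y => ?_
          by_cases h : ‖y‖ < M
          · simp [hj, kM, h]
          · simp [hj, kM, h]
      _ = C := by rw [lintegral_indicator measurableSet_ball]; simp [C]
  refine ENNReal.le_of_forall_pos_le_add fun ε hε _ => ?_
  obtain ⟨δ, hδ0, hδ⟩ : ∃ δ : ℝ≥0∞, δ ≠ 0 ∧ C * (4 * δ) ≤ ε := by
    refine ⟨ε / (4 * (C + 1)), (ENNReal.div_pos (by simpa using hε.ne') (by finiteness)).ne', ?_⟩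
    calc C * (4 * (ε / (4 * (C + 1)))) ≤ (4 * (C+1)) * (ε / (4 * (C + 1))) := by
          rw [← mul_assoc, mul_comm C 4]; gcongr; exact le_self_add
      _ ≤ ε := ENNReal.mul_div_le
  obtain ⟨E', mE', qE', vE', dE'⟩ := pol_conv (fun F => PK j F ≤ PK j E)
    (fun σ H P F mF h => (PK_pol P hja mF).trans h) hE le_rfl hv hδ0
  have dE2 : volume (Bal 0 R \ E') ≤ δ := by
    have h1 : volume (Bal 0 R ∩ E') + volume (Bal 0 R \ E') = volume (Bal (0:X) R) :=
      measure_inter_add_diff _ mE'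
    have h2 : volume (E' ∩ Bal 0 R) + volume (E' \ Bal 0 R) = volume E' := measure_inter_add_diff _ mB
    rw [vE', hv, ← h1, inter_comm] at h2
    have h3 := (ENNReal.add_right_inj ((measure_mono inter_subset_left).trans_lt (vol_ball_lt_top _ _)).ne).1 h2
    rwa [← h3]
  set D : Set X := (E' \ Bal 0 R) ∪ (Bal 0 R \ E') with hD
  have mD : MeasurableSet D := (mE'.diff mB).union (mB.diff mE')
  have hDv : volume D ≤ 2 * δ := (measure_union_le _ _).trans (by rw [two_mul]; gcongr)
  have key : PK j (Bal (0:X) R) ≤ PK j E' + (C * volume D + C * volume D) := by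
    have mj := hja.measurable
    have m1 : Measurable (fun p : X × X => ind D p.1 * j ‖p.1 - p.2‖) :=
      ((ind_meas mD).comp measurable_fst).mul (mj.comp (measurable_fst.sub measurable_snd).norm)
    have m2 : Measurable (fun p : X × X => ind D p.2 * j ‖p.1 - p.2‖) :=
      ((ind_meas mD).comp measurable_snd).mul (mj.comp (measurable_fst.sub measurable_snd).norm)
    have m0 := meas_ker (X := X) mj mE' mE'.compl
    calc PK j (Bal (0:X) R) ≤ ∫⁻ x, ∫⁻ y, (ind E' x * ind E'ᶜ y * j ‖x - y‖ +
            (ind D x * j ‖x - y‖ + ind D y * j ‖x - y‖)) := by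
          refine lintegral_mono fun x => lintegral_mono fun y => ?_
          simp only [← add_mul]
          gcongr
          by_cases a : x ∈ E' <;> by_cases b : y ∈ E' <;> by_cases c : ‖x‖ < R <;> by_cases d : ‖y‖ < R <;>
            simp [ind, Set.indicator, a, b, c, d, hD]
      _ = PK j E' + ((∫⁻ x, ∫⁻ y, ind D x * j ‖x - y‖) + ∫⁻ x, ∫⁻ y, ind D y * j ‖x - y‖) := by
          have : ∀ x : X, ∫⁻ y, (ind E' x * ind E'ᶜ y * j ‖x - y‖ + (ind D x * j ‖x - y‖ + ind D y * j ‖x - y‖)) =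
            (∫⁻ y, ind E' x * ind E'ᶜ y * j ‖x - y‖) + ((∫⁻ y, ind D x * j ‖x - y‖) + ∫⁻ y, ind D y * j ‖x - y‖) := by
            intro x
            rw [lintegral_add_left, lintegral_add_left]
            · exact m1.comp measurable_prodMk_left
            · exact m0.comp measurable_prodMk_left
          simp_rw [this]
          rw [lintegral_add_left, lintegral_add_left]
          · rfl
          · exact m1.lintegral_prod_right'
          · exact m0.lintegral_prod_right'
      _ ≤ PK j E' + (C * volume D + C * volume D) := by
          have a1 : ∫⁻ x, ∫⁻ y, ind D x * j ‖x - y‖ ≤ C * volume D := by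
            rw [vol_ind mD, mul_comm, ← lintegral_mul_const _ (ind_meas mD)]
            refine lintegral_mono fun x => ?_
            simp only
            rw [lintegral_const_mul]
            · gcongr; exact jb x
            · exact mj.comp (measurable_const.sub measurable_id).norm
          gcongr
          rw [lintegral_lintegral_swap m2.aemeasurable]
          simp_rw [norm_sub_rev _ _] at a1 ⊢
          exact a1
  calc PK j (Bal (0:X) R) ≤ PK j E' + (C * volume D + C * volume D) := key
    _ ≤ PK j E + C * (4 * δ) := by
        refine add_le_add qE' ?_
        rw [← mul_add]; gcongr
        calc volume D + volume D ≤ 2 * δ + 2 * δ := by gcongr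
          _ = 4 * δ := by ring
    _ ≤ _ := by gcongr

noncomputable def om (n : ℕ) : ℝ := √Real.pi ^ n / Real.Gamma (n / 2 + 1)

theorem om_pos (n : ℕ) : 0 < om n := by
  unfold om
  have := Real.Gamma_pos_of_pos (s := (n:ℝ)/2+1) (by positivity)
  have := Real.pi_pos
  positivity

theorem vol_ball_om {n : ℕ} (hn : frk X = n) (x : X) {r : ℝ} (hr : 0 < r) :
    volume (Bal x r) = oR (om n * r ^ n) := by
  subst hn
  rcases subsingleton_or_nontrivial X with h | h
  · have h0 : frk X = 0 := Module.finrank_zero_of_subsingleton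
    have h1 := (stdOrthonormalBasis ℝ X).volume_parallelepiped
    have h2 : Bal x r = parallelepiped (stdOrthonormalBasis ℝ X) := by
      ext y; constructor
      · intro _
        rw [mem_parallelepiped_iff]
        exact ⟨0, by simp, Subsingleton.elim _ _⟩
      · intro _; rw [Subsingleton.elim y x]; simpa
    rw [h2, h1, h0]; simp [om]
  · rw [InnerProductSpace.volume_ball, mul_comm, ← ENNReal.ofReal_pow hr.le, om, ENNReal.ofReal_mul (by have := om_pos (frk X); unfold om at this; exact this.le)]

theorem yo_inner {e : X} (y : (ℝ ∙ e)ᗮ) : inn e (y:X) = 0 :=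
  Submodule.mem_orthogonal_singleton_iff_inner_right.1 y.2

theorem slice_norm {e : X} (he : ‖e‖ = 1) (t : ℝ) (y : (ℝ ∙ e)ᗮ) : ‖t • e + (y:X)‖ ^ 2 = t ^ 2 + ‖y‖ ^ 2 := by
  rw [norm_add_sq_real, inner_smul_left, yo_inner, norm_smul, he]; simp

theorem yo_finrank {e : X} (he : ‖e‖ = 1) {n : ℕ} (hn : frk X = n + 1) :
    frk (ℝ ∙ e)ᗮ = n := by
  have : Fact (frk X = n + 1) := ⟨hn⟩
  exact Submodule.finrank_orthogonal_span_singleton (by intro h; simp [h] at he)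

noncomputable def sl (e : X) : ℝ × (ℝ ∙ e)ᗮ → X := fun p => p.1 • e + (p.2 : X)

theorem sl_mp {e : X} (he : ‖e‖ = 1) : MeasurePreserving (sl e) (volume.prod volume) volume := by
  let L : WithLp 2 (ℝ × (ℝ ∙ e)ᗮ) →ₗᵢ[ℝ] X :=
    { toFun := fun p => p.fst • e + (p.snd : X)
      map_add' := by intro p q; simp [add_smul]; abel
      map_smul' := by intro c p; simp [mul_smul]
      norm_map' := by
        intro p
        have h := slice_norm he p.fst p.snd
        have h2 := WithLp.prod_norm_sq_eq_of_L2 p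
        rw [← sq_eq_sq₀ (norm_nonneg _) (norm_nonneg _), h2]
        simp at h ⊢
        linarith }
  have hX : 0 < frk X := by
    rw [Module.finrank_pos_iff_exists_ne_zero]; exact ⟨e, by intro h; simp [h] at he⟩
  have hd : frk (WithLp 2 (ℝ × (ℝ ∙ e)ᗮ)) = frk X := by
    have h1 := yo_finrank he (n := frk X - 1) (by omega)
    have h2 := (WithLp.linearEquiv 2 ℝ (ℝ × (ℝ ∙ e)ᗮ)).finrank_eq
    rw [h2, Module.finrank_prod, h1]; simp; omega
  let L' := L.toLinearIsometryEquiv hd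
  have h1 := L'.measurePreserving
  have h2 := WithLp.volume_preserving_toLp (U := ℝ) (V := (ℝ ∙ e)ᗮ)
  exact h1.comp h2

theorem sl_cont (e : X) : Continuous (sl e) := by unfold sl; fun_prop

theorem sl_inner {e : X} (he : ‖e‖ = 1) (p : ℝ × (ℝ ∙ e)ᗮ) : inn e (sl e p) = p.1 := by
  simp [sl, inner_add_right, inner_smul_right, yo_inner, he]

theorem lint_sl {e : X} (he : ‖e‖ = 1) {f : X → ℝ≥0∞} (hf : Measurable f) :
    ∫⁻ x, f x = ∫⁻ t : ℝ, ∫⁻ y : (ℝ ∙ e)ᗮ, f (sl e (t, y)) := by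
  rw [← (sl_mp he).lintegral_comp hf, lintegral_prod]
  exact (hf.comp (sl_cont e).measurable).aemeasurable

theorem lint_sl' {e : X} (he : ‖e‖ = 1) {f : X → ℝ≥0∞} (hf : Measurable f) :
    ∫⁻ x, f x = ∫⁻ y : (ℝ ∙ e)ᗮ, ∫⁻ t : ℝ, f (sl e (t, y)) := by
  rw [← (sl_mp he).lintegral_comp hf, lintegral_prod_symm']
  exact (hf.comp (sl_cont e).measurable)

theorem int_sl {e : X} (he : ‖e‖ = 1) {f : X → ℝ} (hf : Integrable f) :
    ∫ x, f x = ∫ t : ℝ, ∫ y : (ℝ ∙ e)ᗮ, f (sl e (t, y)) := by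
  have h0 := (sl_mp he).integrable_comp_of_integrable hf
  rw [← integral_prod (fun p => f (sl e p)) h0, ← (sl_mp he).map_eq, integral_map (sl_cont e).measurable.aemeasurable]
  rw [(sl_mp he).map_eq]; exact hf.aestronglyMeasurable
/-- layer type integral: ∫⁻ over reals of |τ| on an interval -/

theorem lint_abs {c : ℝ} (hc : 0 ≤ c) : ∫⁻ t : ℝ, oR (|t|) * ind (Ioo (-c) c) t = oR (c ^ 2) := by
  have h1 : ∀ t : ℝ, oR (|t|) * ind (Ioo (-c) c) t = (Ioo (-c) c).indicator (fun t => oR |t|) t := by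
    intro t; by_cases h : t ∈ Ioo (-c) c
    · rw [indicator_of_mem h, ind_of_mem h, mul_one]
    · rw [indicator_of_notMem h, ind_of_not h, mul_zero]
  simp_rw [h1]
  rw [lintegral_indicator measurableSet_Ioo, restrict_Ioo_eq_restrict_Ioc, ← ofReal_integral_eq_lintegral_ofReal, ← intervalIntegral.integral_of_le (by linarith)]
  · congr 1
    rw [← intervalIntegral.integral_add_adjacent_intervals (b := 0)]
    · have a1 : ∫ t in (-c)..0, |t| = ∫ t in (-c)..0, -t := by
        apply intervalIntegral.integral_congr; intro t ht; rw [uIcc_of_le (by linarith)] at ht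
        exact abs_of_nonpos ht.2
      have a2 : ∫ t in (0:ℝ)..c, |t| = ∫ t in (0:ℝ)..c, t := by
        apply intervalIntegral.integral_congr; intro t ht; rw [uIcc_of_le (by linarith)] at ht
        exact abs_of_nonneg ht.1
      rw [a1, a2, intervalIntegral.integral_neg, integral_id, integral_id]; ring
    · exact continuous_abs.intervalIntegrable _ _
    · exact continuous_abs.intervalIntegrable _ _
  · exact (continuous_abs.integrableOn_Icc).mono_set Ioc_subset_Icc_self
  · exact ae_of_all _ fun t => abs_nonneg t

theorem lint_polar [Nontrivial X] {n : ℕ} (hn : frk X = n + 1) {f : X → ℝ≥0∞} (hf : Measurable f) :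
    ∫⁻ x, f x = ∫⁻ z : Metric.sphere (0:X) 1, (∫⁻ r in Ioi (0:ℝ), oR (r ^ n) * f (r • (z:X)))
      ∂(volume : Measure X).toSphere := by
  have h1 : ∫⁻ x, f x = ∫⁻ x : ({0}ᶜ : Set X), f (x:X) ∂((volume : Measure X).comap ((↑) : ({0}ᶜ : Set X) → X)) := by
    rw [lintegral_subtype_comap (measurableSet_singleton _).compl (fun x => f x), restrict_compl_singleton]
  have h2 := (volume : Measure X).measurePreserving_homeomorphUnitSphereProd
  have hm : Measurable fun p : Metric.sphere (0:X) 1 × Ioi (0:ℝ) => f ((p.2:ℝ) • (p.1:X)) :=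
    hf.comp (by fun_prop)
  have h3 := h2.lintegral_comp hm
  have h4 : ∀ x : ({0}ᶜ : Set X), ((homeomorphUnitSphereProd X x).2 : ℝ) • ((homeomorphUnitSphereProd X x).1 : X) = x := by
    intro x
    have : (x:X) ≠ 0 := x.2
    simp [smul_smul, mul_inv_cancel₀ (norm_ne_zero_iff.2 this)]
  simp_rw [h4] at h3
  rw [h1, h3, lintegral_prod _ hm.aemeasurable]
  congr 1; ext z
  rw [Measure.volumeIoiPow, lintegral_withDensity_eq_lintegral_mul _ (by fun_prop)
    (show Measurable (fun y : Ioi (0:ℝ) => f ((y:ℝ) • (z:X))) from hf.comp (by fun_prop)), hn]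
  simp only [Pi.mul_apply, Nat.add_sub_cancel]
  rw [lintegral_subtype_comap measurableSet_Ioi (fun r : ℝ => oR (r ^ n) * f (r • (z:X)))]

theorem sphere_vol {n : ℕ} (hn : frk X = n + 1) :
    (volume : Measure X).toSphere univ = oR ((n+1) * om (n+1)) := by
  rw [Measure.toSphere_apply_univ, hn, vol_ball_om hn _ one_pos, ← ENNReal.ofReal_natCast, ← ENNReal.ofReal_mul (by positivity)]
  push_cast; simp

theorem lint_radial [Nontrivial X] {n : ℕ} (hn : frk X = n + 1) {f : ℝ → ℝ≥0∞} (hf : Measurable f) :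
    ∫⁻ x : X, f ‖x‖ = oR ((n+1) * om (n+1)) * ∫⁻ r in Ioi (0:ℝ), oR (r ^ n) * f r := by
  rw [lint_polar hn (show Measurable (fun x : X => f ‖x‖) from hf.comp measurable_norm), ← sphere_vol hn, mul_comm, ← lintegral_const]
  congr 1; ext z
  apply setLIntegral_congr_fun measurableSet_Ioi
  intro r hr
  have : ‖(z:X)‖ = 1 := by simpa using z.2
  simp [norm_smul, this, abs_of_pos (mem_Ioi.1 hr)]
/-- ∫ over (0,x) of r^(p) -/

theorem lint_rpow {p x : ℝ} (hp : -1 < p) (hx : 0 ≤ x) :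
    ∫⁻ r in Ioi (0:ℝ), oR (r ^ p) * ind (Iio x) r = oR (x ^ (p+1) / (p+1)) := by
  have h1 : ∀ r : ℝ, oR (r ^ p) * ind (Iio x) r = (Iio x).indicator (fun r => oR (r ^ p)) r := by
    intro t; by_cases h : t ∈ Iio x
    · rw [indicator_of_mem h, ind_of_mem h, mul_one]
    · rw [indicator_of_notMem h, ind_of_not h, mul_zero]
  simp_rw [h1]
  rw [lintegral_indicator measurableSet_Iio, Measure.restrict_restrict measurableSet_Iio, inter_comm, Ioi_inter_Iio,
    restrict_Ioo_eq_restrict_Ioc, ← ofReal_integral_eq_lintegral_ofReal, ← intervalIntegral.integral_of_le hx,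
    integral_rpow (Or.inl hp), Real.zero_rpow (by linarith), sub_zero]
  · exact (intervalIntegral.intervalIntegrable_rpow' hp).1
  · filter_upwards [ae_restrict_mem measurableSet_Ioc] with r hr
    exact Real.rpow_nonneg hr.1.le _

theorem lint_pow {x : ℝ} (n : ℕ) (hx : 0 ≤ x) :
    ∫⁻ r in Ioi (0:ℝ), oR (r ^ n) * ind (Iio x) r = oR (x ^ (n+1) / (n+1)) := by
  have := lint_rpow (p := n) (x := x) (by have := Nat.cast_nonneg (α := ℝ) n; linarith) hx
  simp_rw [Real.rpow_natCast] at this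
  rw [this]; congr 2; exact_mod_cast Real.rpow_natCast x (n+1)

theorem ind_ball (r : ℝ) (h : X) : ind (Bal (0:X) r) h = ind (Iio r) ‖h‖ := by
  simp [ind, indicator]

theorem ball_norm [Nontrivial X] {n : ℕ} (hn : frk X = n + 1) {r : ℝ} (hr : 0 ≤ r) :
    ∫⁻ h : X, oR ‖h‖ * ind (Bal (0:X) r) h
      = oR ((n+1) * om (n+1) / (n+2) * r ^ (n+2)) := by
  simp_rw [ind_ball]
  rw [lint_radial hn (f := fun u => oR u * ind (Iio r) u) (ENNReal.measurable_ofReal.mul (ind_meas measurableSet_Iio))]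
  have : ∀ u ∈ Ioi (0:ℝ), oR (u ^ n) * (oR u * ind (Iio r) u) = oR (u ^ (n+1)) * ind (Iio r) u := by
    intro u hu
    rw [← mul_assoc, ← ENNReal.ofReal_mul (by have := mem_Ioi.1 hu; positivity), pow_succ]
  rw [setLIntegral_congr_fun measurableSet_Ioi this, lint_pow _ hr, ← ENNReal.ofReal_mul (by have := om_pos (n+1); positivity)]
  congr 1; push_cast; ring

theorem y_sq {n : ℕ} (hn : frk X = n) {r : ℝ} (hr : 0 ≤ r) :
    ∫⁻ y : X, oR (r ^ 2 - ‖y‖ ^ 2) = oR (2 * om n / (n+2) * r ^ (n+2)) := by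
  have h1 : ∀ y : X, oR (r ^ 2 - ‖y‖ ^ 2) = ∫⁻ u in Ioi (0:ℝ), oR (2 * u) * (ind (Iio r) u * ind (Bal (0:X) u) y) := by
    intro y
    by_cases hy : ‖y‖ ≤ r
    · have a : ∀ u : ℝ, oR (2 * u) * (ind (Iio r) u * ind (Bal (0:X) u) y) = (Ioo ‖y‖ r).indicator (fun u => oR (2 * u)) u := by
        intro u
        rw [ind_ball]; unfold ind indicator
        by_cases h1 : u < r <;> by_cases h2 : ‖y‖ < u <;> simp [h1, h2]
      simp_rw [a]
      rw [lintegral_indicator measurableSet_Ioo, Measure.restrict_restrict measurableSet_Ioo, inter_eq_left.2,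
        restrict_Ioo_eq_restrict_Ioc, ← ofReal_integral_eq_lintegral_ofReal, ← intervalIntegral.integral_of_le hy,
        intervalIntegral.integral_const_mul, integral_id]
      · congr 1; ring
      · exact Continuous.integrableOn_Ioc (by fun_prop)
      · filter_upwards [ae_restrict_mem measurableSet_Ioc] with u hu
        have := norm_nonneg y; have := hu.1; simp only [Pi.zero_apply]; linarith
      · exact fun u hu => (norm_nonneg y).trans_lt hu.1
    · push Not at hy
      have a : ∀ u : ℝ, oR (2 * u) * (ind (Iio r) u * ind (Bal (0:X) u) y) = 0 := by
        intro u
        rw [ind_ball]; unfold ind indicator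
        by_cases h1 : u < r
        · have : ¬ ‖y‖ < u := by linarith
          simp [this]
        · simp [h1]
      simp_rw [a]; simp
      nlinarith
  simp_rw [h1]
  rw [lintegral_lintegral_swap]
  · have : ∀ u ∈ Ioi (0:ℝ), ∫⁻ y : X, oR (2 * u) * (ind (Iio r) u * ind (Bal (0:X) u) y)
        = oR (2 * om n) * (oR (u ^ (n+1)) * ind (Iio r) u) := by
      intro u hu
      have hu' := mem_Ioi.1 hu
      simp_rw [← mul_assoc]
      rw [lintegral_const_mul _ (ind_meas measurableSet_ball), ← vol_ind measurableSet_ball, vol_ball_om hn _ hu']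
      rw [mul_right_comm, ← ENNReal.ofReal_mul (by positivity), ← ENNReal.ofReal_mul (by have := om_pos n; positivity)]
      congr 2; ring
    rw [setLIntegral_congr_fun measurableSet_Ioi this, lintegral_const_mul' _ _ ENNReal.ofReal_ne_top, lint_pow _ hr, ← ENNReal.ofReal_mul (by have := om_pos n; positivity)]
    congr 1; push_cast; ring
  · refine Measurable.aemeasurable ?_
    refine Measurable.mul (by fun_prop) (Measurable.mul ((ind_meas measurableSet_Iio).comp measurable_snd) ?_)
    have : (fun a : X × ℝ => ind (Bal (0:X) a.2) a.1) = ind {a : X × ℝ | ‖a.1‖ < a.2} := by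
      ext a; simp [ind, indicator]
    show Measurable (fun a : X × ℝ => ind (Bal (0:X) a.2) a.1)
    rw [this]
    exact ((measurable_const (a := (1:ℝ≥0∞))).indicator (measurableSet_lt (by fun_prop) (by fun_prop)))
/-- slices of balls -/

theorem sl_ball {e : X} (he : ‖e‖ = 1) {r : ℝ} (hr : 0 ≤ r) (p : ℝ × (ℝ ∙ e)ᗮ) :
    sl e p ∈ Bal (0:X) r ↔ p.1 ^ 2 + ‖p.2‖ ^ 2 < r ^ 2 := by
  rw [mem_ball_zero_iff, ← slice_norm he]
  exact (sq_lt_sq₀ (norm_nonneg _) hr).symm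

theorem ball_inner {n : ℕ} (hn : frk X = n + 1) (v : X) {r : ℝ} (hr : 0 ≤ r) :
    ∫⁻ h : X, oR |inn v h| * ind (Bal (0:X) r) h
      = oR (‖v‖ * (2 * om n / (n+2) * r ^ (n+2))) := by
  rcases eq_or_ne v 0 with rfl | hv
  · simp
  set e := ‖v‖⁻¹ • v with he'
  have hv' : 0 < ‖v‖ := norm_pos_iff.2 hv
  have he : ‖e‖ = 1 := by rw [he', norm_smul, norm_inv, norm_norm, inv_mul_cancel₀ hv'.ne']
  have hve : v = ‖v‖ • e := by rw [he', smul_smul, mul_inv_cancel₀ hv'.ne', one_smul]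
  rw [lint_sl' he (by
    refine Measurable.mul ?_ (ind_meas measurableSet_ball)
    fun_prop)]
  have h1 : ∀ y : (ℝ ∙ e)ᗮ, ∫⁻ t : ℝ, oR |inn v (sl e (t, y))| * ind (Bal (0:X) r) (sl e (t, y))
      = oR ‖v‖ * oR (r ^ 2 - ‖y‖ ^ 2) := by
    intro y
    have a : ∀ t : ℝ, oR |inn v (sl e (t, y))| * ind (Bal (0:X) r) (sl e (t, y))
        = oR ‖v‖ * (oR (|t|) * ind (Ioo (-√(r ^ 2 - ‖y‖ ^ 2)) √(r ^ 2 - ‖y‖ ^ 2)) t) := by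
      intro t
      have b : inn v (sl e (t, y)) = ‖v‖ * t := by
        conv_lhs => rw [hve]
        rw [inner_smul_left, sl_inner he]; simp
      rw [b, abs_mul, abs_norm, ENNReal.ofReal_mul hv'.le, mul_assoc]
      congr 2
      have c : sl e (t, y) ∈ Bal (0:X) r ↔ t ∈ Ioo (-√(r ^ 2 - ‖y‖ ^ 2)) √(r ^ 2 - ‖y‖ ^ 2) := by
        rw [sl_ball he hr, mem_Ioo, ← abs_lt, Real.lt_sqrt (abs_nonneg _), sq_abs]
        constructor <;> intro h <;> simp only at * <;> linarith
      by_cases h : sl e (t, y) ∈ Bal (0:X) r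
      · rw [ind_of_mem h, ind_of_mem (c.1 h)]
      · rw [ind_of_not h, ind_of_not (fun h' => h (c.2 h'))]
    simp_rw [a]
    rw [lintegral_const_mul' _ _ ENNReal.ofReal_ne_top, lint_abs (Real.sqrt_nonneg _)]
    rcases le_total 0 (r ^ 2 - ‖y‖ ^ 2) with h | h
    · rw [Real.sq_sqrt h]
    · rw [Real.sqrt_eq_zero_of_nonpos h, ENNReal.ofReal_of_nonpos h]; simp
  simp_rw [h1]
  rw [lintegral_const_mul' _ _ ENNReal.ofReal_ne_top, y_sq (yo_finrank he hn) hr, ← ENNReal.ofReal_mul hv'.le]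

noncomputable def ee (E : Set X) (h : X) : ℝ≥0∞ := ∫⁻ x, ind E x * ind Eᶜ (x + h)

theorem ee_meas {E : Set X} (hE : MeasurableSet E) : Measurable (ee E) := by
  unfold ee
  apply Measurable.lintegral_prod_right' (f := fun p : X × X => ind E p.2 * ind Eᶜ (p.2 + p.1))
  exact ((ind_meas hE).comp measurable_snd).mul ((ind_meas hE.compl).comp (measurable_snd.add measurable_fst))

theorem PK_ee {k : ℝ → ℝ≥0∞} (hk : Measurable k) {E : Set X} (hE : MeasurableSet E) :
    PK k E = ∫⁻ h, k ‖h‖ * ee E h := by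
  unfold PK ee
  have h1 : ∀ x : X, ∫⁻ y, ind E x * ind Eᶜ y * k ‖x - y‖ = ∫⁻ h, k ‖h‖ * (ind E x * ind Eᶜ (x + h)) := by
    intro x
    rw [← lintegral_add_left_eq_self _ x]
    congr 1; ext h
    rw [mul_comm]; simp
  simp_rw [h1]
  rw [lintegral_lintegral_swap]
  · congr 1; ext h
    rw [lintegral_const_mul]
    exact (ind_meas hE).mul ((ind_meas hE.compl).comp (measurable_id.add_const h))
  · refine Measurable.aemeasurable ?_
    exact (hk.comp (measurable_norm.comp measurable_snd)).mul (((ind_meas hE).comp measurable_fst).mul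
      ((ind_meas hE.compl).comp (measurable_fst.add measurable_snd)))

theorem ind_le_one (E : Set X) (x : X) : ind E x ≤ 1 := by
  unfold ind; exact indicator_le_self' (fun _ _ => zero_le) x

theorem ind_add (E : Set X) (x : X) : ind E x + ind Eᶜ x = 1 := by
  by_cases h : x ∈ E
  · rw [ind_of_mem h, ind_of_not (by simpa using h), add_zero]
  · rw [ind_of_not h, ind_of_mem (show x ∈ Eᶜ from h), zero_add]

theorem ee_le {E : Set X} (hE : MeasurableSet E) (h : X) : ee E h ≤ volume E := by
  rw [vol_ind hE]
  exact lintegral_mono fun x => mul_le_of_le_one_right' (ind_le_one _ _)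

theorem ee_add {E : Set X} (hE : MeasurableSet E) (h h' : X) : ee E (h + h') ≤ ee E h + ee E h' := by
  have h1 : ee E h' = ∫⁻ x, ind E (x + h) * ind Eᶜ (x + h + h') := by
    unfold ee; rw [← lintegral_add_right_eq_self (fun x => ind E x * ind Eᶜ (x + h')) h]
  rw [h1]; unfold ee
  have m1 := (ind_meas hE).mul ((ind_meas hE.compl).comp (measurable_id.add_const h))
  rw [← lintegral_add_left]
  · apply lintegral_mono
    intro x
    show ind E x * ind Eᶜ (x + (h + h')) ≤ ind E x * ind Eᶜ (x + h) + ind E (x + h) * ind Eᶜ (x + h + h')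
    rw [← add_assoc]
    by_cases a : x + h ∈ E
    · rw [ind_of_mem a, one_mul]
      exact le_add_left (mul_le_of_le_one_left' (ind_le_one _ _))
    · rw [ind_of_mem (show x + h ∈ Eᶜ from a), mul_one]
      exact le_add_right (mul_le_of_le_one_right' (ind_le_one _ _))
  · exact m1

theorem ee_neg {E : Set X} (hE : MeasurableSet E) (hv : volume E ≠ ⊤) (h : X) : ee E (-h) = ee E h := by
  have key : ∀ h : X, ee E h + ∫⁻ x, ind E x * ind E (x + h) = volume E := by
    intro h
    unfold ee
    rw [← lintegral_add_left, vol_ind hE]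
    · congr 1; ext x
      rw [← mul_add, add_comm, ind_add, mul_one]
    · exact (ind_meas hE).mul ((ind_meas hE.compl).comp (measurable_id.add_const h))
  have k1 := key h
  have k2 := key (-h)
  have k3 : ∫⁻ x, ind E x * ind E (x + -h) = ∫⁻ x, ind E x * ind E (x + h) := by
    rw [← lintegral_add_right_eq_self (fun x => ind E x * ind E (x + -h)) h]
    congr 1; ext x; rw [mul_comm]; simp
  rw [k3, ← k1] at k2
  refine (ENNReal.add_left_inj ?_).1 k2
  exact ne_top_of_le_ne_top hv (k1 ▸ le_add_self)

theorem lint_ind_Ioo (a b : ℝ) : ∫⁻ t : ℝ, ind (Ioo a b) t = oR (b - a) := by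
  rw [← vol_ind measurableSet_Ioo, Real.volume_Ioo]

theorem ball_slice_len {r τ s : ℝ} (hr : 0 ≤ r) (hτ : 0 < τ) :
    (∫⁻ t : ℝ, ind {t : ℝ | t ^ 2 + s < r} t * ind {t : ℝ | t ^ 2 + s < r}ᶜ (t + τ) ≤ oR τ) ∧
    (s < r - τ ^ 2 / 4 → oR τ ≤ ∫⁻ t : ℝ, ind {t : ℝ | t ^ 2 + s < r} t * ind {t : ℝ | t ^ 2 + s < r}ᶜ (t + τ)) := by
  constructor
  · calc _ ≤ ∫⁻ t : ℝ, ind (Icc (√(r - s) - τ) √(r - s)) t := by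
          apply lintegral_mono; intro t
          show ind {t : ℝ | t ^ 2 + s < r} t * ind {t : ℝ | t ^ 2 + s < r}ᶜ (t + τ) ≤ ind (Icc (√(r - s) - τ) √(r - s)) t
          by_cases h1 : t ^ 2 + s < r
          · by_cases h2 : (t + τ) ^ 2 + s < r
            · rw [ind_of_not (show ¬ (t + τ ∈ {t : ℝ | t ^ 2 + s < r}ᶜ) from fun h => h h2), mul_zero]; exact zero_le
            · rw [ind_of_mem (show t ∈ Icc (√(r - s) - τ) √(r - s) from ?_)]
              · exact (mul_le_of_le_one_right' (ind_le_one _ _)).trans (ind_le_one _ _)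
              · push Not at h2
                have a1 : |t| < √(r - s) := by rw [Real.lt_sqrt (abs_nonneg _), sq_abs]; linarith
                have a2 : √(r - s) ≤ |t + τ| := by rw [Real.sqrt_le_left (abs_nonneg _), sq_abs]; linarith
                rw [abs_lt] at a1
                refine ⟨?_, a1.2.le⟩
                rcases abs_cases (t + τ) with h | h <;> linarith
          · rw [ind_of_not (show ¬ (t ∈ {t : ℝ | t ^ 2 + s < r}) from h1), zero_mul]; exact zero_le
      _ = oR τ := by rw [← vol_ind measurableSet_Icc, Real.volume_Icc]; congr 1; ring
  · intro h
    calc _ = ∫⁻ t : ℝ, ind (Ioo (√(r - s) - τ) √(r - s)) t := by rw [lint_ind_Ioo]; congr 1; ring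
      _ ≤ _ := by
          apply lintegral_mono; intro t
          show ind (Ioo (√(r - s) - τ) √(r - s)) t ≤ ind {t : ℝ | t ^ 2 + s < r} t * ind {t : ℝ | t ^ 2 + s < r}ᶜ (t + τ)
          by_cases h1 : t ∈ Ioo (√(r - s) - τ) √(r - s)
          · have h0 : τ / 2 < √(r - s) := by rw [Real.lt_sqrt (by positivity)]; linarith
            have h3 := Real.sq_sqrt (show 0 ≤ r - s by nlinarith)
            obtain ⟨h4, h5⟩ := h1
            rw [ind_of_mem (show t ∈ {t : ℝ | t ^ 2 + s < r} from ?_), ind_of_mem (show t + τ ∈ {t : ℝ | t ^ 2 + s < r}ᶜ from ?_)]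
            · simpa using ind_le_one _ t
            · simp only [mem_compl_iff, mem_setOf_eq, not_lt]; nlinarith
            · simp only [mem_setOf_eq]; nlinarith
          · rw [ind_of_not h1]; exact zero_le

theorem ee_ball {n : ℕ} (hn : frk X = n + 1) {R : ℝ} (hR : 0 < R) (h : X) :
    ee (Bal (0:X) R) h ≤ oR (‖h‖ * (om n * R ^ n)) ∧
    ∀ ρ : ℝ, 0 < ρ → ρ ^ 2 ≤ R ^ 2 - ‖h‖ ^ 2 / 4 → oR (‖h‖ * (om n * ρ ^ n)) ≤ ee (Bal (0:X) R) h := by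
  rcases eq_or_ne h 0 with rfl | hv
  · refine ⟨?_, fun ρ _ _ => by simp⟩
    have : ∀ x : X, ind (Bal (0:X) R) x * ind (Bal (0:X) R)ᶜ (x + 0) = 0 := by
      intro x
      by_cases a : x ∈ Bal (0:X) R
      · rw [add_zero, ind_of_not (show ¬ x ∈ (Bal (0:X) R)ᶜ from fun h => h a), mul_zero]
      · rw [ind_of_not a, zero_mul]
    unfold ee; simp_rw [this]; simp
  set e := ‖h‖⁻¹ • h with he'
  have hv' : 0 < ‖h‖ := norm_pos_iff.2 hv
  have he : ‖e‖ = 1 := by rw [he', norm_smul, norm_inv, norm_norm, inv_mul_cancel₀ hv'.ne']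
  have hve : h = ‖h‖ • e := by rw [he', smul_smul, mul_inv_cancel₀ hv'.ne', one_smul]
  have hb : MeasurableSet (Bal (0:X) R) := measurableSet_ball
  have h1 : ee (Bal (0:X) R) h = ∫⁻ y : (ℝ ∙ e)ᗮ, ∫⁻ t : ℝ, ind {t : ℝ | t ^ 2 + ‖y‖^2 < R^2} t * ind {t : ℝ | t ^ 2 + ‖y‖^2 < R^2}ᶜ (t + ‖h‖) := by
    unfold ee
    rw [lint_sl' he (f := fun x => ind (Bal (0:X) R) x * ind (Bal (0:X) R)ᶜ (x + h)) ((ind_meas hb).mul ((ind_meas hb.compl).comp (measurable_id.add_const h)))]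
    congr 1; ext y; congr 1; ext t
    have e1 : sl e (t, y) + h = sl e (t + ‖h‖, y) := by
      conv_lhs => rw [hve]
      simp only [sl, add_smul]; abel
    rw [e1]
    congr 1
    · by_cases a : sl e (t, y) ∈ Bal (0:X) R
      · rw [ind_of_mem a, ind_of_mem (by rw [sl_ball he hR.le] at a; exact a)]
      · rw [ind_of_not a, ind_of_not (by rw [sl_ball he hR.le] at a; exact a)]
    · by_cases a : sl e (t + ‖h‖, y) ∈ Bal (0:X) R
      · rw [ind_of_not (not_not_intro a), ind_of_not (by rw [sl_ball he hR.le] at a; exact not_not_intro a)]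
      · rw [ind_of_mem (show _ ∈ (Bal (0:X) R)ᶜ from a), ind_of_mem (by rw [sl_ball he hR.le] at a; exact a)]
  have hY := yo_finrank he hn
  have cst : ∀ ρ : ℝ, 0 < ρ → ∫⁻ y : (ℝ ∙ e)ᗮ, oR ‖h‖ * ind (Bal 0 ρ) y = oR (‖h‖ * (om n * ρ ^ n)) := by
    intro ρ hρ
    rw [lintegral_const_mul' _ _ ENNReal.ofReal_ne_top, ← vol_ind measurableSet_ball, vol_ball_om hY _ hρ, ← ENNReal.ofReal_mul hv'.le]
  rw [h1]
  constructor
  · rw [← cst R hR]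
    apply lintegral_mono; intro y
    show (∫⁻ t : ℝ, ind {t : ℝ | t ^ 2 + ‖y‖^2 < R^2} t * ind {t : ℝ | t ^ 2 + ‖y‖^2 < R^2}ᶜ (t + ‖h‖)) ≤ oR ‖h‖ * ind (Bal 0 R) y
    by_cases a : y ∈ Bal (0:(ℝ ∙ e)ᗮ) R
    · rw [ind_of_mem a, mul_one]
      exact (ball_slice_len (by positivity) hv').1
    · rw [ind_of_not a, mul_zero]
      have : ∀ t : ℝ, ind {t : ℝ | t ^ 2 + ‖y‖^2 < R^2} t = 0 := by
        intro t
        apply ind_of_not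
        simp only [mem_setOf_eq, not_lt]
        rw [mem_ball_zero_iff, not_lt] at a
        nlinarith [sq_nonneg t]
      simp only [this, zero_mul, lintegral_zero, le_refl]
  · intro ρ hρ hρ2
    rw [← cst ρ hρ]
    apply lintegral_mono; intro y
    show oR ‖h‖ * ind (Bal 0 ρ) y ≤ (∫⁻ t : ℝ, ind {t : ℝ | t ^ 2 + ‖y‖^2 < R^2} t * ind {t : ℝ | t ^ 2 + ‖y‖^2 < R^2}ᶜ (t + ‖h‖))
    by_cases a : y ∈ Bal (0:(ℝ ∙ e)ᗮ) ρ
    · rw [ind_of_mem a, mul_one]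
      rw [mem_ball_zero_iff] at a
      exact (ball_slice_len (by positivity) hv').2 (by nlinarith [norm_nonneg y])
    · rw [ind_of_not a, mul_zero]; exact zero_le
/-- J functional: truncated kernel -/

theorem J_riesz [Nontrivial X] {E : Set X} (hE : MeasurableSet E) {R : ℝ} (hv : volume E = volume (Bal (0:X) R)) (r : ℝ) :
    ∫⁻ h, ind (Iio r) ‖h‖ * ee (Bal (0:X) R) h ≤ ∫⁻ h, ind (Iio r) ‖h‖ * ee E h := by
  rw [← PK_ee (ind_meas measurableSet_Iio) hE, ← PK_ee (ind_meas measurableSet_Iio) measurableSet_ball]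
  refine riesz ?_ hE hv
  intro a b hab
  by_cases h : b < r
  · rw [ind_of_mem (show b ∈ Iio r from h), ind_of_mem (show a ∈ Iio r from hab.trans_lt h)]
  · rw [ind_of_not (show ¬ b ∈ Iio r from h)]; exact zero_le

theorem ball_clm {n : ℕ} (hn : frk X = n + 1) (L : X →L[ℝ] ℝ) {r : ℝ} (hr : 0 ≤ r) :
    ∫⁻ h : X, oR |L h| * ind (Bal (0:X) r) h
      = oR (‖L‖ * (2 * om n / (n+2) * r ^ (n+2))) := by
  have := ball_inner hn ((InnerProductSpace.toDual ℝ X).symm L) hr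
  simpa only [InnerProductSpace.toDual_symm_apply, LinearIsometryEquiv.norm_map] using this

theorem ball_clm_half {n : ℕ} (hn : frk X = n + 1) (L : X →L[ℝ] ℝ) {r : ℝ} (hr : 0 ≤ r) :
    2 * ∫⁻ h : X, oR (-L h) * ind (Bal (0:X) r) h
      = oR (‖L‖ * (2 * om n / (n+2) * r ^ (n+2))) := by
  rw [← ball_clm hn L hr, two_mul]
  nth_rewrite 2 [← lintegral_neg_eq_self]
  rw [← lintegral_add_left]
  · congr 1; ext h
    have : ind (Bal (0:X) r) (-h) = ind (Bal (0:X) r) h := by rw [ind_ball, ind_ball, norm_neg]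
    rw [this, ← add_mul]
    congr 1
    simp only [map_neg, neg_neg]
    rcases le_total 0 (L h) with a | a
    · rw [abs_of_nonneg a, ENNReal.ofReal_of_nonpos (by linarith), zero_add]
    · rw [abs_of_nonpos a, ENNReal.ofReal_of_nonpos a, add_zero]
  · exact Measurable.mul (by fun_prop) (ind_meas measurableSet_ball)

theorem ofReal_int_le {α : Type*} [MeasurableSpace α] {μ : Measure α} (f : α → ℝ) (hf : Integrable f μ) :
    oR (∫ x, f x ∂μ) ≤ ∫⁻ x, oR (f x) ∂μ := by
  rw [integral_eq_lintegral_pos_part_sub_lintegral_neg_part hf]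
  refine ENNReal.ofReal_le_of_le_toReal ?_
  linarith [ENNReal.toReal_nonneg (a := ∫⁻ x, oR (-f x) ∂μ)]

theorem diff_le {w : X → ℝ} (hw : ContDiff ℝ 1 w) (h : X) :
    ∫⁻ x, oR (w x - w (x + h)) ≤ ∫⁻ x, oR (-fdv w x h) := by
  have cf : Continuous (fdv w) := hw.continuous_fderiv one_ne_zero
  have h1 : ∀ x, oR (w x - w (x + h)) ≤ ∫⁻ s in Ioc (0:ℝ) 1, oR (-fdv w (x + s • h) h) := by
    intro x
    have d : ∀ s ∈ uIcc (0:ℝ) 1, HasDerivAt (fun s : ℝ => w (x + s • h)) (fdv w (x + s • h) h) s := by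
      intro s _
      have a := (hw.differentiable one_ne_zero (x + s • h)).hasFDerivAt
      have b : HasDerivAt (fun s : ℝ => x + s • h) h s := by
        simpa using ((hasDerivAt_id s).smul_const h).const_add x
      exact a.comp_hasDerivAt s b
    have ci : Continuous fun s : ℝ => fdv w (x + s • h) h := (cf.comp (by fun_prop)).clm_apply continuous_const
    have e := intervalIntegral.integral_eq_sub_of_hasDerivAt d (ci.intervalIntegrable _ _)
    simp only [one_smul, zero_smul, add_zero] at e
    have : w x - w (x + h) = ∫ s in Ioc (0:ℝ) 1, -fdv w (x + s • h) h := by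
      rw [integral_neg, ← intervalIntegral.integral_of_le zero_le_one, e]; ring
    rw [this]
    exact ofReal_int_le _ ((intervalIntegrable_iff_integrableOn_Ioc_of_le zero_le_one).1 (ci.neg.intervalIntegrable 0 1))
  calc _ ≤ ∫⁻ x, ∫⁻ s in Ioc (0:ℝ) 1, oR (-fdv w (x + s • h) h) := lintegral_mono h1
    _ = ∫⁻ s in Ioc (0:ℝ) 1, ∫⁻ x, oR (-fdv w (x + s • h) h) := by
        rw [lintegral_lintegral_swap]
        have : Continuous fun p : X × ℝ => fdv w (p.1 + p.2 • h) h := (cf.comp (by fun_prop)).clm_apply continuous_const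
        exact (ENNReal.measurable_ofReal.comp this.neg.measurable).aemeasurable
    _ = ∫⁻ s in Ioc (0:ℝ) 1, ∫⁻ x, oR (-fdv w x h) := by
        congr 1; ext s
        rw [lintegral_add_right_eq_self (fun x => oR (-fdv w x h))]
    _ = _ := by simp

theorem level_int (u v : ℝ) (hv : 0 ≤ v) : ∫⁻ l in Ioi (0:ℝ), ind {l : ℝ | l < u} l * ind {l : ℝ | l < v}ᶜ l = oR (u - v) := by
  have : ∀ l ∈ Ioi (0:ℝ), ind {l : ℝ | l < u} l * ind {l : ℝ | l < v}ᶜ l = ind (Ico v u) l := by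
    intro l _
    by_cases a : l < u <;> by_cases b : l < v <;> simp [ind, indicator, a, b]
  rw [setLIntegral_congr_fun measurableSet_Ioi this]
  have h2 : ∀ l, ind (Ico v u) l = (Ico v u).indicator (fun _ => (1:ℝ≥0∞)) l := fun l => rfl
  simp_rw [h2]
  rw [lintegral_indicator measurableSet_Ico, Measure.restrict_restrict measurableSet_Ico]
  simp
  rw [← Real.volume_Ico]
  refine le_antisymm (measure_mono inter_subset_left) ?_
  rw [← Real.volume_Ioo.trans Real.volume_Ico.symm]
  exact measure_mono fun l hl => ⟨⟨hl.1.le, hl.2⟩, hv.trans_lt hl.1⟩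

theorem int_norm_fderiv {w : X → ℝ} (hw : ContDiff ℝ 1 w) (hc : HasCompactSupport w) : Integrable fun x => ‖fdv w x‖ :=
  ((hw.continuous_fderiv one_ne_zero).integrable_of_hasCompactSupport (hc.fderiv (𝕜 := ℝ))).norm

theorem iso [Nontrivial X] {n : ℕ} (hn : frk X = n + 1) {w : X → ℝ} (hw : ContDiff ℝ 1 w) (hc : HasCompactSupport w)
    (h0 : ∀ x, 0 ≤ w x) {a ρ : ℝ} (ha : a ≤ 1) (hρ : 0 < ρ)
    (hl : ∀ l ∈ Ioo 0 (1 - a), oR (om (n+1) * ρ ^ (n+1)) ≤ volume {x | l < w x}) :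
    (1 - a) * ((n+1) * om (n+1) * ρ ^ n) ≤ ∫ x, ‖fdv w x‖ := by
  have hom := om_pos n
  have hom1 := om_pos (n+1)
  have hE : ∀ l, MeasurableSet {x | l < w x} := fun l => measurableSet_lt measurable_const hw.continuous.measurable
  have cf : Continuous (fdv w) := hw.continuous_fderiv one_ne_zero
  have main : ∀ σ ∈ Ioo 0 ρ, (1 - a) * ((n+1) * om (n+1) * σ ^ n) ≤ ∫ x, ‖fdv w x‖ := by
    intro σ hσ
    obtain ⟨hσ0, hσ1⟩ := hσ
    set r := 2 * √(ρ ^ 2 - σ ^ 2) with hr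
    have hrp : 0 < r := by
      have : 0 < ρ ^ 2 - σ ^ 2 := by nlinarith
      have := Real.sqrt_pos.2 this
      positivity
    have hr2 : r ^ 2 / 4 = ρ ^ 2 - σ ^ 2 := by
      rw [hr, mul_pow, Real.sq_sqrt (by nlinarith)]; ring
    have low : ∀ l ∈ Ioo 0 (1 - a), oR (om n * σ ^ n * ((n+1) * om (n+1) / (n+2) * r ^ (n+2))) ≤
        ∫⁻ h, ind (Iio r) ‖h‖ * ee {x | l < w x} h := by
      intro l hl'
      have fin : volume {x | l < w x} ≠ ⊤ := by
        refine ne_top_of_le_ne_top hc.isCompact.measure_lt_top.ne (measure_mono fun x hx => subset_tsupport w ?_)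
        have : l < w x := hx
        exact ne_of_gt (hl'.1.trans this)
      set V := (volume {x | l < w x}).toReal with hV
      have hV1 : om (n+1) * ρ ^ (n+1) ≤ V := by
        have := (ENNReal.ofReal_le_iff_le_toReal fin).1 (hl l hl'); exact this
      set R := (V / om (n+1)) ^ (1 / ((n:ℝ)+1)) with hR
      have hRn : R ^ (n+1) = V / om (n+1) := by
        rw [hR, ← Real.rpow_natCast, ← Real.rpow_mul (by have : 0 ≤ V := ENNReal.toReal_nonneg
                                                         positivity)]
        push_cast; rw [one_div, inv_mul_cancel₀ (by positivity), Real.rpow_one]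
      have hR0 : 0 ≤ R := Real.rpow_nonneg (div_nonneg ENNReal.toReal_nonneg hom1.le) _
      have hRρ : ρ ≤ R := by
        refine le_of_pow_le_pow_left₀ (n := n+1) (by omega) hR0 ?_
        rw [hRn, le_div_iff₀ hom1]; linarith
      have hvol : volume {x | l < w x} = volume (Bal (0:X) R) := by
        rw [vol_ball_om hn _ (by linarith), hRn, mul_div_cancel₀ _ hom1.ne', ENNReal.ofReal_toReal fin]
      refine le_trans ?_ (J_riesz (hE l) hvol r)
      rw [ENNReal.ofReal_mul (by positivity), ← ball_norm hn hrp.le, ← lintegral_const_mul' _ _ ENNReal.ofReal_ne_top]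
      apply lintegral_mono; intro h
      show oR (om n * σ ^ n) * (oR ‖h‖ * ind (Bal (0:X) r) h) ≤ ind (Iio r) ‖h‖ * ee (Bal 0 R) h
      rw [ind_ball, ← mul_assoc, mul_comm]
      by_cases hh : ‖h‖ ∈ Iio r
      · gcongr
        rw [← ENNReal.ofReal_mul (by positivity), mul_comm]
        apply (ee_ball hn (by linarith) h).2 σ hσ0
        have := mem_Iio.1 hh
        nlinarith [norm_nonneg h]
      · rw [ind_of_not hh]; simp
    have up : 2 * ∫⁻ l in Ioi (0:ℝ), ∫⁻ h, ind (Iio r) ‖h‖ * ee {x | l < w x} h ≤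
        oR ((∫ x, ‖fdv w x‖) * (2 * om n / (n+2) * r ^ (n+2))) := by
      have meas3 : Measurable fun p : (ℝ × X) × X => ind {x | p.1.1 < w x} p.2 * ind {x | p.1.1 < w x}ᶜ (p.2 + p.1.2) := by
        have a1 : MeasurableSet {p : (ℝ × X) × X | p.1.1 < w p.2} := measurableSet_lt (by fun_prop) (hw.continuous.measurable.comp (by fun_prop))
        have a2 : MeasurableSet {p : (ℝ × X) × X | p.1.1 < w (p.2 + p.1.2)} := measurableSet_lt (by fun_prop) (hw.continuous.measurable.comp (by fun_prop))
        exact ((measurable_const (a := (1:ℝ≥0∞))).indicator a1).mul ((measurable_const (a := (1:ℝ≥0∞))).indicator a2.compl)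
      have meas2 : Measurable fun p : ℝ × X => ee {x | p.1 < w x} p.2 := by
        unfold ee
        exact Measurable.lintegral_prod_right' meas3
      rw [lintegral_lintegral_swap]
      · have e1 : ∀ h : X, ∫⁻ l in Ioi (0:ℝ), ind (Iio r) ‖h‖ * ee {x | l < w x} h ≤ ∫⁻ x, oR (-fdv w x h) * ind (Bal (0:X) r) h := by
          intro h
          rw [lintegral_const_mul' _ _ (ne_top_of_le_ne_top one_ne_top (ind_le_one _ _)), lintegral_mul_const' _ _ (ne_top_of_le_ne_top one_ne_top (ind_le_one _ _)),
            ind_ball, mul_comm]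
          gcongr
          refine le_trans (le_of_eq ?_) (diff_le hw h)
          unfold ee
          rw [lintegral_lintegral_swap]
          · congr 1; ext x
            rw [← level_int _ _ (h0 _)]
            congr 1
          · exact (meas3.comp (show Measurable fun q : ℝ × X => ((q.1, h), q.2) by fun_prop)).aemeasurable
        calc _ ≤ 2 * ∫⁻ h, ∫⁻ x, oR (-fdv w x h) * ind (Bal (0:X) r) h := by
              gcongr with h; exact e1 h
          _ = ∫⁻ x, oR (‖fdv w x‖ * (2 * om n / (n+2) * r ^ (n+2))) := by
              rw [lintegral_lintegral_swap, ← lintegral_const_mul' _ _ (by simp)]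
              · congr 1; ext x
                rw [ball_clm_half hn _ hrp.le]
              · have : Continuous fun p : X × X => fdv w p.2 p.1 := (cf.comp continuous_snd).clm_apply continuous_fst
                exact ((ENNReal.measurable_ofReal.comp this.neg.measurable).mul ((ind_meas measurableSet_ball).comp measurable_fst)).aemeasurable
          _ ≤ _ := by
              rw [← integral_mul_const, ofReal_integral_eq_lintegral_ofReal ((int_norm_fderiv hw hc).mul_const _)]
              exact ae_of_all _ fun x => by positivity
      · exact (((ind_meas measurableSet_Iio).comp (measurable_norm.comp measurable_snd)).mul meas2).aemeasurable
    have both : oR (2 * ((1 - a) * (om n * σ ^ n * ((n+1) * om (n+1) / (n+2) * r ^ (n+2))))) ≤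
        oR ((∫ x, ‖fdv w x‖) * (2 * om n / (n+2) * r ^ (n+2))) := by
      refine le_trans ?_ up
      rw [ENNReal.ofReal_mul zero_le_two, ENNReal.ofReal_mul (by linarith)]
      simp only [ENNReal.ofReal_ofNat]
      gcongr
      calc _ = ∫⁻ l in Ioo (0:ℝ) (1-a), oR (om n * σ ^ n * ((n+1) * om (n+1) / (n+2) * r ^ (n+2))) := by
            rw [setLIntegral_const, Real.volume_Ioo, sub_zero, mul_comm]
        _ ≤ ∫⁻ l in Ioo (0:ℝ) (1-a), ∫⁻ h, ind (Iio r) ‖h‖ * ee {x | l < w x} h := setLIntegral_mono' measurableSet_Ioo low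
        _ ≤ _ := lintegral_mono_set fun l hl => hl.1
    have nn : 0 ≤ ∫ x, ‖fdv w x‖ := integral_nonneg fun _ => norm_nonneg _
    rw [ENNReal.ofReal_le_ofReal_iff (by positivity)] at both
    have c0 : 0 < 2 * om n / (n+2) * r ^ (n+2) := by positivity
    refine le_of_mul_le_mul_right (le_trans (le_of_eq ?_) both) c0
    field_simp
  have lim : Tendsto (fun σ => (1 - a) * ((n+1) * om (n+1) * σ ^ n)) (𝓝[<] ρ) (𝓝 ((1 - a) * ((n+1) * om (n+1) * ρ ^ n))) := by
    refine Tendsto.mono_left ?_ nhdsWithin_le_nhds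
    exact Continuous.tendsto (by fun_prop) ρ
  refine le_of_tendsto lim ?_
  filter_upwards [Ioo_mem_nhdsLT hρ] with σ hσ using main σ hσ

theorem psi_ineq {n : ℕ} (hn : 1 ≤ n) {p : ℝ} (hp : 0 < p) :
    n + 1 + (1 / n) * ((p ^ n - 1) ^ 2 / (1 + p ^ n)) ≤ p ^ n + n / p := by
  have hn' : (0:ℝ) < n := by exact_mod_cast hn
  have hb := one_add_mul_le_pow (show (-2:ℝ) ≤ p - 1 by linarith) n
  rw [add_sub_cancel] at hb
  have hG := mul_geom_sum p n
  set G := ∑ i ∈ Finset.range n, p ^ i with hGd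
  have hG0 : 0 ≤ G := Finset.sum_nonneg fun i _ => by positivity
  have hpG : p * G ≤ n * (1 + p ^ n) := by
    rw [hGd, Finset.mul_sum]
    calc _ ≤ ∑ i ∈ Finset.range n, (1 + p ^ n) := by
          refine Finset.sum_le_sum fun i hi => ?_
          rw [← pow_succ']
          rcases le_total p 1 with h | h
          · linarith [pow_le_one₀ hp.le h (n := i + 1), pow_pos hp n]
          · have : i + 1 ≤ n := by have := Finset.mem_range.1 hi; omega
            linarith [pow_le_pow_right₀ h this]
      _ = _ := by simp; ring
  have k1 : (1 / n) * ((p ^ n - 1) ^ 2 / (1 + p ^ n)) ≤ (p - 1) * (p ^ n - 1) / p := by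
    rw [← hG, div_mul_div_comm, div_le_div_iff₀ (by positivity) hp]
    have := mul_le_mul_of_nonneg_left hpG (mul_nonneg (sq_nonneg (p-1)) hG0)
    nlinarith
  have k2 : (p - 1) * (p ^ n - 1) / p ≤ p ^ n + n / p - (n + 1) := by
    have : p ^ n + n / p - (n + 1) = (p * p ^ n + n - (n+1) * p) / p := by field_simp
    rw [this]
    gcongr
    nlinarith
  linarith

theorem dir_ineq {r a b T S : ℝ} (hr : 0 ≤ r) (h : a ^ 2 + b ^ 2 ≤ r ^ 2) (hTS : T ^ 2 + S ^ 2 = 1) :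
    0 ≤ r + T * a - S * b ∧ (a + T * r) ^ 2 ≤ 2 * r * (r + T * a - S * b) := by
  constructor
  · have : (S * b - T * a) ^ 2 ≤ r ^ 2 := by nlinarith [sq_nonneg (T * b + S * a)]
    linarith [abs_le_of_sq_le_sq' this hr]
  · have e : S ^ 2 = 1 - T ^ 2 := by linarith
    nlinarith [sq_nonneg (S * r - b)]

theorem clm_split {e : X} (he : ‖e‖ = 1) (L : X →L[ℝ] ℝ) : (L e) ^ 2 + ‖L.comp (ℝ ∙ e)ᗮ.subtypeL‖ ^ 2 ≤ ‖L‖ ^ 2 := by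
  set v := (InnerProductSpace.toDual ℝ X).symm L with hv
  have hL : ∀ x, L x = inn v x := fun x => by rw [hv, InnerProductSpace.toDual_symm_apply]
  have hn : ‖L‖ = ‖v‖ := by rw [hv, LinearIsometryEquiv.norm_map]
  have h1 : ‖v - (L e) • e‖ ^ 2 = ‖v‖ ^ 2 - (L e) ^ 2 := by
    rw [norm_sub_sq_real, inner_smul_right, norm_smul, he, ← hL, Real.norm_eq_abs, mul_one, sq_abs]; ring
  have h2 : ‖L.comp (ℝ ∙ e)ᗮ.subtypeL‖ ≤ ‖v - (L e) • e‖ := by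
    refine ContinuousLinearMap.opNorm_le_bound _ (norm_nonneg _) fun y => ?_
    have : L.comp (ℝ ∙ e)ᗮ.subtypeL y = inn (v - (L e) • e) (y:X) := by
      rw [inner_sub_left, inner_smul_left, yo_inner]; simp [hL]
    rw [this]
    exact norm_inner_le_norm _ _
  have := pow_le_pow_left₀ (norm_nonneg (L.comp (ℝ ∙ e)ᗮ.subtypeL)) h2 2
  rw [hn]; linarith

theorem slice_ineq [Nontrivial X] {k : ℕ} (hk : frk X = k + 1) {u : X → ℝ} (hu : ContDiff ℝ 1 u) (hc : HasCompactSupport u)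
    (h0 : ∀ x, 0 ≤ u x) (h1 : ∀ x, u x ≤ 1) {S ε : ℝ} (hS : 0 < S) (hε : 0 < ε) (hε1 : ε ≤ 1/2) {n : ℕ} (hnk : n = k + 1) {P : ℝ}
    (hP : P = (∫ x, u x) / (om n * S ^ n)) :
    (1 - 2 * ε) * ((∫ x, u x) * (n + 1 + (1 / n) * ((P - 1) ^ 2 / (1 + P)))) - (n + 2) * (∫ x, u x * (1 - u x)) / ε ^ 2
      ≤ (∫ x, u x) * P + S * ∫ x, ‖fdv u x‖ := by
  set α := ∫ x, u x with hα
  set κ := ∫ x, u x * (1 - u x) with hκ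
  have iu : Integrable u := hu.continuous.integrable_of_hasCompactSupport hc
  have ik : Integrable fun x => u x * (1 - u x) :=
    (hu.continuous.mul (continuous_const.sub hu.continuous)).integrable_of_hasCompactSupport (hc.mul_right)
  have α0 : 0 ≤ α := integral_nonneg h0
  have κ0 : 0 ≤ κ := integral_nonneg fun x => mul_nonneg (h0 x) (sub_nonneg.2 (h1 x))
  have hom := om_pos n
  have P0 : 0 ≤ P := by rw [hP]; positivity
  have T0 : 0 ≤ ∫ x, ‖fdv u x‖ := integral_nonneg fun _ => norm_nonneg _
  have hn1 : (1:ℝ) ≤ n := by rw [hnk]; push_cast; linarith [(Nat.cast_nonneg k : (0:ℝ) ≤ k)]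
  have g0 : 0 ≤ (P - 1) ^ 2 / (1 + P) := by positivity
  by_cases hg : κ ≤ ε ^ 2 * α
  · rcases α0.eq_or_lt with hz | hpos
    · rw [← hz]; simp; have : 0 ≤ (n + 2) * κ / ε ^ 2 := by positivity
      nlinarith [mul_nonneg hS.le T0]
    set R := (α / om n) ^ (1 / (n:ℝ)) with hR
    have hRn : R ^ n = α / om n := by
      rw [hR, ← Real.rpow_natCast, ← Real.rpow_mul (by positivity), one_div, inv_mul_cancel₀ (by positivity), Real.rpow_one]
    have hR0 : 0 < R := Real.rpow_pos_of_pos (by positivity) _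
    set ρ := ((1 - ε) * (α / om n)) ^ (1 / (n:ℝ)) with hρ
    have h1e : 0 < 1 - ε := by linarith
    have hρn : ρ ^ n = (1 - ε) * (α / om n) := by
      rw [hρ, ← Real.rpow_natCast, ← Real.rpow_mul (by positivity), one_div, inv_mul_cancel₀ (by positivity), Real.rpow_one]
    have hρ0 : 0 < ρ := Real.rpow_pos_of_pos (by positivity) _
    have hρR : ρ ≤ R := by
      refine le_of_pow_le_pow_left₀ (n := n) (by omega) hR0.le ?_
      rw [hρn, hRn]; have : 0 < α / om n := by positivity
      nlinarith
    have key := iso hk hu hc h0 (a := ε) (by linarith) hρ0 (fun l hl => by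
      have fin : volume {x | l < u x} ≠ ⊤ := by
        refine ne_top_of_le_ne_top hc.isCompact.measure_lt_top.ne (measure_mono fun x hx => subset_tsupport u ?_)
        have : l < u x := hx
        exact ne_of_gt (hl.1.trans this)
      rw [← hnk, hρn, ENNReal.ofReal_le_iff_le_toReal fin, mul_div_assoc', mul_div_cancel₀ _ hom.ne']
      have hE : MeasurableSet {x | l < u x} := measurableSet_lt measurable_const hu.continuous.measurable
      have i1 : Integrable ({x | l < u x}.indicator (fun _ => (1:ℝ))) := (integrable_indicator_iff hE).2 (integrableOn_const fin)
      have : α ≤ ∫ x, ({x | l < u x}.indicator (fun _ => (1:ℝ)) x + (u x * (1 - u x)) / ε) := by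
        refine integral_mono iu (i1.add (ik.div_const ε)) fun x => ?_
        by_cases hx : l < u x
        · have : 0 ≤ u x * (1 - u x) / ε := div_nonneg (mul_nonneg (h0 x) (sub_nonneg.2 (h1 x))) hε.le
          simp [indicator, hx]; linarith [h1 x]
        · simp [indicator, hx]
          rw [le_div_iff₀ hε]
          have := hl.2
          exact mul_le_mul_of_nonneg_left (by linarith) (h0 x)
      rw [integral_add i1 (ik.div_const ε), integral_div, integral_indicator hE] at this
      simp only [integral_const, smul_eq_mul, mul_one, MeasurableSet.univ, measureReal_restrict_apply, univ_inter] at this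
      change _ ≤ volume.real _
      have : κ / ε ≤ ε * α := by rw [div_le_iff₀ hε]; nlinarith
      linarith)
    rw [← hnk] at key
    have hk' : (k:ℝ) + 1 = n := by rw [hnk]; push_cast; ring
    rw [hk'] at key
    have e1 : (1 - ε) * (α / om n) / R ≤ ρ ^ k := by
      rw [div_le_iff₀ hR0, ← hρn, hnk, pow_succ]
      gcongr
    have hp := psi_ineq (n := n) (by omega) (div_pos hR0 hS)
    have hPp : (R / S) ^ n = P := by rw [div_pow, hRn, hP, div_div]
    rw [hPp] at hp
    have e2 : (1 - ε) ^ 2 * (α * (n / (R / S))) ≤ S * ∫ x, ‖fdv u x‖ := by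
      calc _ = S * ((1 - ε) * (n * om n * ((1 - ε) * (α / om n) / R))) := by field_simp
        _ ≤ S * ((1 - ε) * (n * om n * ρ ^ k)) := by gcongr
        _ ≤ _ := by gcongr
    have e3 : (1 - 2 * ε) * (α * (n / (R / S))) ≤ (1 - ε) ^ 2 * (α * (n / (R / S))) := by
      gcongr; nlinarith
    have e4 : (1 - 2 * ε) * (α * P) ≤ α * P := by nlinarith [mul_nonneg α0 P0]
    have e5 : (1 - 2 * ε) * (α * (n + 1 + (1 / n) * ((P - 1) ^ 2 / (1 + P)))) ≤ (1 - 2 * ε) * (α * (P + n / (R / S))) := by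
      have : 0 ≤ 1 - 2 * ε := by linarith
      gcongr
    have e6 : 0 ≤ (n + 2) * κ / ε ^ 2 := by positivity
    rw [mul_add α P, mul_add (1 - 2*ε)] at e5
    linarith
  · push Not at hg
    have e1 : (n + 2) * α ≤ (n + 2) * κ / ε ^ 2 := by
      rw [le_div_iff₀ (by positivity)]; nlinarith
    have e2 : (1 / n) * ((P - 1) ^ 2 / (1 + P)) ≤ 1 + P := by
      have : (P - 1) ^ 2 / (1 + P) ≤ 1 + P := by rw [div_le_iff₀ (by positivity)]; nlinarith
      have h3 : 1 / (n:ℝ) ≤ 1 := by rw [div_le_one (by linarith)]; exact hn1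
      nlinarith
    have e3 : (1 - 2 * ε) * (α * (n + 1 + (1 / n) * ((P - 1) ^ 2 / (1 + P)))) ≤ 1 * (α * (n + 1 + (1 + P))) := by
      gcongr; linarith
    have e4 := mul_nonneg hS.le T0
    have e5 : 1 * (α * (n + 1 + (1 + P))) = (n+2) * α + α * P := by ring
    linarith

theorem transport {α β : ℝ → ℝ} (hα : Continuous α) (h0 : ∀ x, 0 ≤ α x) (hc : HasCompactSupport α) (hV : 0 < ∫ x, α x)
    (hβ : Continuous β) {z : ℝ} (hz : 0 < z) (hp : ∀ x ∈ Icc (-z) z, 0 < β x) :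
    ∃ (T : ℝ → ℝ) (c : ℝ), T c = 0 ∧ (∀ τ, T τ ∈ Icc (-z) z) ∧
      ∀ τ, HasDerivAt T ((∫ x in (-z)..z, β x) / (∫ x, α x) * α τ / β (T τ)) τ := by
  set V := ∫ x, α x with hVd
  set B := ∫ x in (-z)..z, β x with hB
  have hzz : -z ≤ z := by linarith
  obtain ⟨x0, hx0, hmin⟩ := isCompact_Icc.exists_isMinOn (nonempty_Icc.2 hzz) hβ.continuousOn
  set m := β x0 with hm
  have hm0 : 0 < m := hp x0 hx0
  have hmem : ∀ x, max (-z) (min x z) ∈ Icc (-z) z := fun x => ⟨le_max_left _ _, max_le hzz (min_le_right _ _)⟩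
  set b : ℝ → ℝ := fun x => β (max (-z) (min x z)) with hb
  have bc : Continuous b := hβ.comp (by fun_prop)
  have bm : ∀ x, m ≤ b x := fun x => hmin (hmem x)
  set f : ℝ → ℝ := fun x => ∫ s in (-z)..x, b s with hf
  have hfd : ∀ x, HasDerivAt f (b x) x := fun x => intervalIntegral.integral_hasDerivAt_right (bc.intervalIntegrable _ _)
    (bc.stronglyMeasurableAtFilter _ _) bc.continuousAt
  have fm : StrictMono f := strictMono_of_hasDerivAt_pos hfd fun x => hm0.trans_le (bm x)
  have fz : f (-z) = 0 := intervalIntegral.integral_same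
  have fB : f z = B := by
    refine intervalIntegral.integral_congr fun x hx => ?_
    rw [uIcc_of_le hzz] at hx
    simp only [hb]; rw [min_eq_left hx.2, max_eq_right hx.1]
  have fcont : Continuous f := continuous_iff_continuousAt.2 fun x => (hfd x).continuousAt
  have mono : Monotone fun x => f x - m * (x + z) := by
    refine monotone_of_hasDerivAt_nonneg (f' := fun x => b x - m) (fun x => ?_) (fun x => sub_nonneg.2 (bm x))
    have := ((hasDerivAt_id x).add_const z).const_mul m
    exact ((hfd x).sub this).congr_deriv (by simp)
  have fs : Function.Surjective f := by
    refine fcont.surjective ?_ ?_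
    · refine tendsto_atTop_mono' (f₁ := fun x => m * (x + z)) _ ?_ ?_
      · filter_upwards [eventually_ge_atTop (-z)] with x hx
        have := mono hx; simp [fz] at this; linarith
      · exact (tendsto_atTop_add_const_right _ _ tendsto_id).const_mul_atTop hm0
    · refine tendsto_atBot_mono' _ (show f ≤ᶠ[atBot] fun x => m * (x + z) from ?_) ?_
      · filter_upwards [eventually_le_atBot (-z)] with x hx
        have := mono hx; simp [fz] at this; linarith
      · exact (tendsto_atBot_add_const_right _ _ tendsto_id).const_mul_atBot hm0
  set o := fm.orderIsoOfSurjective f fs with ho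
  have of : ∀ x, f (o.symm x) = x := fun x => o.apply_symm_apply x
  have B0 : 0 < B := by rw [← fB, ← fz]; exact fm (by linarith)
  have iα : Integrable α := hα.integrable_of_hasCompactSupport hc
  set v : ℝ → ℝ := fun τ => ∫ x in Iic τ, α x with hv
  have v0 : ∀ τ, 0 ≤ v τ := fun τ => integral_nonneg h0
  have vV : ∀ τ, v τ ≤ V := fun τ => setIntegral_le_integral iα (ae_of_all _ h0)
  have vd : ∀ τ, HasDerivAt v (α τ) τ := by
    intro τ
    have e : v = fun τ => v 0 + ∫ x in (0:ℝ)..τ, α x := by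
      ext τ; rw [← intervalIntegral.integral_Iic_sub_Iic iα.integrableOn iα.integrableOn]; simp [hv]
    rw [e]
    exact (intervalIntegral.integral_hasDerivAt_right (hα.intervalIntegrable _ _)
      (hα.stronglyMeasurableAtFilter _ _) hα.continuousAt).const_add _
  have vcont : Continuous v := continuous_iff_continuousAt.2 fun x => (vd x).continuousAt
  have gd : ∀ x, HasDerivAt o.symm (b (o.symm x))⁻¹ x := fun x =>
    (hfd (o.symm x)).of_local_left_inverse o.symm.continuous.continuousAt (ne_of_gt (hm0.trans_le (bm _))) (Eventually.of_forall of)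
  have key : ∀ τ, o.symm (B / V * v τ) ∈ Icc (-z) z := by
    intro τ
    have h1 : 0 ≤ B / V * v τ := by have := v0 τ; positivity
    have h2 : B / V * v τ ≤ B := by
      rw [div_mul_eq_mul_div, div_le_iff₀ hV]; exact mul_le_mul_of_nonneg_left (vV τ) B0.le
    constructor
    · rw [← fm.le_iff_le, of, fz]; exact h1
    · rw [← fm.le_iff_le, of, fB]; exact h2
  obtain ⟨A, hA⟩ := hc.isCompact.isBounded.subset_closedBall 0
  have out : ∀ x, A < |x| → α x = 0 := by
    intro x hx; by_contra h
    have := hA (subset_tsupport α h)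
    simp at this; linarith
  have f0 : 0 < f 0 ∧ f 0 < B := by constructor <;> [rw [← fz]; rw [← fB]] <;> exact fm (by linarith)
  obtain ⟨c, hcc⟩ : ∃ c, v c = f 0 * V / B := by
    have hy : 0 ≤ f 0 * V / B ∧ f 0 * V / B ≤ V := by
      refine ⟨by have := f0.1; positivity, ?_⟩
      rw [div_le_iff₀ B0]; nlinarith [f0.2]
    have e1 : v (-(|A|+1)) = 0 := by
      refine setIntegral_eq_zero_of_forall_eq_zero fun x hx => out x ?_
      have h1 : x ≤ -(|A|+1) := hx
      have h2 := neg_le_abs x; have h3 := le_abs_self A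
      linarith
    have e2 : v (|A|+1) = V := by
      refine setIntegral_eq_integral_of_forall_compl_eq_zero fun x hx => out x ?_
      have h1 : |A| + 1 < x := by simpa using hx
      have h2 := le_abs_self x; have h3 := le_abs_self A
      linarith
    have := intermediate_value_Icc (show -(|A|+1) ≤ |A|+1 by have := abs_nonneg A; linarith) vcont.continuousOn
    rw [e1, e2] at this
    obtain ⟨c, -, h⟩ := this hy
    exact ⟨c, h⟩
  refine ⟨fun τ => o.symm (B / V * v τ), c, ?_, key, fun τ => ?_⟩
  · have : B / V * v c = f 0 := by rw [hcc]; field_simp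
    show o.symm (B / V * v c) = 0
    rw [this]; exact o.symm_apply_apply 0
  · have := (gd (B / V * v τ)).comp τ ((vd τ).const_mul (B / V))
    refine this.congr_deriv ?_
    have h := key τ
    have e : b (o.symm (B / V * v τ)) = β (o.symm (B / V * v τ)) := by
      simp only [hb]; rw [min_eq_left h.2, max_eq_right h.1]
    rw [e]; field_simp

theorem beta_int {e : X} (he : ‖e‖ = 1) {n : ℕ} (hn : frk X = n + 1) (h1 : 1 ≤ n) :
    ∫⁻ t : ℝ, oR (om n * √(1 - t ^ 2) ^ n) = oR (om (n+1)) := by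
  have hv := vol_ball_om hn (0:X) one_pos
  rw [one_pow, mul_one] at hv
  rw [← hv, vol_ind measurableSet_ball, lint_sl he (ind_meas measurableSet_ball)]
  congr 1; ext t
  have key : ∀ y : (ℝ ∙ e)ᗮ, ind (Bal (0:X) 1) (sl e (t, y)) = ind (Bal (0:(ℝ ∙ e)ᗮ) √(1 - t ^ 2)) y := by
    intro y
    have : sl e (t, y) ∈ Bal (0:X) 1 ↔ y ∈ Bal (0:(ℝ ∙ e)ᗮ) √(1 - t ^ 2) := by
      rw [sl_ball he zero_le_one, mem_ball_zero_iff, Real.lt_sqrt (norm_nonneg y)]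
      constructor <;> intro h <;> simp at h ⊢ <;> linarith
    by_cases h : sl e (t, y) ∈ Bal (0:X) 1
    · rw [ind_of_mem h, ind_of_mem (this.1 h)]
    · rw [ind_of_not h, ind_of_not (fun h' => h (this.2 h'))]
  simp_rw [key]
  rw [← vol_ind measurableSet_ball]
  rcases (Real.sqrt_nonneg (1 - t ^ 2)).eq_or_lt with h | h
  · rw [← h, zero_pow (by omega)]; simp
  · rw [vol_ball_om (yo_finrank he hn) _ h]

theorem ibp {w f f' : X → ℝ} {e : X} (hw : ContDiff ℝ 1 w) (hc : HasCompactSupport w) (hf : ContDiff ℝ 1 f)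
    (h : ∀ x, HasDerivAt (fun s : ℝ => f (x + s • e)) (f' x) 0) :
    ∫ x, f x * fdv w x e = - ∫ x, f' x * w x := by
  have e1 : ∀ x, fdv f x e = f' x := by
    intro x
    have a : HasFDerivAt f (fdv f (x + (0:ℝ) • e)) (x + (0:ℝ) • e) := (hf.differentiable one_ne_zero _).hasFDerivAt
    have b : HasDerivAt (fun s : ℝ => x + s • e) e 0 := by
      simpa using ((hasDerivAt_id (0:ℝ)).smul_const e).const_add x
    have := (a.comp_hasDerivAt 0 b).unique (h x)
    simpa using this
  have cf : Continuous fun x => fdv f x e := (hf.continuous_fderiv one_ne_zero).clm_apply continuous_const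
  have cw : Continuous fun x => fdv w x e := (hw.continuous_fderiv one_ne_zero).clm_apply continuous_const
  have sw : HasCompactSupport fun x => fdv w x e := (hc.fderiv (𝕜 := ℝ)).comp_left (g := fun L : X →L[ℝ] ℝ => L e) rfl
  have := integral_mul_fderiv_eq_neg_fderiv_mul_of_integrable (μ := volume) (f := f) (g := w) (v := e)
    ((cf.mul hw.continuous).integrable_of_hasCompactSupport hc.mul_left)
    ((hf.continuous.mul cw).integrable_of_hasCompactSupport sw.mul_left)
    ((hf.continuous.mul hw.continuous).integrable_of_hasCompactSupport hc.mul_left)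
    (fun x _ => hf.differentiable one_ne_zero x) (fun x _ => hw.differentiable one_ne_zero x)
  rw [this]; simp_rw [e1]

theorem sl_zero {e : X} (he : ‖e‖ = 1) {g : X → ℝ} (hc : HasCompactSupport g) :
    ∃ A : ℝ, ∀ t (y : (ℝ ∙ e)ᗮ), (A < |t| ∨ A < ‖y‖) → g (sl e (t, y)) = 0 := by
  obtain ⟨A, hA⟩ := hc.isCompact.isBounded.subset_closedBall 0
  refine ⟨A, fun t y h => ?_⟩
  by_contra h'
  have h1 := hA (subset_tsupport g h')
  simp at h1
  have h2 := slice_norm he t y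
  have h3 : ‖t • e + (y:X)‖ ≤ A := h1
  have h4 := pow_le_pow_left₀ (norm_nonneg _) h3 2
  have h5 := norm_nonneg (t • e + (y:X))
  rcases h with h | h
  · nlinarith [sq_abs t, sq_nonneg ‖y‖]
  · nlinarith [sq_nonneg t]

theorem slice_cont {e : X} (he : ‖e‖ = 1) {g : X → ℝ} (hg : Continuous g) (hc : HasCompactSupport g) :
    Continuous (fun t : ℝ => ∫ y : (ℝ ∙ e)ᗮ, g (sl e (t, y))) ∧ HasCompactSupport (fun t : ℝ => ∫ y : (ℝ ∙ e)ᗮ, g (sl e (t, y))) := by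
  obtain ⟨A, hA⟩ := sl_zero he hc
  constructor
  · have : (fun t : ℝ => ∫ y : (ℝ ∙ e)ᗮ, g (sl e (t, y))) = fun t => ∫ y in Metric.closedBall (0:(ℝ ∙ e)ᗮ) A, g (sl e (t, y)) := by
      ext t; symm
      refine setIntegral_eq_integral_of_forall_compl_eq_zero fun y hy => hA t y (Or.inr ?_)
      simpa using hy
    rw [this]
    exact continuous_parametric_integral_of_continuous (f := fun t y => g (sl e (t, y))) (hg.comp (sl_cont e)) (isCompact_closedBall _ _)
  · refine HasCompactSupport.intro (isCompact_closedBall (0:ℝ) A) fun t ht => ?_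
    have : A < |t| := by simpa using ht
    simp [hA t _ (Or.inl this)]

theorem slice_int {e : X} (he : ‖e‖ = 1) {g : X → ℝ} (hg : Continuous g) (hc : HasCompactSupport g) (t : ℝ) :
    HasCompactSupport (fun y : (ℝ ∙ e)ᗮ => g (sl e (t, y))) := by
  obtain ⟨A, hA⟩ := sl_zero he hc
  refine HasCompactSupport.intro (isCompact_closedBall (0:(ℝ ∙ e)ᗮ) A) fun y hy => hA t y (Or.inr ?_)
  simpa using hy

theorem cd1 {T q : ℝ → ℝ} (h : ∀ x, HasDerivAt T (q x) x) (hq : Continuous q) : ContDiff ℝ 1 T := by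
  rw [contDiff_one_iff_deriv]
  refine ⟨fun x => (h x).differentiableAt, ?_⟩
  rwa [show deriv T = q from funext fun x => (h x).deriv]

def WH (n : ℕ) (w : X → ℝ) (ε : ℝ) : Prop :=
  ContDiff ℝ 1 w ∧ HasCompactSupport w ∧ (∀ x, 0 ≤ w x) ∧ (∀ x, w x ≤ 1) ∧ |(∫ x, w x) - om (n+1)| ≤ ε ∧
    ∫ x, w x * (1 - w x) ≤ ε ^ 3 ∧ ∫ x, ‖fdv w x‖ ≤ (n+1) * om (n+1) + ε

theorem beta_bound {e : X} (he : ‖e‖ = 1) {n : ℕ} (hn : frk X = n + 1) (h1 : 1 ≤ n) {ε : ℝ} (h0 : 0 ≤ ε) (hε : ε ≤ 1) :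
    om (n+1) - 2 * ε * om n ≤ (∫ t in (-(1-ε))..(1-ε), om n * √(1 - t ^ 2) ^ n) ∧
    (∫ t in (-(1-ε))..(1-ε), om n * √(1 - t ^ 2) ^ n) ≤ om (n+1) := by
  have hb := beta_int he hn h1
  have hom := om_pos n
  set β : ℝ → ℝ := fun t => om n * √(1 - t ^ 2) ^ n with hβ
  have bc : Continuous β := by fun_prop
  have b0 : ∀ t, 0 ≤ β t := fun t => by positivity
  have bi : Integrable β := by
    refine ⟨bc.aestronglyMeasurable, ?_⟩
    rw [hasFiniteIntegral_iff_ofReal (ae_of_all _ b0), hb]; exact ENNReal.ofReal_lt_top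
  have bI : ∫ t, β t = om (n+1) := by
    rw [integral_eq_lintegral_of_nonneg_ae (ae_of_all _ b0) bc.aestronglyMeasurable, hb, ENNReal.toReal_ofReal (om_pos _).le]
  have bz : ∀ t, 1 ≤ |t| → β t = 0 := by
    intro t ht
    have : 1 - t ^ 2 ≤ 0 := by nlinarith [sq_abs t]
    simp only [hβ]; rw [Real.sqrt_eq_zero_of_nonpos this, zero_pow (by omega), mul_zero]
  have b1 : ∀ t, β t ≤ om n := by
    intro t
    have : √(1 - t ^ 2) ≤ 1 := Real.sqrt_le_one.2 (by nlinarith [sq_nonneg t])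
    have := pow_le_one₀ (n := n) (Real.sqrt_nonneg _) this
    simp only [hβ]; nlinarith
  have ii : ∀ a b, IntervalIntegrable β volume a b := fun a b => bc.intervalIntegrable a b
  constructor
  · have e1 : om (n+1) = ∫ t in (-1:ℝ)..1, β t := by
      rw [← bI, intervalIntegral.integral_of_le (by norm_num)]; symm
      refine setIntegral_eq_integral_of_forall_compl_eq_zero fun t ht => bz t ?_
      by_contra h
      push Not at h
      exact ht ⟨(abs_lt.1 h).1, (abs_lt.1 h).2.le⟩
    have e2 : ∀ a b, a ≤ b → ∫ t in a..b, β t ≤ (b - a) * om n := by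
      intro a b hab
      calc _ ≤ ∫ t in a..b, om n := intervalIntegral.integral_mono_on hab (ii _ _) (by simp) fun t _ => b1 t
        _ = _ := by simp
    have e3 := intervalIntegral.integral_add_adjacent_intervals (ii (-1) (-(1-ε))) (ii (-(1-ε)) (1-ε))
    have e4 := intervalIntegral.integral_add_adjacent_intervals (ii (-1) (1-ε)) (ii (1-ε) 1)
    have e5 := e2 (-1) (-(1-ε)) (by linarith)
    have e6 := e2 (1-ε) 1 (by linarith)
    have : (-(1-ε) - -1) * om n = ε * om n := by ring
    have : (1 - (1-ε)) * om n = ε * om n := by ring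
    linarith
  · rw [intervalIntegral.integral_of_le (by linarith), ← bI]
    exact setIntegral_le_integral bi (ae_of_all _ b0)

theorem csupp_comp {w : X → ℝ} (hc : HasCompactSupport w) {g : X → ℝ} (hg : ∀ x, fdv w x = 0 → g x = 0) : HasCompactSupport g := by
  refine HasCompactSupport.intro (hc.fderiv (𝕜 := ℝ)).isCompact fun x hx => hg x ?_
  exact image_eq_zero_of_notMem_tsupport hx

theorem nm1 {n C ε : ℝ} (hn : 1 ≤ n) (hC : 0 < C) (hε : 0 < ε) (h : ε * (n * (4 + 4 * C) * 2) ≤ 1) : C * ε ≤ 1 := by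
  nlinarith [mul_pos hC hε, mul_le_mul_of_nonneg_right hn (mul_pos hC hε).le]

theorem nm2 {ε t : ℝ} (hε : 0 < ε) (h : t ∈ Icc (-(1-ε)) (1-ε)) : 0 < 1 - t ^ 2 := by nlinarith [h.1, h.2]

theorem nm3 (p : ℝ) : 0 ≤ p ^ 2 - 2 * p + 5 := by nlinarith [sq_nonneg (p - 1)]

theorem nm4 {n C ε : ℝ} (hn : 1 ≤ n) (hC : 0 < C) (hε : 0 < ε) (h : ε * (n * (4 + 4 * C) * 2) ≤ 1) : 0 ≤ 1 - 4 * ε - 4 * C * ε * n := by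
  have := mul_le_mul_of_nonneg_left hn hε.le
  have : 0 < C * ε * n := by positivity
  nlinarith

theorem nm5 {n ε α g P q C K Z : ℝ} (h1 : (1 - 2 * ε) * (α * (n + 1 + (1 / n) * g)) - K ≤ α * P + Z)
    (h2 : α * P ≤ α * q + C * ε * (α * (3 + 2 * g))) (h3 : 1 / (2 * n) * (α * g) ≤ ((1 - 2 * ε) * (1 / n) - 2 * C * ε) * (α * g)) :
    (1 - 2 * ε) * (n+1) * α + 1 / (2 * n) * (α * g) - 3 * C * ε * α - K ≤ α * q + Z := by linarith

theorem nm6 {σ P x : ℝ} (h : 0 < σ) (h1 : σ ≤ 1) (hx : 0 ≤ x) (hP : P ≤ 1 + x) : σ * (1 + P) / 2 ≤ σ + x / 2 := by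
  have := mul_le_mul_of_nonneg_left hP h.le
  have := mul_le_of_le_one_left hx h1
  linarith
set_option maxHeartbeats 2000000 in

theorem dir_main [Nontrivial X] {n : ℕ} (hn : frk X = n + 1) (h1n : 1 ≤ n) :
    ∃ C > 0, ∃ ε₀ > 0, ∀ (w : X → ℝ) (ε : ℝ) (e : X), 0 < ε → ε ≤ ε₀ → WH n w ε → ‖e‖ = 1 →
      ∃ (T q : ℝ → ℝ) (c : ℝ), T c = 0 ∧ (∀ τ, |T τ| ≤ 1) ∧ (∀ τ, HasDerivAt T (q τ) τ) ∧ Continuous q ∧ (∀ τ, 0 ≤ q τ) ∧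
        ∫ x, |fdv w x e + T (inn e x) * ‖fdv w x‖| ≤ C * √ε ∧
        ∫ x, w x * |q (inn e x) - 1| ≤ C * √ε := by
  have hom := om_pos n
  set ω := om (n+1) with hω
  have hω0 : 0 < ω := om_pos (n+1)
  have hn0 : (1:ℝ) ≤ n := by exact_mod_cast h1n
  set C1 := (1 + 2 * om n) / (ω / 2) with hC1
  have hC1p : 0 < C1 := by positivity
  set C2 := (n+1) + 1 + 4 * (n+1) * ω + 6 * C1 * ω + (n+2) with hC2
  have hC2p : 0 < C2 := by positivity
  set TV := (n+1) * ω + 1 with hTV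
  have hTVp : 0 < TV := by positivity
  refine ⟨TV + C2 + (2*n*C2 + 4 * ω + C1 * (6 * ω + 4 * n * C2)), by positivity, min (1/4) (min (ω/2) (1 / (n * (4 + 4 * C1) * 2))), by positivity, ?_⟩
  intro w ε e hε hε₀ hW he
  obtain ⟨hw, hc, w0, w1, hV, hκ, hTVw⟩ := hW
  have ε1 : ε ≤ 1/4 := hε₀.trans (min_le_left _ _)
  have ε2 : ε ≤ ω/2 := hε₀.trans ((min_le_right _ _).trans (min_le_left _ _))
  have ε3 : ε * (n * (4 + 4 * C1) * 2) ≤ 1 := by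
    rw [← le_div_iff₀ (by positivity)]; exact hε₀.trans ((min_le_right _ _).trans (min_le_right _ _))
  set V := ∫ x, w x with hVd
  have hV' := abs_le.1 hV
  have Vp : ω / 2 ≤ V := by linarith
  have V2 : V ≤ 2 * ω := by linarith
  have wc := hw.continuous
  have cf : Continuous (fdv w) := hw.continuous_fderiv one_ne_zero
  have iw : Integrable w := wc.integrable_of_hasCompactSupport hc
  set α : ℝ → ℝ := fun t => ∫ y : (ℝ ∙ e)ᗮ, w (sl e (t, y)) with hα
  obtain ⟨αc, αs⟩ := slice_cont he wc hc
  have α0 : ∀ t, 0 ≤ α t := fun t => integral_nonneg fun y => w0 _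
  have αV : ∫ t, α t = V := (int_sl he iw).symm
  set β : ℝ → ℝ := fun t => om n * √(1 - t ^ 2) ^ n with hβ
  have bc : Continuous β := by fun_prop
  have hz : (0:ℝ) < 1 - ε := by linarith
  have S1 : ∀ t ∈ Icc (-(1-ε)) (1-ε), 0 < √(1 - t ^ 2) := fun t ht => Real.sqrt_pos.2 (nm2 hε ht)
  obtain ⟨T, c, Tc, Tm, Td⟩ := transport αc α0 αs (by rw [αV]; linarith) bc hz (fun t ht => mul_pos hom (pow_pos (S1 t ht) n))
  rw [αV] at Td
  obtain ⟨B1, B2⟩ := beta_bound he hn h1n hε.le (by linarith)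
  set B := ∫ t in (-(1-ε))..(1-ε), β t with hB
  have B1' : ω - 2 * ε * om n ≤ B := B1
  have B2' : B ≤ ω := B2
  set θ := B / V with hθ
  have θ1 : |θ - 1| ≤ C1 * ε := by
    have Vp' : 0 < V := by linarith
    have : θ - 1 = (B - V) / V := by rw [hθ]; field_simp
    rw [this, abs_div, abs_of_pos Vp', div_le_iff₀ Vp']
    have h2 : |B - V| ≤ (1 + 2 * om n) * ε := by
      have := mul_pos hε hom; rw [abs_le]; constructor <;> linarith
    refine h2.trans ?_
    have : (1 + 2 * om n) * ε = C1 * ε * (ω/2) := by rw [hC1]; field_simp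
    rw [this]; gcongr
  set P : ℝ → ℝ := fun t => α t / β (T t) with hP
  have bT : ∀ t, 0 < β (T t) := fun t => mul_pos hom (pow_pos (S1 _ (Tm t)) n)
  have P0 : ∀ t, 0 ≤ P t := fun t => div_nonneg (α0 t) (bT t).le
  have Tcont : Continuous T := continuous_iff_continuousAt.2 fun x => (Td x).continuousAt
  have Pc : Continuous P := αc.div (bc.comp Tcont) fun t => (bT t).ne'
  set q : ℝ → ℝ := fun t => θ * P t with hq
  have Td' : ∀ t, HasDerivAt T (q t) t := fun t => (Td t).congr_deriv (by simp only [hq, hP]; ring)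
  have qc : Continuous q := continuous_const.mul Pc
  have θ0 : 0 ≤ θ := by
    have : C1 * ε ≤ 1 := nm1 hn0 hC1p hε ε3
    linarith [(abs_le.1 θ1).1]
  set S : ℝ → ℝ := fun t => √(1 - (T t) ^ 2) with hS
  have Sc : Continuous S := by fun_prop
  have Sp : ∀ t, 0 < S t := fun t => S1 _ (Tm t)
  have TS : ∀ t, T t ^ 2 + S t ^ 2 = 1 := fun t => by
    have := Tm t
    simp only [hS]; rw [Real.sq_sqrt (nm2 hε this).le]; ring
  set g : ℝ → ℝ := fun t => (P t - 1) ^ 2 / (1 + P t) with hg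
  have g0 : ∀ t, 0 ≤ g t := fun t => by have := P0 t; positivity
  have gc : Continuous g := ((Pc.sub continuous_const).pow 2).div (continuous_const.add Pc) fun t => by have := P0 t; positivity
  have gP : ∀ t, P t ≤ 3 + 2 * g t := fun t => by
    have := P0 t
    have e : 3 + 2 * g t - P t = (P t ^ 2 - 2 * P t + 5) / (1 + P t) := by
      simp only [hg]; field_simp; ring
    have : 0 ≤ (P t ^ 2 - 2 * P t + 5) / (1 + P t) := by
      apply div_nonneg (nm3 _) (by linarith)
    linarith
  set b : X → ℝ := fun x => ‖(fdv w x).comp (ℝ ∙ e)ᗮ.subtypeL‖ with hb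
  have bcx : Continuous b := (cf.clm_comp continuous_const).norm
  have bs : HasCompactSupport b := csupp_comp hc fun x hx => by simp only [hb]; rw [hx, ContinuousLinearMap.zero_comp]; exact norm_zero (E := (ℝ ∙ e)ᗮ →L[ℝ] ℝ)
  set κ : ℝ → ℝ := fun t => ∫ y : (ℝ ∙ e)ᗮ, w (sl e (t, y)) * (1 - w (sl e (t, y))) with hκd
  have kc : Continuous fun x => w x * (1 - w x) := wc.mul (continuous_const.sub wc)
  have ks : HasCompactSupport fun x => w x * (1 - w x) := hc.mul_right
  obtain ⟨κc, κs⟩ := slice_cont he kc ks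
  have κI : ∫ t, κ t ≤ ε ^ 3 := by
    rw [hκd, ← int_sl he (kc.integrable_of_hasCompactSupport ks)]; exact hκ
  set τ : ℝ → ℝ := fun t => ∫ y : (ℝ ∙ e)ᗮ, b (sl e (t, y)) with hτ
  obtain ⟨τc, τs⟩ := slice_cont he bcx bs
  obtain ⟨k, hk⟩ : ∃ k, n = k + 1 := ⟨n - 1, by omega⟩
  have fY : frk (ℝ ∙ e)ᗮ = k + 1 := (yo_finrank he hn).trans hk
  haveI : Nontrivial (ℝ ∙ e)ᗮ := Module.nontrivial_of_finrank_pos (R := ℝ) (by omega)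
  have slice : ∀ t, (1 - 2 * ε) * (α t * (n + 1 + (1 / n) * g t)) - (n + 2) * κ t / ε ^ 2 ≤ α t * P t + S t * τ t := by
    intro t
    have hs : ContDiff ℝ 1 fun y : (ℝ ∙ e)ᗮ => w (sl e (t, y)) := by
      refine hw.comp ?_
      unfold sl
      exact (contDiff_const (c := t • e)).add (ℝ ∙ e)ᗮ.subtypeL.contDiff
    have := slice_ineq fY hs (slice_int he wc hc t) (fun y => w0 _) (fun y => w1 _) (Sp t) hε (by linarith) hk (P := P t) rfl
    refine this.trans (le_of_eq ?_)
    congr 2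
    refine integral_congr_ae (ae_of_all _ fun y => ?_)
    show ‖_‖ = ‖_‖
    congr 1
    have h1 : HasFDerivAt (fun y : (ℝ ∙ e)ᗮ => t • e + (y:X)) (ℝ ∙ e)ᗮ.subtypeL y := (ℝ ∙ e)ᗮ.subtypeL.hasFDerivAt.const_add _
    have h2 : HasFDerivAt w (fdv w (t • e + (y:X))) (t • e + (y:X)) := (hw.differentiable one_ne_zero _).hasFDerivAt
    exact (h2.comp y h1).fderiv
  have slice2 : ∀ t, (1 - 2 * ε) * (n+1) * α t + 1 / (2 * n) * (α t * g t) - 3 * C1 * ε * α t - (n + 2) / ε ^ 2 * κ t ≤ α t * q t + S t * τ t := by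
    intro t
    have h1 := slice t
    have hαg : 0 ≤ α t * g t := mul_nonneg (α0 t) (g0 t)
    have h2 : α t * P t ≤ α t * q t + C1 * ε * (α t * (3 + 2 * g t)) := by
      have a1 : (1 - θ) * (α t * P t) ≤ C1 * ε * (α t * P t) :=
        mul_le_mul_of_nonneg_right (by linarith [(abs_le.1 θ1).1]) (mul_nonneg (α0 t) (P0 t))
      have a2 : C1 * ε * (α t * P t) ≤ C1 * ε * (α t * (3 + 2 * g t)) := by
        have := α0 t; have := gP t; gcongr
      have a3 : α t * q t = α t * P t - (1 - θ) * (α t * P t) := by simp only [hq]; ring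
      linarith
    have h3 : 1 / (2 * n) * (α t * g t) ≤ ((1 - 2 * ε) * (1 / n) - 2 * C1 * ε) * (α t * g t) := by
      refine mul_le_mul_of_nonneg_right ?_ hαg
      have : ((1 - 2 * ε) * (1 / n) - 2 * C1 * ε) - 1 / (2 * n) = (1 - 4 * ε - 4 * C1 * ε * n) / (2 * n) := by field_simp; ring
      have h4 : 0 ≤ (1 - 4 * ε - 4 * C1 * ε * n) / (2 * n) := by
        apply div_nonneg _ (by positivity)
        exact nm4 hn0 hC1p hε ε3
      linarith
    have h5 : (n + 2) / ε ^ 2 * κ t = (n + 2) * κ t / ε ^ 2 := by ring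
    rw [h5]
    exact nm5 h1 h2 h3
  have iα : Integrable α := αc.integrable_of_hasCompactSupport αs
  have iκ : Integrable κ := κc.integrable_of_hasCompactSupport κs
  have iag : Integrable fun t => α t * g t := (αc.mul gc).integrable_of_hasCompactSupport αs.mul_right
  have iaq : Integrable fun t => α t * q t := (αc.mul qc).integrable_of_hasCompactSupport αs.mul_right
  have isτ : Integrable fun t => S t * τ t := (Sc.mul τc).integrable_of_hasCompactSupport τs.mul_left
  set G := ∫ t, α t * g t with hG
  have G0 : 0 ≤ G := integral_nonneg fun t => mul_nonneg (α0 t) (g0 t)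
  have I1 : (1 - 2 * ε) * (n+1) * V + 1 / (2 * n) * G - 3 * C1 * ε * V - (n + 2) / ε ^ 2 * (∫ t, κ t) ≤ (∫ t, α t * q t) + ∫ t, S t * τ t := by
    have := integral_mono ((((iα.const_mul _).add (iag.const_mul _)).sub (iα.const_mul _)).sub (iκ.const_mul _)) (iaq.add isτ) slice2
    simp only [Pi.add_apply, Pi.sub_apply] at this
    rw [integral_sub, integral_sub, integral_add, integral_add, integral_const_mul, integral_const_mul, integral_const_mul, integral_const_mul, αV] at this
    · exact this
    · exact iaq
    · exact isτ
    · exact iα.const_mul _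
    · exact iag.const_mul _
    · exact (iα.const_mul _).add (iag.const_mul _)
    · exact iα.const_mul _
    · exact (((iα.const_mul _).add (iag.const_mul _)).sub (iα.const_mul _))
    · exact iκ.const_mul _
  have ic : Continuous fun x : X => inn e x := by fun_prop
  have iprod : ∀ f : ℝ → ℝ, Continuous f → ∫ x, f (inn e x) * w x = ∫ t, α t * f t := by
    intro f hf
    rw [int_sl he (f := fun x => f (inn e x) * w x) (((hf.comp ic).mul wc).integrable_of_hasCompactSupport hc.mul_left)]
    congr 1; ext t
    simp_rw [sl_inner he]
    rw [integral_const_mul, mul_comm]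
  have I2 : ∫ x, T (inn e x) * fdv w x e = - ∫ t, α t * q t := by
    rw [← iprod q qc]
    refine ibp hw hc ((cd1 Td' qc).comp (contDiff_const.inner ℝ contDiff_id)) fun x => ?_
    have h1 : HasDerivAt (fun s : ℝ => inn e (x + s • e)) 1 0 := by
      have : (fun s : ℝ => inn e (x + s • e)) = fun s => inn e x + s := by
        ext s; rw [inner_add_right, inner_smul_right, real_inner_self_eq_norm_sq, he]; ring
      rw [this]; exact (hasDerivAt_id (0:ℝ)).const_add _
    have h2 : HasDerivAt T (q (inn e x)) (inn e (x + (0:ℝ) • e)) := by simpa using Td' (inn e x)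
    exact (h2.comp (0:ℝ) h1).congr_deriv (by rw [mul_one])
  have I3 : ∫ x, S (inn e x) * b x = ∫ t, S t * τ t := by
    rw [int_sl he (f := fun x => S (inn e x) * b x) (((Sc.comp ic).mul bcx).integrable_of_hasCompactSupport bs.mul_left)]
    congr 1; ext t
    simp_rw [sl_inner he]
    rw [integral_const_mul]
  have ir := int_norm_fderiv hw hc
  have ca : Continuous fun x => fdv w x e := cf.clm_apply continuous_const
  have sa : HasCompactSupport fun x => fdv w x e := csupp_comp hc fun x hx => by simp [hx]
  have iT : Integrable fun x => T (inn e x) * fdv w x e := ((Tcont.comp ic).mul ca).integrable_of_hasCompactSupport sa.mul_left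
  have iS : Integrable fun x => S (inn e x) * b x := ((Sc.comp ic).mul bcx).integrable_of_hasCompactSupport bs.mul_left
  set d : X → ℝ := fun x => ‖fdv w x‖ + T (inn e x) * fdv w x e - S (inn e x) * b x with hd
  have idd : Integrable d := (ir.add iT).sub iS
  have dd : ∀ x, 0 ≤ d x ∧ (fdv w x e + T (inn e x) * ‖fdv w x‖) ^ 2 ≤ 2 * ‖fdv w x‖ * d x := fun x =>
    dir_ineq (norm_nonneg _) (clm_split he _) (TS _)
  have ID : ∫ x, d x = (∫ x, ‖fdv w x‖) - (∫ t, α t * q t) - ∫ t, S t * τ t := by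
    have a1 : ∫ x, d x = (∫ x, (‖fdv w x‖ + T (inn e x) * fdv w x e)) - ∫ x, S (inn e x) * b x := integral_sub (ir.add iT) iS
    have a2 : ∫ x, (‖fdv w x‖ + T (inn e x) * fdv w x e) = (∫ x, ‖fdv w x‖) + ∫ x, T (inn e x) * fdv w x e := integral_add ir iT
    rw [a1, a2, I2, I3]; ring
  have D0 : 0 ≤ ∫ x, d x := integral_nonneg fun x => (dd x).1
  have hκ2 : (n + 2) / ε ^ 2 * (∫ t, κ t) ≤ (n + 2) * ε := by
    calc _ ≤ (n + 2) / ε ^ 2 * ε ^ 3 := by gcongr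
      _ = _ := by field_simp
  have main : (∫ x, d x) + 1 / (2 * n) * G ≤ C2 * ε := by
    have a1 : 2 * ε * (n + 1) * V ≤ 2 * ε * (n + 1) * (2 * ω) := by gcongr
    have a2 : 3 * C1 * ε * V ≤ 3 * C1 * ε * (2 * ω) := by gcongr
    have a3 : (n+1) * ω - (n+1) * V ≤ (n+1) * ε := by
      have : (n+1:ℝ) * (ω - V) ≤ (n+1) * ε := by gcongr; linarith
      linarith
    rw [hC2, ID]
    linarith
  have hGn : G ≤ 2 * n * C2 * ε := by
    have : 1 / (2 * n) * G ≤ C2 * ε := by linarith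
    calc G = 2 * n * (1 / (2 * n) * G) := by field_simp
      _ ≤ 2 * n * (C2 * ε) := by gcongr
      _ = _ := by ring
  have hDn : ∫ x, d x ≤ C2 * ε := by
    have : 0 ≤ 1 / (2 * n) * G := by positivity
    linarith
  have σ0 : 0 < √ε := Real.sqrt_pos.2 hε
  have σ2 : √ε * √ε = ε := Real.mul_self_sqrt hε.le
  have σ1 : √ε ≤ 1 := by rw [Real.sqrt_le_one]; linarith
  have εσ : ε ≤ √ε := by conv_lhs => rw [← σ2]
                         exact mul_le_of_le_one_left σ0.le σ1
  set σ := √ε with hσ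
  refine ⟨T, q, c, Tc, fun t => abs_le.2 ⟨by linarith [(Tm t).1], by linarith [(Tm t).2]⟩, Td', qc, fun t => mul_nonneg θ0 (P0 t), ?_, ?_⟩
  · have pt : ∀ x, |fdv w x e + T (inn e x) * ‖fdv w x‖| ≤ σ / 2 * ‖fdv w x‖ + d x / σ := by
      intro x
      obtain ⟨h1, h2⟩ := dd x
      have r0 := norm_nonneg (fdv w x)
      refine abs_le_of_sq_le_sq (h2.trans ?_) (by positivity)
      have : (σ / 2 * ‖fdv w x‖ + d x / σ) ^ 2 - 2 * ‖fdv w x‖ * d x = (σ / 2 * ‖fdv w x‖ - d x / σ) ^ 2 := by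
        field_simp; ring
      have := sq_nonneg (σ / 2 * ‖fdv w x‖ - d x / σ); linarith
    calc _ ≤ ∫ x, (σ / 2 * ‖fdv w x‖ + d x / σ) := by
          refine integral_mono_of_nonneg (ae_of_all _ fun x => abs_nonneg _) ((ir.const_mul _).add (idd.div_const _)) (ae_of_all _ pt)
      _ = σ / 2 * (∫ x, ‖fdv w x‖) + (∫ x, d x) / σ := by
          rw [integral_add (ir.const_mul _) (idd.div_const _), integral_const_mul, integral_div]
      _ ≤ σ / 2 * TV + C2 * σ := by
          have : (∫ x, d x) / σ ≤ C2 * σ := by rw [div_le_iff₀ σ0, mul_assoc, σ2]; exact hDn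
          have : ∫ x, ‖fdv w x‖ ≤ TV := by linarith
          gcongr
      _ ≤ _ := by
          have : 0 ≤ (2*n*C2 + 4 * ω + C1 * (6 * ω + 4 * n * C2)) * σ := by positivity
          have : 0 ≤ TV * σ := by positivity
          linarith
  · have e1 : ∫ x, w x * |q (inn e x) - 1| = ∫ t, α t * |q t - 1| := by
      rw [← iprod (fun t => |q t - 1|) (by fun_prop)]
      congr 1; ext x; ring
    have pt : ∀ t, α t * |q t - 1| ≤ (1 / σ + 2 * C1 * ε) * (α t * g t) + (2 * σ + 3 * C1 * ε) * α t := by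
      intro t
      have p0 := P0 t
      have h1 : |P t - 1| ≤ g t / σ + 2 * σ := by
        have hx : |P t - 1| ^ 2 = g t * (1 + P t) := by simp only [hg]; rw [sq_abs]; field_simp
        set x := |P t - 1| with hxd
        have hx0 : 0 ≤ x := abs_nonneg _
        have hP2 : P t ≤ 1 + x := by linarith [le_abs_self (P t - 1)]
        have h3 : x ≤ g t / (2 * σ) + σ * (1 + P t) / 2 := by
          refine le_of_sq_le_sq ?_ (by have := g0 t; positivity)
          rw [hx]
          have : (g t / (2 * σ) + σ * (1 + P t) / 2) ^ 2 - g t * (1 + P t) = (g t / (2 * σ) - σ * (1 + P t) / 2) ^ 2 := by field_simp; ring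
          have := sq_nonneg (g t / (2 * σ) - σ * (1 + P t) / 2); linarith
        have h4 : σ * (1 + P t) / 2 ≤ σ + x / 2 := nm6 σ0 σ1 hx0 hP2
        have h5 : g t / (2 * σ) = g t / σ / 2 := by field_simp
        linarith
      have h2 : |q t - 1| ≤ |P t - 1| + C1 * ε * (3 + 2 * g t) := by
        have : q t - 1 = (P t - 1) + (θ - 1) * P t := by simp only [hq]; ring
        rw [this]
        refine (abs_add_le _ _).trans ?_
        rw [abs_mul, abs_of_nonneg p0]
        have := gP t
        gcongr
      have h3 := mul_le_mul_of_nonneg_left (h2.trans (add_le_add_left h1 _)) (α0 t)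
      refine h3.trans (le_of_eq ?_)
      field_simp; ring
    rw [e1]
    calc _ ≤ ∫ t, ((1 / σ + 2 * C1 * ε) * (α t * g t) + (2 * σ + 3 * C1 * ε) * α t) :=
          integral_mono_of_nonneg (ae_of_all _ fun t => mul_nonneg (α0 t) (abs_nonneg _)) ((iag.const_mul _).add (iα.const_mul _)) (ae_of_all _ pt)
      _ = (1 / σ + 2 * C1 * ε) * G + (2 * σ + 3 * C1 * ε) * V := by
          rw [integral_add (iag.const_mul _) (iα.const_mul _), integral_const_mul, integral_const_mul, αV]
      _ ≤ (1 / σ + 2 * C1 * σ) * (2 * n * C2 * (σ * σ)) + (2 * σ + 3 * C1 * σ) * (2 * ω) := by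
          have Vn : 0 ≤ V := by linarith
          rw [σ2]; gcongr
      _ = (2 * n * C2 + 4 * ω + 6 * C1 * ω) * σ + C1 * 4 * n * C2 * σ * (σ * σ) := by field_simp; ring
      _ ≤ (2 * n * C2 + 4 * ω + 6 * C1 * ω) * σ + C1 * 4 * n * C2 * σ * 1 := by
          gcongr; exact mul_le_one₀ σ1 σ0.le σ1
      _ ≤ _ := by
          have : 0 ≤ (TV + C2) * σ := by positivity
          linarith

theorem tan_le_two {x : ℝ} (h0 : 0 ≤ x) (h : x < 1/2) : Real.tan x ≤ 2 * x := by
  have h1 := Real.one_sub_sq_div_two_le_cos (x := x)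
  have h2 := Real.sin_le h0
  have hc : 1/2 ≤ Real.cos x := by nlinarith
  rw [Real.tan_eq_sin_div_cos, div_le_iff₀ (by linarith)]
  nlinarith

theorem oneD {T q : ℝ → ℝ} {c : ℝ} (Tc : T c = 0) (Td : ∀ τ, HasDerivAt T (q τ) τ) (qc : Continuous q) (q0 : ∀ τ, 0 ≤ q τ) :
    ∃ X X' : ℝ → ℝ, (∀ τ, HasDerivAt X (X' τ) τ) ∧ Continuous X' ∧ (∀ τ, 0 ≤ X' τ ∧ X' τ ≤ |q τ - 1|) ∧
      (∀ τ, |X τ| ≤ 2) ∧ (∀ τ, 0 ≤ T τ * X τ) ∧ (∀ τ, 0 ≤ T τ * (τ - c)) ∧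
      (∀ τ, |X τ| < 1/2 → |T τ - (τ - c)| ≤ 2 * |X τ|) := by
  have ac : Continuous fun τ => |q τ - 1| := by fun_prop
  set Θ : ℝ → ℝ := fun τ => ∫ s in c..τ, |q s - 1| with hΘ
  have Θd : ∀ τ, HasDerivAt Θ (|q τ - 1|) τ := fun τ => intervalIntegral.integral_hasDerivAt_right (ac.intervalIntegrable _ _)
    (ac.stronglyMeasurableAtFilter _ _) ac.continuousAt
  have Θc : Θ c = 0 := intervalIntegral.integral_same
  have Θm : Monotone Θ := monotone_of_hasDerivAt_nonneg Θd fun τ => abs_nonneg _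
  have Tm : Monotone T := monotone_of_hasDerivAt_nonneg Td q0
  have Θcont : Continuous Θ := continuous_iff_continuousAt.2 fun x => (Θd x).continuousAt
  have sg : ∀ τ, (0 ≤ τ - c ∧ 0 ≤ T τ ∧ 0 ≤ Θ τ) ∨ (τ - c ≤ 0 ∧ T τ ≤ 0 ∧ Θ τ ≤ 0) := by
    intro τ
    rcases le_total c τ with h | h
    · left; exact ⟨by linarith, Tc ▸ Tm h, Θc ▸ Θm h⟩
    · right; exact ⟨by linarith, Tc ▸ Tm h, Θc ▸ Θm h⟩
  have cmp : ∀ τ, |T τ - (τ - c)| ≤ |Θ τ| := by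
    have m1 : Monotone fun τ => Θ τ - (T τ - (τ - c)) := by
      refine monotone_of_hasDerivAt_nonneg (f' := fun τ => |q τ - 1| - (q τ - 1)) (fun τ => ?_) (fun τ => sub_nonneg.2 (le_abs_self _))
      exact (Θd τ).sub ((Td τ).sub ((hasDerivAt_id τ).sub_const c))
    have m2 : Monotone fun τ => Θ τ + (T τ - (τ - c)) := by
      refine monotone_of_hasDerivAt_nonneg (f' := fun τ => |q τ - 1| + (q τ - 1)) (fun τ => ?_) (fun τ => by have := neg_abs_le (q τ - 1); show 0 ≤ |q τ - 1| + (q τ - 1); linarith)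
      exact (Θd τ).add ((Td τ).sub ((hasDerivAt_id τ).sub_const c))
    intro τ
    rcases le_total c τ with h | h
    · have a := m1 h; have b := m2 h
      simp only [Θc, Tc, sub_self] at a b
      have hp : 0 ≤ Θ τ := Θc ▸ Θm h
      rw [abs_of_nonneg hp, abs_le]; constructor <;> linarith
    · have a := m1 h; have b := m2 h
      simp only [Θc, Tc, sub_self] at a b
      have hp : Θ τ ≤ 0 := Θc ▸ Θm h
      rw [abs_of_nonpos hp, abs_le]; constructor <;> linarith
  refine ⟨fun τ => Real.arctan (Θ τ), fun τ => 1 / (1 + Θ τ ^ 2) * |q τ - 1|, fun τ => (Θd τ).arctan, ?_, fun τ => ⟨by positivity, ?_⟩, fun τ => ?_, fun τ => ?_, fun τ => ?_, fun τ h => ?_⟩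
  · exact (continuous_const.div (by fun_prop) fun τ => by positivity).mul ac
  · have : 1 / (1 + Θ τ ^ 2) ≤ 1 := by rw [div_le_one (by positivity)]; nlinarith [sq_nonneg (Θ τ)]
    exact mul_le_of_le_one_left (abs_nonneg _) this
  · have h1 := Real.arctan_lt_pi_div_two (Θ τ); have h2 := Real.neg_pi_div_two_lt_arctan (Θ τ)
    rw [abs_le]; constructor <;> linarith [Real.pi_le_four]
  · rcases sg τ with ⟨_, h2, h3⟩ | ⟨_, h2, h3⟩
    · exact mul_nonneg h2 (Real.arctan_nonneg.2 h3)
    · exact mul_nonneg_of_nonpos_of_nonpos h2 (Real.arctan_le_zero.2 h3)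
  · rcases sg τ with ⟨h1, h2, _⟩ | ⟨h1, h2, _⟩
    · exact mul_nonneg h2 h1
    · exact mul_nonneg_of_nonpos_of_nonpos h2 h1
  · refine (cmp τ).trans ?_
    have e : |Θ τ| = Real.tan |Real.arctan (Θ τ)| := by
      rcases sg τ with ⟨_, _, h3⟩ | ⟨_, _, h3⟩
      · rw [abs_of_nonneg h3, abs_of_nonneg (Real.arctan_nonneg.2 h3), Real.tan_arctan]
      · rw [abs_of_nonpos h3, abs_of_nonpos (Real.arctan_le_zero.2 h3), Real.tan_neg, Real.tan_arctan]
    rw [e]; exact tan_le_two (abs_nonneg _) h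

theorem rho_fun {ε : ℝ} (hε : 0 < ε) : ∃ ρ ρ' : ℝ → ℝ, (∀ u, HasDerivAt ρ (ρ' u) u) ∧ Continuous ρ' ∧ (∀ u, 0 ≤ ρ u ∧ ρ u ≤ 1) ∧
    (∀ u, 0 ≤ ρ' u) ∧ (∀ u, 0 ≤ u → u * ρ' u ≤ 1) ∧ (∀ u, ρ u ≤ max (u - 1) 0 + √ε) ∧ (∀ u, 1 ≤ u → 1/8 ≤ ρ u + u * ρ' u) := by
  set s : ℝ → ℝ := fun u => √(ε + (u - 1) ^ 2) with hs
  have s2 : ∀ u, s u ^ 2 = ε + (u - 1) ^ 2 := fun u => Real.sq_sqrt (by positivity)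
  have sp : ∀ u, 0 < s u := fun u => Real.sqrt_pos.2 (by positivity)
  have sa : ∀ u, |u - 1| ≤ s u := fun u => abs_le_of_sq_le_sq (by rw [s2]; linarith) (sp u).le
  have sle : ∀ u, s u ≤ |u - 1| + √ε := fun u => by
    refine le_of_sq_le_sq ?_ (by positivity)
    rw [s2, add_sq, sq_abs, Real.sq_sqrt hε.le]
    have : 0 ≤ 2 * |u - 1| * √ε := by positivity
    linarith
  have sd : ∀ u, HasDerivAt s ((u - 1) / s u) u := by
    intro u
    have h1 : HasDerivAt (fun u : ℝ => ε + (u - 1) ^ 2) (2 * (u - 1)) u := by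
      have := (((hasDerivAt_id u).sub_const 1).pow 2).const_add ε
      exact this.congr_deriv (by simp)
    exact (h1.sqrt (by positivity)).congr_deriv (by simp only [hs]; field_simp)
  set p : ℝ → ℝ := fun u => (s u + (u - 1)) / 2 with hp
  have p0 : ∀ u, 0 ≤ p u := fun u => by have := sa u; have := neg_abs_le (u-1); simp only [hp]; linarith
  have p1 : ∀ u, u - 1 ≤ p u := fun u => by have := sa u; have := le_abs_self (u-1); simp only [hp]; linarith
  have pd : ∀ u, HasDerivAt p (((u - 1) / s u + 1) / 2) u := fun u => ((sd u).add ((hasDerivAt_id u).sub_const 1)).div_const 2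
  have sc : Continuous s := by fun_prop
  have r0 : ∀ u, 0 ≤ ((u - 1) / s u + 1) / 2 ∧ ((u - 1) / s u + 1) / 2 ≤ 1 := fun u => by
    have h1 : |(u - 1) / s u| ≤ 1 := by rw [abs_div, abs_of_pos (sp u), div_le_one (sp u)]; exact sa u
    have := abs_le.1 h1
    constructor <;> linarith
  have hq : ∀ u, 0 < 1 + p u := fun u => by have := p0 u; linarith
  refine ⟨fun u => p u / (1 + p u), fun u => ((u - 1) / s u + 1) / 2 / (1 + p u) ^ 2, fun u => ?_, ?_, fun u => ⟨div_nonneg (p0 u) (hq u).le, ?_⟩, fun u => ?_, fun u hu => ?_, fun u => ?_, fun u hu => ?_⟩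
  · exact ((pd u).div ((pd u).const_add 1) (hq u).ne').congr_deriv (by ring)
  · have : Continuous p := by fun_prop
    exact ((((continuous_id.sub continuous_const).div sc fun u => (sp u).ne').add continuous_const).div_const 2).div (by fun_prop) fun u => pow_ne_zero 2 (hq u).ne'
  · rw [div_le_one (hq u)]; linarith
  · have := (r0 u).1; positivity
  · have h1 := (r0 u).2
    rw [mul_div_assoc', div_le_one (by have := hq u; positivity)]
    have h2 : u ≤ 1 + p u := by linarith [p1 u]
    have h3 : 1 ≤ 1 + p u := by linarith [p0 u]
    calc _ ≤ u * 1 := by gcongr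
      _ ≤ (1 + p u) ^ 2 := by nlinarith
  · have h1 : p u / (1 + p u) ≤ p u := div_le_self (p0 u) (by linarith [p0 u])
    have h2 := sle u
    have h3 : |u - 1| + (u - 1) ≤ 2 * max (u - 1) 0 := by
      rcases le_total 0 (u - 1) with h | h
      · rw [abs_of_nonneg h, max_eq_left h]; linarith
      · rw [abs_of_nonpos h, max_eq_right h]; linarith
    have : 0 ≤ √ε := Real.sqrt_nonneg _
    have : p u = (s u + (u - 1)) / 2 := rfl
    show p u / (1 + p u) ≤ _
    linarith
  · have h1 : 1/2 ≤ ((u - 1) / s u + 1) / 2 := by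
      have : 0 ≤ (u - 1) / s u := div_nonneg (by linarith) (sp u).le
      linarith
    have h2 := p0 u
    rcases le_total (p u) 1 with h | h
    · have : 1/8 ≤ ((u - 1) / s u + 1) / 2 / (1 + p u) ^ 2 := by
        rw [le_div_iff₀ (by positivity)]; nlinarith
      have : 0 ≤ p u / (1 + p u) := by positivity
      show _ ≤ p u / (1 + p u) + u * (((u - 1) / s u + 1) / 2 / (1 + p u) ^ 2)
      nlinarith
    · have h3 : 1/2 ≤ p u / (1 + p u) := by rw [le_div_iff₀ (hq u)]; linarith
      have : 0 ≤ u * (((u - 1) / s u + 1) / 2 / (1 + p u) ^ 2) := by have := (r0 u).1; positivity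
      show _ ≤ p u / (1 + p u) + u * (((u - 1) / s u + 1) / 2 / (1 + p u) ^ 2)
      linarith

noncomputable def IW (v g : X → ℝ) : ℝ := ∫ x, g x * v x

structure WV (v : X → ℝ) : Prop where
  c : Continuous v
  s : HasCompactSupport v
  p : ∀ x, 0 ≤ v x

theorem WV.int {v g : X → ℝ} (h : WV v) (hg : Continuous g) : Integrable fun x => g x * v x :=
  (hg.mul h.c).integrable_of_hasCompactSupport h.s.mul_left

theorem WV.mono {v f g : X → ℝ} (h : WV v) (hf : Continuous f) (hg : Continuous g) (hfg : ∀ x, f x ≤ g x) : IW v f ≤ IW v g :=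
  integral_mono (h.int hf) (h.int hg) fun x => mul_le_mul_of_nonneg_right (hfg x) (h.p x)

theorem WV.add {v f g : X → ℝ} (h : WV v) (hf : Continuous f) (hg : Continuous g) : IW v (fun x => f x + g x) = IW v f + IW v g := by
  unfold IW; simp only [add_mul]; exact integral_add (h.int hf) (h.int hg)

theorem WV.mul {v f : X → ℝ} (a : ℝ) : IW v (fun x => a * f x) = a * IW v f := by
  unfold IW; simp only [mul_assoc]; exact integral_const_mul _ _

theorem WV.sum {ι : Type*} [Fintype ι] {v : X → ℝ} {f : ι → X → ℝ} (h : WV v) (hf : ∀ i, Continuous (f i)) : IW v (fun x => ∑ i, f i x) = ∑ i, IW v (f i) := by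
  unfold IW; simp only [Finset.sum_mul]; exact integral_finsetSum _ fun i _ => h.int (hf i)

theorem dd {T : ℝ → ℝ} {q' : ℝ} {e x : X} (e' : X) (h : HasDerivAt T q' (inn e x)) :
    HasDerivAt (fun s : ℝ => T (inn e (x + s • e'))) (q' * inn e e') 0 := by
  have h1 : HasDerivAt (fun s : ℝ => inn e (x + s • e')) (inn e e') 0 := by
    simp only [inner_add_right, inner_smul_right]
    exact (((hasDerivAt_id (0:ℝ)).mul_const _).const_add _).congr_deriv (by simp)
  refine HasDerivAt.comp (h₂ := T) (0:ℝ) ?_ h1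
  simpa using h

theorem star {w f f' : X → ℝ} {e : X} {T : ℝ → ℝ} {M D : ℝ} (hw : ContDiff ℝ 1 w) (hc : HasCompactSupport w) (hT : Continuous T) (hf : ContDiff ℝ 1 f)
    (h : ∀ x, HasDerivAt (fun s : ℝ => f (x + s • e)) (f' x) 0) (hM : ∀ x, |f x| ≤ M)
    (hD : ∫ x, |fdv w x e + T (inn e x) * ‖fdv w x‖| ≤ D) :
    |IW w f' - IW (fun x => ‖fdv w x‖) (fun x => f x * T (inn e x))| ≤ M * D := by
  have cD := hw.continuous_fderiv one_ne_zero
  have c1 : Continuous fun x => fdv w x e := cD.clm_apply continuous_const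
  have cT : Continuous fun x : X => T (inn e x) := hT.comp (by fun_prop)
  have i1 : Integrable fun x => f x * fdv w x e := (hf.continuous.mul c1).integrable_of_hasCompactSupport (csupp_comp hc fun x hx => by simp [hx])
  have i2 : Integrable fun x => f x * T (inn e x) * ‖fdv w x‖ := ((hf.continuous.mul cT).mul cD.norm).integrable_of_hasCompactSupport (csupp_comp hc fun x hx => by simp [hx])
  have i3 : Integrable fun x => |fdv w x e + T (inn e x) * ‖fdv w x‖| := ((c1.add (cT.mul cD.norm)).abs).integrable_of_hasCompactSupport (csupp_comp hc fun x hx => by simp [hx])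
  have a := ibp hw hc hf h
  have b : ∫ x, (f x * fdv w x e + f x * T (inn e x) * ‖fdv w x‖) = _ := integral_add i1 i2
  have : IW w f' - IW (fun x => ‖fdv w x‖) (fun x => f x * T (inn e x)) = - ∫ x, (f x * fdv w x e + f x * T (inn e x) * ‖fdv w x‖) := by
    rw [b, a]; unfold IW; ring
  rw [this, abs_neg]
  have M0 : 0 ≤ M := (abs_nonneg _).trans (hM 0)
  calc _ ≤ ∫ x, |f x * fdv w x e + f x * T (inn e x) * ‖fdv w x‖| := abs_integral_le_integral_abs
    _ ≤ ∫ x, M * |fdv w x e + T (inn e x) * ‖fdv w x‖| := by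
        refine integral_mono (i1.add i2).abs (i3.const_mul M) fun x => ?_
        show |_| ≤ _
        rw [show f x * fdv w x e + f x * T (inn e x) * ‖fdv w x‖ = f x * (fdv w x e + T (inn e x) * ‖fdv w x‖) by ring, abs_mul]
        exact mul_le_mul_of_nonneg_right (hM x) (abs_nonneg _)
    _ ≤ _ := by rw [integral_const_mul]; exact mul_le_mul_of_nonneg_left hD M0

theorem step0 {ι : Type*} [Fintype ι] (b : OrthonormalBasis ι ℝ X) {w : X → ℝ} {T : ι → ℝ → ℝ} {D : ℝ} (hw : ContDiff ℝ 1 w) (hc : HasCompactSupport w)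
    (hT : ∀ i, Continuous (T i)) (hT1 : ∀ i τ, |T i τ| ≤ 1)
    (hD : ∀ i, ∫ x, |fdv w x (b i) + T i (inn (b i) x) * ‖fdv w x‖| ≤ D) :
    IW (fun x => ‖fdv w x‖) (fun x => |∑ i, T i (inn (b i) x) ^ 2 - 1|) ≤ 2 * (Fintype.card ι * D) := by
  have cD := hw.continuous_fderiv one_ne_zero
  have c1 : ∀ i, Continuous fun x => fdv w x (b i) := fun i => cD.clm_apply continuous_const
  have cT : ∀ i, Continuous fun x : X => T i (inn (b i) x) := fun i => (hT i).comp (by fun_prop)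
  have i3 : ∀ i, Integrable fun x => |fdv w x (b i) + T i (inn (b i) x) * ‖fdv w x‖| := fun i => (((c1 i).add ((cT i).mul cD.norm)).abs).integrable_of_hasCompactSupport (csupp_comp hc fun x hx => by simp [hx])
  have i2 : Integrable fun x => |∑ i, T i (inn (b i) x) ^ 2 - 1| * ‖fdv w x‖ := (Continuous.mul (Continuous.abs ((continuous_finsetSum _ fun i _ => (cT i).pow 2).sub continuous_const)) cD.norm).integrable_of_hasCompactSupport (csupp_comp hc fun x hx => by simp [hx])
  have pt : ∀ x, |∑ i, T i (inn (b i) x) ^ 2 - 1| * ‖fdv w x‖ ≤ 2 * ∑ i, |fdv w x (b i) + T i (inn (b i) x) * ‖fdv w x‖| := by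
    intro x
    set L := fdv w x
    set m := ‖L‖ with hm
    have h2 : ∑ i, (L (b i)) ^ 2 = m ^ 2 := by
      obtain ⟨v, hv⟩ : ∃ v, (InnerProductSpace.toDual ℝ X) v = L := ⟨(InnerProductSpace.toDual ℝ X).symm L, by simp⟩
      have h3 : m = ‖v‖ := by rw [hm, ← hv, LinearIsometryEquiv.norm_map]
      rw [h3, ← real_inner_self_eq_norm_sq, ← b.sum_inner_mul_inner v v]
      refine Finset.sum_congr rfl fun i _ => ?_
      rw [← hv, InnerProductSpace.toDual_apply_apply, real_inner_comm v (b i), sq]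
    rcases eq_or_lt_of_le (norm_nonneg L) with h0 | h0
    · rw [hm, ← h0, mul_zero]; positivity
    · rw [← hm] at h0
      refine le_of_mul_le_mul_right ?_ h0
      calc _ = |∑ i, ((T i (inn (b i) x) * m - L (b i)) * (L (b i) + T i (inn (b i) x) * m))| := by
            rw [mul_assoc, ← abs_of_pos (mul_pos h0 h0), ← abs_mul]; congr 1
            rw [Finset.sum_congr rfl fun i _ => show (T i (inn (b i) x) * m - L (b i)) * (L (b i) + T i (inn (b i) x) * m) = T i (inn (b i) x) ^ 2 * m ^ 2 - L (b i) ^ 2 by ring, Finset.sum_sub_distrib, h2, ← Finset.sum_mul]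
            ring
        _ ≤ ∑ i, |(T i (inn (b i) x) * m - L (b i)) * (L (b i) + T i (inn (b i) x) * m)| := Finset.abs_sum_le_sum_abs _ _
        _ ≤ ∑ i, (2 * m) * |L (b i) + T i (inn (b i) x) * m| := by
            refine Finset.sum_le_sum fun i _ => ?_
            rw [abs_mul]
            refine mul_le_mul_of_nonneg_right ?_ (abs_nonneg _)
            have h4 : |L (b i)| ≤ m := by have := L.le_opNorm (b i); rwa [b.norm_eq_one, mul_one] at this
            have h5 : |T i (inn (b i) x) * m| ≤ m := by rw [abs_mul, abs_of_pos h0]; exact mul_le_of_le_one_left h0.le (hT1 i _)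
            have := abs_sub (T i (inn (b i) x) * m) (L (b i))
            linarith
        _ = _ := by rw [← Finset.mul_sum]; ring
  calc _ ≤ ∫ x, 2 * ∑ i, |fdv w x (b i) + T i (inn (b i) x) * ‖fdv w x‖| :=
        integral_mono i2 ((integrable_finsetSum _ fun i _ => i3 i).const_mul 2) pt
    _ = 2 * ∑ i, ∫ x, |fdv w x (b i) + T i (inn (b i) x) * ‖fdv w x‖| := by
        rw [integral_const_mul, integral_finsetSum _ fun i _ => i3 i]
    _ ≤ 2 * ∑ i : ι, D := by gcongr with i; exact hD i
    _ = _ := by simp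
section

theorem yfun {ε : ℝ} (hε : 0 < ε) (hε1 : ε ≤ 1) {Z Z' : ℝ → ℝ} (hZ : ∀ τ, HasDerivAt Z (Z' τ) τ) (hZ' : Continuous Z') (Z2 : ∀ τ, |Z τ| ≤ 2) :
    ∃ Y Y' : ℝ → ℝ, (∀ τ, HasDerivAt Y (Y' τ) τ) ∧ Continuous Y' ∧ (∀ τ, |Z τ| ≤ Y τ ∧ Y τ ≤ |Z τ| + √ε ∧ Y τ ≤ 3 ∧ 0 ≤ Y τ) ∧
      (∀ τ a, 0 ≤ a * Z τ → 0 ≤ Z' τ → 0 ≤ a * Y' τ) := by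
  set Y : ℝ → ℝ := fun τ => √(ε + Z τ ^ 2) with hY
  have y2 : ∀ u, Y u ^ 2 = ε + Z u ^ 2 := fun u => Real.sq_sqrt (by positivity)
  have yp : ∀ u, 0 < Y u := fun u => Real.sqrt_pos.2 (by positivity)
  have yle : ∀ u, Y u ≤ |Z u| + √ε := fun u => by
    refine le_of_sq_le_sq ?_ (by positivity)
    rw [y2, add_sq, sq_abs, Real.sq_sqrt hε.le]
    have : 0 ≤ 2 * |Z u| * √ε := by positivity
    linarith
  have zc : Continuous Z := continuous_iff_continuousAt.2 fun x => (hZ x).continuousAt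
  refine ⟨Y, fun τ => Z τ * Z' τ / Y τ, fun τ => ?_, ?_, fun τ => ⟨abs_le_of_sq_le_sq (by rw [y2]; linarith) (yp τ).le, yle τ, ?_, (yp τ).le⟩, fun τ a h1 h2 => ?_⟩
  · have h1 : HasDerivAt (fun u : ℝ => ε + Z u ^ 2) (2 * Z τ * Z' τ) τ := (((hZ τ).pow 2).const_add ε).congr_deriv (by simp)
    exact (h1.sqrt (by positivity)).congr_deriv (by simp only [hY]; field_simp)
  · exact (zc.mul hZ').div (by fun_prop) fun u => (yp u).ne'
  · have := yle τ; have := Z2 τ; have : √ε ≤ 1 := Real.sqrt_le_one.2 hε1; linarith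
  · rw [show a * (Z τ * Z' τ / Y τ) = (a * Z τ) * Z' τ / Y τ by ring]
    exact div_nonneg (mul_nonneg h1 h2) (yp τ).le
/-- one-coordinate data -/

structure DT (w : X → ℝ) (e : X) (D : ℝ) (T q Z Z' Y Y' : ℝ → ℝ) (σ : ℝ) : Prop where
  T1 : ∀ τ, |T τ| ≤ 1
  Td : ∀ τ, HasDerivAt T (q τ) τ
  qc : Continuous q
  q0 : ∀ τ, 0 ≤ q τ
  i1 : ∫ x, |fdv w x e + T (inn e x) * ‖fdv w x‖| ≤ D
  i2 : IW w (fun x => |q (inn e x) - 1|) ≤ D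
  Zd : ∀ τ, HasDerivAt Z (Z' τ) τ
  Zc : Continuous Z'
  Z0 : ∀ τ, 0 ≤ Z' τ ∧ Z' τ ≤ |q τ - 1|
  Z2 : ∀ τ, |Z τ| ≤ 2
  TZ : ∀ τ, 0 ≤ T τ * Z τ
  Yd : ∀ τ, HasDerivAt Y (Y' τ) τ
  Yc : Continuous Y'
  Yb : ∀ τ, |Z τ| ≤ Y τ ∧ Y τ ≤ |Z τ| + σ ∧ Y τ ≤ 3 ∧ 0 ≤ Y τ
  TY : ∀ τ, 0 ≤ T τ * Y' τ
variable {w : X → ℝ} {e e' : X} {D σ : ℝ} {T q Z Z' Y Y' T₂ q₂ Z₂ Z₂' Y₂ Y₂' : ℝ → ℝ}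

theorem cont_in {f : ℝ → ℝ} (hf : Continuous f) (e : X) : Continuous fun x : X => f (inn e x) := hf.comp (by fun_prop)

theorem cd_in {f f' : ℝ → ℝ} (hd : ∀ τ, HasDerivAt f (f' τ) τ) (hf : Continuous f') (e : X) : ContDiff ℝ 1 fun x : X => f (inn e x) :=
  (cd1 hd hf).comp (contDiff_const.inner ℝ contDiff_id)

theorem cont_d {f f' : ℝ → ℝ} (hd : ∀ τ, HasDerivAt f (f' τ) τ) : Continuous f := continuous_iff_continuousAt.2 fun x => (hd x).continuousAt

theorem stepA (d : DT w e D T q Z Z' Y Y' σ) (hw : ContDiff ℝ 1 w) (hc : HasCompactSupport w) (W : WV w) (M : WV fun x => ‖fdv w x‖) (he : ‖e‖ = 1) :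
    IW (fun x => ‖fdv w x‖) (fun x => Z (inn e x) * T (inn e x)) ≤ 3 * D := by
  have h := star (f := fun x => Z (inn e x)) (f' := fun x => Z' (inn e x)) (e := e) (M := 2) hw hc (cont_d d.Td) (cd_in d.Zd d.Zc e)
    (fun x => (dd e (d.Zd _)).congr_deriv (by rw [real_inner_self_eq_norm_sq, he]; ring)) (fun x => d.Z2 _) d.i1
  have h2 := W.mono (f := fun x => Z' (inn e x)) (g := fun x => |q (inn e x) - 1|) (cont_in d.Zc e) (cont_in (d.qc.sub continuous_const).abs e) fun x => (d.Z0 (inn e x)).2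
  have := (abs_le.1 h).1
  have := d.i2
  linarith

theorem stepA' (d : DT w e D T q Z Z' Y Y' σ) (hw : ContDiff ℝ 1 w) (hc : HasCompactSupport w) (W : WV w) (M : WV fun x => ‖fdv w x‖) (he : ‖e‖ = 1) (hσ : 0 ≤ σ) :
    IW (fun x => ‖fdv w x‖) (fun x => T (inn e x) * Y (inn e x) * T (inn e x)) ≤ 3 * D + σ * IW (fun x => ‖fdv w x‖) (fun x => 1) := by
  have cT := (cont_d d.Td)
  have cZ := (cont_d d.Zd)
  have cY := (cont_d d.Yd)
  refine le_trans (M.mono (g := fun x => Z (inn e x) * T (inn e x) + σ * 1) (by fun_prop) (by fun_prop) fun x => ?_) ?_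
  · set τ := inn e x
    obtain ⟨h1, h2, h3, h4⟩ := d.Yb τ
    have h5 := d.T1 τ
    have h6 : Z τ * T τ = |T τ| * |Z τ| := by rw [← abs_mul, abs_of_nonneg (d.TZ τ), mul_comm]
    rw [h6]
    calc T τ * Y τ * T τ = |T τ| * |T τ| * Y τ := by rw [abs_mul_abs_self]; ring
      _ ≤ |T τ| * 1 * (|Z τ| + σ) := by gcongr
      _ = |T τ| * |Z τ| + |T τ| * σ := by ring
      _ ≤ |T τ| * |Z τ| + 1 * σ := by gcongr
      _ = _ := by ring
  · rw [M.add (f := fun x => Z (inn e x) * T (inn e x)) (g := fun x => σ * 1) (by fun_prop) (by fun_prop), WV.mul (f := fun x => 1)]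
    have := stepA d hw hc W M he
    linarith

theorem stepB (d : DT w e D T q Z Z' Y Y' σ) (hw : ContDiff ℝ 1 w) (hc : HasCompactSupport w) (W : WV w) (M : WV fun x => ‖fdv w x‖) (he : ‖e‖ = 1) (hσ : 0 ≤ σ) :
    IW w (fun x => Y (inn e x)) ≤ 9 * D + σ * IW (fun x => ‖fdv w x‖) (fun x => 1) := by
  have cT := (cont_d d.Td)
  have cY := (cont_d d.Yd)
  have cY' := d.Yc
  have cq := d.qc
  have h := star (f := fun x => T (inn e x) * Y (inn e x)) (f' := fun x => q (inn e x) * Y (inn e x) + T (inn e x) * Y' (inn e x)) (e := e) (M := 3)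
    hw hc (cont_d d.Td) ((cd_in d.Td d.qc e).mul (cd_in d.Yd d.Yc e))
    (fun x => ((dd e (d.Td _)).mul (dd e (d.Yd _))).congr_deriv (by rw [real_inner_self_eq_norm_sq, he]; simp))
    (fun x => by
      obtain ⟨h1, h2, h3, h4⟩ := d.Yb (inn e x)
      rw [abs_mul, abs_of_nonneg h4]
      calc _ ≤ 1 * (3:ℝ) := by gcongr; exact d.T1 _
        _ = 3 := one_mul _) d.i1
  have h2 := W.mono (f := fun x => Y (inn e x)) (g := fun x => (q (inn e x) * Y (inn e x) + T (inn e x) * Y' (inn e x)) + 3 * |q (inn e x) - 1|) (by fun_prop) (by fun_prop) fun x => by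
    set τ := inn e x
    obtain ⟨h1, h2, h3, h4⟩ := d.Yb τ
    have h5 := d.TY τ
    have h6 : (1 - q τ) * Y τ ≤ |q τ - 1| * 3 := by
      calc _ ≤ |q τ - 1| * Y τ := by gcongr; rw [abs_sub_comm]; exact le_abs_self _
        _ ≤ _ := by gcongr
    linarith
  rw [W.add (f := fun x => (q (inn e x) * Y (inn e x) + T (inn e x) * Y' (inn e x))) (by fun_prop) (by fun_prop), WV.mul (f := fun x => |q (inn e x) - 1|)] at h2
  have := (abs_le.1 h).2
  have := d.i2
  have := stepA' d hw hc W M he hσ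
  linarith

theorem stepC (d : DT w e D T q Z Z' Y Y' σ) (d₂ : DT w e' D T₂ q₂ Z₂ Z₂' Y₂ Y₂' σ) (hw : ContDiff ℝ 1 w) (hc : HasCompactSupport w) (W : WV w) (M : WV fun x => ‖fdv w x‖) (he : ‖e‖ = 1) (he' : ‖e'‖ = 1) (ho : inn e e' = 0) (hσ : 0 ≤ σ) :
    IW (fun x => ‖fdv w x‖) (fun x => T₂ (inn e' x) * Y (inn e x) * T₂ (inn e' x)) ≤ 15 * D + σ * IW (fun x => ‖fdv w x‖) (fun x => 1) := by
  have cY := (cont_d d.Yd)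
  have cq := d₂.qc
  have h := star (f := fun x => T₂ (inn e' x) * Y (inn e x)) (f' := fun x => q₂ (inn e' x) * Y (inn e x)) (e := e') (M := 3)
    hw hc (cont_d d₂.Td) ((cd_in d₂.Td d₂.qc e').mul (cd_in d.Yd d.Yc e))
    (fun x => ((dd e' (d₂.Td _)).mul (dd e' (d.Yd _))).congr_deriv (by rw [real_inner_self_eq_norm_sq, he', ho]; simp))
    (fun x => by
      obtain ⟨h1, h2, h3, h4⟩ := d.Yb (inn e x)
      rw [abs_mul, abs_of_nonneg h4]
      calc _ ≤ 1 * (3:ℝ) := by gcongr; exact d₂.T1 _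
        _ = 3 := one_mul _) d₂.i1
  have h2 := W.mono (f := fun x => q₂ (inn e' x) * Y (inn e x)) (g := fun x => Y (inn e x) + 3 * |q₂ (inn e' x) - 1|) (by fun_prop) (by fun_prop) fun x => by
    obtain ⟨h1, h2, h3, h4⟩ := d.Yb (inn e x)
    set y := Y (inn e x)
    set p := q₂ (inn e' x)
    have h6 : (p - 1) * y ≤ |p - 1| * 3 := by
      calc _ ≤ |p - 1| * y := by gcongr; exact le_abs_self _
        _ ≤ _ := by gcongr
    linarith
  rw [W.add (f := fun x => Y (inn e x)) (by fun_prop) (by fun_prop), WV.mul (f := fun x => |q₂ (inn e' x) - 1|)] at h2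
  have := (abs_le.1 h).1
  have := d₂.i2
  have := stepB d hw hc W M he hσ
  linarith
end
section

theorem g_lt {ι : Type*} [Fintype ι] (Z : ι → ℝ) : (∀ j, |Z j| < 1/2) ∨ 1/2 ≤ ∑ j, |Z j| := by
  by_cases h : ∀ j, |Z j| < 1/2
  · exact .inl h
  · push Not at h
    obtain ⟨j, hj⟩ := h
    exact .inr (hj.trans (Finset.single_le_sum (f := fun j => |Z j|) (fun i _ => abs_nonneg _) (Finset.mem_univ j)))

theorem g1 {ι : Type*} [Fintype ι] {T y Z : ι → ℝ} {ρ u σ : ℝ} (hT : ∀ j, |T j| ≤ 1) (hZ : ∀ j, |Z j| < 1/2 → |T j - y j| ≤ 2 * |Z j|)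
    (hu : u = ∑ j, y j ^ 2) (hρ : ρ ≤ 1) (hσ : 0 ≤ σ) (h : ρ ≤ max (u - 1) 0 + σ) : ρ ≤ |∑ j, T j ^ 2 - 1| + 6 * ∑ j, |Z j| + σ := by
  have S0 : 0 ≤ ∑ j, |Z j| := Finset.sum_nonneg fun j _ => abs_nonneg _
  rcases g_lt Z with hs | hs
  · have h1 : u - ∑ j, T j ^ 2 ≤ 6 * ∑ j, |Z j| := by
      rw [hu, ← Finset.sum_sub_distrib, Finset.mul_sum]
      refine Finset.sum_le_sum fun j _ => ?_
      have h2 := hZ j (hs j)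
      have h3 := hs j
      have h4 := abs_le.1 (hT j)
      have h5 := abs_le.1 h2
      calc y j ^ 2 - T j ^ 2 = -((T j - y j) * (y j + T j)) := by ring
        _ ≤ |(T j - y j) * (y j + T j)| := neg_le_abs _
        _ = |T j - y j| * |y j + T j| := abs_mul _ _
        _ ≤ (2 * |Z j|) * 3 := by gcongr; rw [abs_le]; constructor <;> linarith
        _ = _ := by ring
    have h6 := le_abs_self (∑ j, T j ^ 2 - 1)
    have h7 : max (u - 1) 0 ≤ |∑ j, T j ^ 2 - 1| + 6 * ∑ j, |Z j| := max_le (by linarith) (by positivity)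
    linarith
  · have := abs_nonneg (∑ j, T j ^ 2 - 1)
    linarith

theorem g2 {ι : Type*} [Fintype ι] {T y Z : ι → ℝ} {u r : ℝ} (hTy : ∀ j, 0 ≤ T j * y j) (hZ : ∀ j, |Z j| < 1/2 → |T j - y j| ≤ 2 * |Z j|)
    (hu : u = ∑ j, y j ^ 2) (h1 : 1 ≤ u) (r0 : 0 ≤ r) (hr : u * r ≤ 1) : u * r - 4 * ∑ j, |Z j| ≤ 2 * r * ∑ j, T j * y j := by
  rcases g_lt Z with hs | hs
  · have h2 : u - 2 * u * ∑ j, |Z j| ≤ ∑ j, T j * y j := by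
      nth_rewrite 1 [hu]
      rw [Finset.mul_sum, ← Finset.sum_sub_distrib]
      refine Finset.sum_le_sum fun j _ => ?_
      have h2 := hZ j (hs j)
      have h3 : |y j| ≤ u := by
        have : y j ^ 2 ≤ u := by rw [hu]; exact Finset.single_le_sum (f := fun j => y j ^ 2) (fun i _ => sq_nonneg _) (Finset.mem_univ j)
        exact abs_le_of_sq_le_sq (by nlinarith) (by linarith)
      have h4 : -(T j - y j) * y j ≤ 2 * |Z j| * u := by
        calc _ ≤ |-(T j - y j) * y j| := le_abs_self _
          _ = |T j - y j| * |y j| := by rw [abs_mul, abs_neg]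
          _ ≤ _ := by gcongr
      nlinarith
    have S0 : 0 ≤ ∑ j, |Z j| := Finset.sum_nonneg fun j _ => abs_nonneg _
    have h5 : 2 * r * (u - 2 * u * ∑ j, |Z j|) ≤ 2 * r * ∑ j, T j * y j := by gcongr
    have h6 : (u * r) * ∑ j, |Z j| ≤ 1 * ∑ j, |Z j| := by gcongr
    have h7 : 0 ≤ u * r := by positivity
    nlinarith
  · have : 0 ≤ 2 * r * ∑ j, T j * y j := mul_nonneg (by linarith) (Finset.sum_nonneg fun j _ => hTy j)
    linarith
variable {ι : Type*} [Fintype ι] {w : X → ℝ} {D σ : ℝ} {T q Z Z' Y Y' : ι → ℝ → ℝ} {b : OrthonormalBasis ι ℝ X}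

theorem stepD (d : ∀ i, DT w (b i) D (T i) (q i) (Z i) (Z' i) (Y i) (Y' i) σ) (hw : ContDiff ℝ 1 w) (hc : HasCompactSupport w) (W : WV w) (M : WV fun x => ‖fdv w x‖) (hD : 0 ≤ D) (hσ : 0 ≤ σ) (i : ι) :
    IW (fun x => ‖fdv w x‖) (fun x => Y i (inn (b i) x)) ≤ Fintype.card ι * (21 * D + σ * IW (fun x => ‖fdv w x‖) (fun x => 1)) := by
  have cT := fun j => cont_in (cont_d (d j).Td) (b j)
  have cY := cont_in (cont_d (d i).Yd) (b i)
  have h0 := step0 b hw hc (fun i => cont_d (d i).Td) (fun i => (d i).T1) (fun i => (d i).i1)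
  have h1 : ∀ j, IW (fun x => ‖fdv w x‖) (fun x => T j (inn (b j) x) * Y i (inn (b i) x) * T j (inn (b j) x)) ≤ 15 * D + σ * IW (fun x => ‖fdv w x‖) (fun x => 1) := by
    intro j
    by_cases hj : i = j
    · subst hj; have := stepA' (d i) hw hc W M (b.norm_eq_one i) hσ; linarith
    · exact stepC (d i) (d j) hw hc W M (b.norm_eq_one i) (b.norm_eq_one j) (b.inner_eq_zero hj) hσ
  have cf : ∀ j, Continuous fun x => T j (inn (b j) x) * Y i (inn (b i) x) * T j (inn (b j) x) := fun j => ((cT j).mul cY).mul (cT j)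
  have ca : Continuous fun x => |∑ i, T i (inn (b i) x) ^ 2 - 1| := ((continuous_finsetSum _ fun i _ => (cT i).pow 2).sub continuous_const).abs
  have h2 := M.mono (f := fun x => Y i (inn (b i) x)) (g := fun x => (∑ j, T j (inn (b j) x) * Y i (inn (b i) x) * T j (inn (b j) x)) + 3 * |∑ i, T i (inn (b i) x) ^ 2 - 1|) cY ((continuous_finsetSum _ fun j _ => cf j).add (continuous_const.mul ca)) fun x => by
    obtain ⟨_, _, h3, h4⟩ := (d i).Yb (inn (b i) x)
    rw [Finset.sum_congr rfl fun j _ => show T j (inn (b j) x) * Y i (inn (b i) x) * T j (inn (b j) x) = Y i (inn (b i) x) * T j (inn (b j) x) ^ 2 by ring, ← Finset.mul_sum]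
    generalize Y i (inn (b i) x) = y at *
    generalize ∑ j, T j (inn (b j) x) ^ 2 = s
    have := neg_abs_le (s - 1)
    have : y * (-|s - 1|) ≤ y * (s - 1) := by gcongr
    have : y * |s - 1| ≤ 3 * |s - 1| := by gcongr
    linarith
  have c1 : Continuous fun x => ∑ j, T j (inn (b j) x) * Y i (inn (b i) x) * T j (inn (b j) x) := continuous_finsetSum _ fun j _ => cf j
  have c2 : Continuous fun x => 3 * |∑ i, T i (inn (b i) x) ^ 2 - 1| := continuous_const.mul ca
  rw [M.add c1 c2, WV.mul (f := fun x => |∑ i, T i (inn (b i) x) ^ 2 - 1|), M.sum cf] at h2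
  have h3 := Finset.sum_le_sum fun j (_ : j ∈ Finset.univ) => h1 j
  rw [Finset.sum_const, Finset.card_univ, nsmul_eq_mul] at h3
  linarith

theorem stepG [Nonempty ι] (d : ∀ i, DT w (b i) D (T i) (q i) (Z i) (Z' i) (Y i) (Y' i) σ) (hw : ContDiff ℝ 1 w) (hc : HasCompactSupport w) (W : WV w) (M : WV fun x => ‖fdv w x‖) (hD : 0 ≤ D) {ε : ℝ} (hε : 0 < ε) (hσ : σ = √ε)
    {c : X} (hZ : ∀ j τ, |Z j τ| < 1/2 → |T j τ - (τ - inn (b j) c)| ≤ 2 * |Z j τ|) (hTy : ∀ j τ, 0 ≤ T j τ * (τ - inn (b j) c)) {E1 : ℝ} 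
    (hE : ∀ i, IW (fun x => ‖fdv w x‖) (fun x => Y i (inn (b i) x)) ≤ E1) (hE' : ∀ i, IW w (fun x => Y i (inn (b i) x)) ≤ E1) :
    ∫ x, (Bal c 1)ᶜ.indicator w x ≤ 8 * (Fintype.card ι * (6 * D + 10 * E1) + σ * IW (fun x => ‖fdv w x‖) (fun x => 1)) := by
  have σ0 : 0 ≤ σ := hσ ▸ Real.sqrt_nonneg _
  obtain ⟨ρ, ρ', ρd, ρc, ρb, ρ0, ρ1, ρ2, ρ3⟩ := rho_fun hε
  set u : X → ℝ := fun x => ‖x - c‖ ^ 2 with hu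
  have cu : Continuous u := by fun_prop
  have cρ : Continuous ρ := cont_d ρd
  have cT := fun j => cont_in (cont_d (d j).Td) (b j)
  have cq := fun j => cont_in (d j).qc (b j)
  have cY := fun j => cont_in (cont_d (d j).Yd) (b j)
  have h0 := step0 b hw hc (fun i => cont_d (d i).Td) (fun i => (d i).T1) (fun i => (d i).i1)
  have us : ∀ x, u x = ∑ j, (inn (b j) x - inn (b j) c) ^ 2 := by
    intro x
    simp only [hu]
    rw [← real_inner_self_eq_norm_sq, ← b.sum_inner_mul_inner]
    refine Finset.sum_congr rfl fun j _ => ?_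
    rw [real_inner_comm (b j), inner_sub_right, sq]
  set f' : ι → X → ℝ := fun j x => ρ' (u x) * (2 * (inn (b j) x - inn (b j) c)) * T j (inn (b j) x) + ρ (u x) * q j (inn (b j) x) with hf'
  have cf' : ∀ j, Continuous (f' j) := fun j => ((((ρc.comp cu).mul (by fun_prop)).mul (cT j)).add ((cρ.comp cu).mul (cq j)))
  have hs : ∀ j, IW w (f' j) ≤ IW (fun x => ‖fdv w x‖) (fun x => ρ (u x) * T j (inn (b j) x) * T j (inn (b j) x)) + D := by
    intro j
    have h := star (f := fun x => ρ (u x) * T j (inn (b j) x)) (f' := f' j) (e := b j) (M := 1) hw hc (cont_d (d j).Td)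
      (((cd1 ρd ρc).comp ((contDiff_id.sub contDiff_const).norm_sq ℝ)).mul (cd_in (d j).Td (d j).qc (b j)))
      (fun x => by
        have h1 : HasDerivAt (fun s : ℝ => u (x + s • b j)) (2 * (inn (b j) x - inn (b j) c)) 0 := by
          have : (fun s : ℝ => u (x + s • b j)) = fun s : ℝ => u x + (2 * (inn (b j) x - inn (b j) c)) * s + s ^ 2 := by
            funext s
            simp only [hu]
            rw [show x + s • b j - c = (x - c) + s • b j by abel, norm_add_sq_real, inner_smul_right, real_inner_comm, inner_sub_right, norm_smul, b.norm_eq_one, mul_one, Real.norm_eq_abs, sq_abs]; ring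
          rw [this]
          exact ((((hasDerivAt_id (0:ℝ)).const_mul _).const_add _).add ((hasDerivAt_id (0:ℝ)).pow 2)).congr_deriv (by simp)
        have h2 : HasDerivAt (fun s : ℝ => ρ (u (x + s • b j))) (ρ' (u x) * (2 * (inn (b j) x - inn (b j) c))) 0 := by
          refine HasDerivAt.comp (h₂ := ρ) (0:ℝ) ?_ h1
          simpa using ρd (u x)
        exact (h2.mul (dd (b j) ((d j).Td _))).congr_deriv (by rw [real_inner_self_eq_norm_sq, b.norm_eq_one]; simp [hf']))
      (fun x => by
        rw [abs_mul, abs_of_nonneg (ρb _).1]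
        calc _ ≤ 1 * (1:ℝ) := by gcongr; exacts [(ρb _).2, (d j).T1 _]
          _ = 1 := one_mul _) (d j).i1
    have := (abs_le.1 h).2
    linarith
  have cs : Continuous fun x => ∑ j, ρ (u x) * T j (inn (b j) x) * T j (inn (b j) x) := continuous_finsetSum _ fun j _ => ((cρ.comp cu).mul (cT j)).mul (cT j)
  have ca : Continuous fun x => |∑ i, T i (inn (b i) x) ^ 2 - 1| := ((continuous_finsetSum _ fun i _ => (cT i).pow 2).sub continuous_const).abs
  have cYs : Continuous fun x => ∑ j, Y j (inn (b j) x) := continuous_finsetSum _ fun j _ => cY j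
  have zy : ∀ x, ∑ j, |Z j (inn (b j) x)| ≤ ∑ j, Y j (inn (b j) x) := fun x => Finset.sum_le_sum fun j _ => ((d j).Yb _).1
  have hR : IW (fun x => ‖fdv w x‖) (fun x => ∑ j, ρ (u x) * T j (inn (b j) x) * T j (inn (b j) x)) ≤
      2 * (2 * (Fintype.card ι * D)) + 6 * (Fintype.card ι * E1) + σ * IW (fun x => ‖fdv w x‖) (fun x => 1) := by
    refine le_trans (M.mono (g := fun x => (2 * |∑ i, T i (inn (b i) x) ^ 2 - 1| + 6 * ∑ j, Y j (inn (b j) x)) + σ * 1) cs (((continuous_const.mul ca).add (continuous_const.mul cYs)).add continuous_const) fun x => ?_) ?_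
    · have h1 := g1 (T := fun j => T j (inn (b j) x)) (y := fun j => inn (b j) x - inn (b j) c) (Z := fun j => Z j (inn (b j) x)) (fun j => (d j).T1 _) (fun j => hZ j _) (us x) (ρb (u x)).2 σ0 (hσ ▸ ρ2 (u x))
      have h2 := zy x
      rw [Finset.sum_congr rfl fun j _ => show ρ (u x) * T j (inn (b j) x) * T j (inn (b j) x) = ρ (u x) * T j (inn (b j) x) ^ 2 by ring, ← Finset.mul_sum]
      have h3 := ρb (u x)
      generalize ∑ j, T j (inn (b j) x) ^ 2 = s at *
      have : ρ (u x) * (s - 1) ≤ 1 * |s - 1| := by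
        calc _ ≤ ρ (u x) * |s - 1| := mul_le_mul_of_nonneg_left (le_abs_self _) h3.1
          _ ≤ _ := mul_le_mul_of_nonneg_right h3.2 (abs_nonneg _)
      linarith
    · have c1 : Continuous fun x => 2 * |∑ i, T i (inn (b i) x) ^ 2 - 1| := continuous_const.mul ca
      have c2 : Continuous fun x => 6 * ∑ j, Y j (inn (b j) x) := continuous_const.mul cYs
      have c3 : Continuous fun x => 2 * |∑ i, T i (inn (b i) x) ^ 2 - 1| + 6 * ∑ j, Y j (inn (b j) x) := c1.add c2
      rw [M.add c3 continuous_const, M.add c1 c2, WV.mul (f := fun x => |∑ i, T i (inn (b i) x) ^ 2 - 1|), WV.mul (f := fun x => ∑ j, Y j (inn (b j) x)), WV.mul (f := fun x => 1), M.sum cY]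
      have h3 := Finset.sum_le_sum fun j (_ : j ∈ Finset.univ) => hE j
      rw [Finset.sum_const, Finset.card_univ, nsmul_eq_mul] at h3
      linarith
  have hL : IW w (fun x => ∑ j, f' j x) ≤ 2 * (2 * (Fintype.card ι * D)) + 6 * (Fintype.card ι * E1) + σ * IW (fun x => ‖fdv w x‖) (fun x => 1) + Fintype.card ι * D := by
    rw [W.sum cf']
    have h3 := Finset.sum_le_sum fun j (_ : j ∈ Finset.univ) => hs j
    rw [Finset.sum_add_distrib, Finset.sum_const, Finset.card_univ, nsmul_eq_mul, ← M.sum (f := fun j x => ρ (u x) * T j (inn (b j) x) * T j (inn (b j) x)) fun j => ((cρ.comp cu).mul (cT j)).mul (cT j)] at h3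
    linarith
  have cqs : Continuous fun x => ∑ j, |q j (inn (b j) x) - 1| := continuous_finsetSum _ fun j _ => ((cq j).sub continuous_const).abs
  have cfs : Continuous fun x => ∑ j, f' j x := continuous_finsetSum _ fun j _ => cf' j
  have cG : Continuous fun x => 8 * ((∑ j, f' j x + 4 * ∑ j, Y j (inn (b j) x)) + ∑ j, |q j (inn (b j) x) - 1|) := continuous_const.mul ((cfs.add (continuous_const.mul cYs)).add cqs)
  have pt : ∀ x, (Bal c 1)ᶜ.indicator w x ≤ (8 * ((∑ j, f' j x + 4 * ∑ j, Y j (inn (b j) x)) + ∑ j, |q j (inn (b j) x) - 1|)) * w x := by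
    intro x
    have h4 : 0 ≤ ρ' (u x) * 2 * ∑ j, T j (inn (b j) x) * (inn (b j) x - inn (b j) c) := mul_nonneg (mul_nonneg (ρ0 _) zero_le_two) (Finset.sum_nonneg fun j _ => hTy j _)
    have h5 : ∑ j, f' j x = 2 * ρ' (u x) * (∑ j, T j (inn (b j) x) * (inn (b j) x - inn (b j) c)) + ρ (u x) * ∑ j, q j (inn (b j) x) := by
      rw [Finset.mul_sum, Finset.mul_sum, ← Finset.sum_add_distrib]; exact Finset.sum_congr rfl fun j _ => by simp only [hf']; ring
    have h6 : ρ (u x) - ∑ j, |q j (inn (b j) x) - 1| ≤ ρ (u x) * ∑ j, q j (inn (b j) x) := by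
      obtain ⟨r0, r1⟩ := ρb (u x)
      have hk : (1:ℝ) ≤ Fintype.card ι := by exact_mod_cast Fintype.card_pos
      have h7 : (Fintype.card ι : ℝ) - ∑ j, |q j (inn (b j) x) - 1| ≤ ∑ j, q j (inn (b j) x) := by
        rw [sub_le_iff_le_add, ← Finset.sum_add_distrib, ← Finset.card_univ, Finset.cast_card]
        exact Finset.sum_le_sum fun j _ => by have := neg_abs_le (q j (inn (b j) x) - 1); linarith
      have h8 : 0 ≤ ∑ j, |q j (inn (b j) x) - 1| := Finset.sum_nonneg fun j _ => abs_nonneg _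
      generalize ∑ j, |q j (inn (b j) x) - 1| = a at *
      generalize ∑ j, q j (inn (b j) x) = s at *
      have := mul_le_mul_of_nonneg_left h7 r0
      have := mul_le_mul_of_nonneg_left hk r0
      have := mul_le_mul_of_nonneg_right r1 h8
      linarith
    have h2 := zy x
    have hS : 0 ≤ ∑ j, |Z j (inn (b j) x)| := Finset.sum_nonneg fun j _ => abs_nonneg _
    by_cases hx : x ∈ Bal c 1
    · rw [indicator_of_notMem (by simpa using hx)]
      refine mul_nonneg ?_ (W.p x)
      have := (ρb (u x)).1
      linarith
    · rw [indicator_of_mem (by simpa using hx)]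
      have u1 : 1 ≤ u x := by
        rw [Metric.mem_ball, not_lt, dist_eq_norm] at hx
        show 1 ≤ ‖x - c‖ ^ 2
        exact one_le_pow₀ hx
      have h1 := g2 (T := fun j => T j (inn (b j) x)) (y := fun j => inn (b j) x - inn (b j) c) (Z := fun j => Z j (inn (b j) x)) (fun j => hTy j _) (fun j => hZ j _) (us x) u1 (ρ0 (u x)) (ρ1 _ (by linarith))
      have h9 := ρ3 _ u1
      refine le_mul_of_one_le_left (W.p x) ?_
      linarith
  have fin : ∫ x, (Bal c 1)ᶜ.indicator w x ≤ IW w _ := integral_mono (((W.c.integrable_of_hasCompactSupport W.s)).indicator measurableSet_ball.compl) (W.int cG) pt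
  have c2 : Continuous fun x => 4 * ∑ j, Y j (inn (b j) x) := continuous_const.mul cYs
  have c3 : Continuous fun x => ∑ j, f' j x + 4 * ∑ j, Y j (inn (b j) x) := cfs.add c2
  rw [WV.mul, W.add c3 cqs, W.add cfs c2, WV.mul (f := fun x => ∑ j, Y j (inn (b j) x)), W.sum cY, W.sum (f := fun j x => |q j (inn (b j) x) - 1|) fun j => ((cq j).sub continuous_const).abs] at fin
  have h3 := Finset.sum_le_sum fun j (_ : j ∈ Finset.univ) => hE' j
  have h4 := Finset.sum_le_sum fun j (_ : j ∈ Finset.univ) => (d j).i2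
  rw [Finset.sum_const, Finset.card_univ, nsmul_eq_mul] at h3 h4
  linarith
end

theorem W_main [Nontrivial X] {n : ℕ} (hn : frk X = n + 1) (h1n : 1 ≤ n) :
    ∃ C > (0:ℝ), ∃ ε₀ > (0:ℝ), ∀ (w : X → ℝ) (ε : ℝ), 0 < ε → ε ≤ ε₀ → WH n w ε →
      ∃ c, ∫ x, |w x - (Bal c 1).indicator (fun _ => 1) x| ≤ C * √ε := by
  obtain ⟨C, C0, ε₀, ε00, H⟩ := dir_main hn h1n
  set k : ℝ := n + 1
  set Q : ℝ := k * om (n+1) + 1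
  have k0 : 0 < k := by positivity
  have Q0 : 0 < Q := by have := om_pos (n+1); positivity
  set E1 : ℝ := k * (21 * C + Q) + (9 * C + Q)
  refine ⟨2 * (8 * (k * (6 * C + 10 * E1) + Q)) + 1, by positivity, min ε₀ 1, by positivity, fun w ε hε hεe hW => ?_⟩
  have e1 : ε ≤ 1 := hεe.trans (min_le_right _ _)
  have HH := fun e he => H w ε e hε (hεe.trans (min_le_left _ _)) hW he
  obtain ⟨hw, hc, w0, w1, hV, hκ, hP⟩ := hW
  have W : WV w := ⟨hw.continuous, hc, w0⟩
  have M : WV fun x => ‖fdv w x‖ := ⟨(hw.continuous_fderiv one_ne_zero).norm, (hc.fderiv (𝕜 := ℝ)).norm, fun x => norm_nonneg _⟩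
  set b := stdOrthonormalBasis ℝ X
  have key : ∀ i, ∃ T q Z Z' Y Y' : ℝ → ℝ, ∃ c : ℝ, DT w (b i) (C * √ε) T q Z Z' Y Y' √ε ∧ (∀ τ, |Z τ| < 1/2 → |T τ - (τ - c)| ≤ 2 * |Z τ|) ∧ (∀ τ, 0 ≤ T τ * (τ - c)) := by
    intro i
    obtain ⟨T, q, c, Tc, T1, Td, qc, q0, i1, i2⟩ := HH (b i) (b.norm_eq_one i)
    obtain ⟨Z, Z', Zd, Zc, Z0, Z2, TZ, Ty, hZ⟩ := oneD Tc Td qc q0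
    obtain ⟨Y, Y', Yd, Yc, Yb, TY⟩ := yfun hε e1 Zd Zc Z2
    refine ⟨T, q, Z, Z', Y, Y', c, ⟨T1, Td, qc, q0, i1, ?_, Zd, Zc, Z0, Z2, TZ, Yd, Yc, Yb, fun τ => TY τ _ (TZ τ) (Z0 τ).1⟩, hZ, Ty⟩
    unfold IW; simpa only [mul_comm] using i2
  choose T q Z Z' Y Y' c d hZ hTy using key
  set cv : X := ∑ i, c i • b i
  have hcv : ∀ j, inn (b j) cv = c j := fun j => b.orthonormal.inner_right_fintype c j
  have s0 : 0 ≤ √ε := Real.sqrt_nonneg _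
  have D0 : 0 ≤ C * √ε := by positivity
  have hQ : IW (fun x => ‖fdv w x‖) (fun x => 1) ≤ Q := by unfold IW; simp only [one_mul]; linarith
  have hk : (Fintype.card (Fin (frk X)) : ℝ) = k := by rw [Fintype.card_fin, hn]; push_cast; rfl
  have sQ : √ε * IW (fun x => ‖fdv w x‖) (fun x => 1) ≤ √ε * Q := by gcongr
  have hE : ∀ i, IW (fun x => ‖fdv w x‖) (fun x => Y i (inn (b i) x)) ≤ E1 * √ε := fun i => by
    refine (stepD d hw hc W M D0 s0 i).trans ?_
    rw [hk]
    calc _ ≤ k * (21 * (C * √ε) + √ε * Q) := by gcongr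
      _ ≤ k * (21 * (C * √ε) + √ε * Q) + (9 * C + Q) * √ε := le_add_of_nonneg_right (by positivity)
      _ = _ := by ring
  have hE' : ∀ i, IW w (fun x => Y i (inn (b i) x)) ≤ E1 * √ε := fun i => by
    refine (stepB (d i) hw hc W M (b.norm_eq_one i) s0).trans ?_
    calc _ ≤ 9 * (C * √ε) + √ε * Q := by gcongr
      _ ≤ 9 * (C * √ε) + √ε * Q + k * (21 * C + Q) * √ε := le_add_of_nonneg_right (by positivity)
      _ = _ := by ring
  haveI : Nonempty (Fin (frk X)) := ⟨⟨0, by omega⟩⟩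
  have G := stepG d hw hc W M D0 hε rfl (c := cv) (fun j τ => by rw [hcv]; exact hZ j τ) (fun j τ => by rw [hcv]; exact hTy j τ) hE hE'
  rw [hk] at G
  have G' : ∫ x, (Bal cv 1)ᶜ.indicator w x ≤ 8 * (k * (6 * C + 10 * E1) + Q) * √ε := by
    refine G.trans ?_
    have : 8 * (k * (6 * C + 10 * E1) + Q) * √ε = 8 * (k * (6 * (C * √ε) + 10 * (E1 * √ε)) + √ε * Q) := by ring
    rw [this]; gcongr
  refine ⟨cv, ?_⟩
  have mB : MeasurableSet (Bal cv 1) := measurableSet_ball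
  have iw : Integrable w := hw.continuous.integrable_of_hasCompactSupport hc
  have iB : Integrable ((Bal cv 1).indicator fun _ => (1:ℝ)) := (integrable_indicator_iff mB).2 (integrableOn_const (vol_ball_lt_top _ _).ne)
  have pt : ∀ x, |w x - (Bal cv 1).indicator (fun _ => 1) x| = 2 * (Bal cv 1)ᶜ.indicator w x + ((Bal cv 1).indicator (fun _ => (1:ℝ)) x - w x) := by
    intro x
    by_cases hx : x ∈ Bal cv 1
    · rw [indicator_of_mem hx, indicator_of_notMem (by simpa using hx), abs_of_nonpos (by linarith [w1 x])]; ring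
    · rw [indicator_of_notMem hx, indicator_of_mem (by simpa using hx), sub_zero, abs_of_nonneg (w0 x)]; ring
  have a : ∫ x, (2 * (Bal cv 1)ᶜ.indicator w x + ((Bal cv 1).indicator (fun _ => (1:ℝ)) x - w x)) = _ := integral_add ((iw.indicator mB.compl).const_mul 2) (iB.sub iw)
  have a' : ∫ x, ((Bal cv 1).indicator (fun _ => (1:ℝ)) x - w x) = _ := integral_sub iB iw
  have vB : ∫ x, (Bal cv 1).indicator (fun _ => (1:ℝ)) x = om (n+1) := by
    rw [integral_indicator_const _ mB, measureReal_def, vol_ball_om hn cv one_pos, ENNReal.toReal_ofReal (by have := om_pos (n+1); positivity)]; simp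
  rw [integral_congr_ae (Eventually.of_forall pt), a, a', integral_const_mul, vB]
  have h1 := (abs_le.1 hV).1
  have h2 : ε ≤ √ε := Real.le_sqrt_of_sq_le (by nlinarith)
  linarith

noncomputable def JJ (E : Set X) (a : ℝ) : ℝ≥0∞ := ∫⁻ h, ind (Iio a) ‖h‖ * ee E h

noncomputable def df (E : Set X) (a : ℝ) : ℝ≥0∞ := JJ E a - JJ (Bal (0:X) 1) a

noncomputable def kap (p a : ℝ) : ℝ≥0∞ := oR (p * a ^ (-p - 1))

noncomputable def PP (p : ℝ) (E : Set X) : ℝ≥0∞ := ∫⁻ h, oR (‖h‖ ^ (-p)) * ee E h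

theorem indI_mono {a b : ℝ} (h : a ≤ b) (r : ℝ) : ind (Iio a) r ≤ ind (Iio b) r := by
  by_cases h1 : r < a
  · rw [ind_of_mem (show r ∈ Iio a from h1), ind_of_mem (show r ∈ Iio b from h1.trans_le h)]
  · rw [ind_of_not (show ¬ r ∈ Iio a from h1)]; exact zero_le

theorem JJ_mono (E : Set X) : Monotone (JJ E) := fun a b h => lintegral_mono fun x => mul_le_mul_left (indI_mono h _) _

theorem JJ_meas (E : Set X) : Measurable (JJ E) := (JJ_mono E).measurable

theorem df_meas (E : Set X) : Measurable (df E) := (JJ_meas E).sub (JJ_meas _)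

theorem kap_meas (p : ℝ) : Measurable (kap p) := by unfold kap; fun_prop

theorem indI_meas2 : Measurable fun p : X × ℝ => ind (Iio p.2) ‖p.1‖ := by
  have : (fun p : X × ℝ => ind (Iio p.2) ‖p.1‖) = {p : X × ℝ | ‖p.1‖ < p.2}.indicator 1 := by
    ext p
    by_cases h : ‖p.1‖ < p.2
    · rw [ind_of_mem (show ‖p.1‖ ∈ Iio p.2 from h), indicator_of_mem (show p ∈ {p : X × ℝ | ‖p.1‖ < p.2} from h)]; rfl
    · rw [ind_of_not (show ¬ ‖p.1‖ ∈ Iio p.2 from h), indicator_of_notMem (show ¬ p ∈ {p : X × ℝ | ‖p.1‖ < p.2} from h)]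
  rw [this]
  exact measurable_one.indicator (measurableSet_lt (measurable_norm.comp measurable_fst) measurable_snd)

theorem JJ_lt_top {E : Set X} (hE : MeasurableSet E) (hv : volume E ≠ ⊤) (a : ℝ) : JJ E a ≠ ⊤ := by
  have : JJ E a ≤ volume (Bal (0:X) a) * volume E := by
    rw [vol_ind measurableSet_ball, ← lintegral_mul_const _ (ind_meas measurableSet_ball)]
    apply lintegral_mono; intro h
    show ind (Iio a) ‖h‖ * ee E h ≤ ind (Bal (0:X) a) h * volume E
    rw [ind_ball]; gcongr; exact ee_le hE h
  exact ne_top_of_le_ne_top (mul_ne_top (vol_ball_lt_top _ _).ne hv) this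

theorem df_add [Nontrivial X] {E : Set X} (hE : MeasurableSet E) (hv : volume E = volume (Bal (0:X) 1)) (a : ℝ) :
    JJ E a = JJ (Bal (0:X) 1) a + df E a := by
  exact (add_tsub_cancel_of_le (J_riesz hE hv a)).symm

theorem layer {E : Set X} (hE : MeasurableSet E) {κ : ℝ → ℝ≥0∞} (hκ : Measurable κ) :
    ∫⁻ h, (∫⁻ a in Ioi (0:ℝ), κ a * ind (Iio a) ‖h‖) * ee E h = ∫⁻ a in Ioi (0:ℝ), κ a * JJ E a := by
  have m1 : ∀ h : X, Measurable fun a : ℝ => κ a * ind (Iio a) ‖h‖ := fun h =>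
    hκ.mul (indI_meas2.comp (measurable_const.prodMk measurable_id))
  have m2 : ∀ a : ℝ, Measurable fun h : X => ind (Iio a) ‖h‖ * ee E h := fun a =>
    (indI_meas2.comp (measurable_id.prodMk measurable_const)).mul (ee_meas hE)
  calc _ = ∫⁻ h, ∫⁻ a in Ioi (0:ℝ), κ a * (ind (Iio a) ‖h‖ * ee E h) := by
        congr 1; ext h
        rw [← lintegral_mul_const _ (m1 h)]; congr 1; ext a; ring
    _ = ∫⁻ a in Ioi (0:ℝ), ∫⁻ h, κ a * (ind (Iio a) ‖h‖ * ee E h) := by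
        rw [lintegral_lintegral_swap]
        exact ((hκ.comp measurable_snd).mul (indI_meas2.mul ((ee_meas hE).comp measurable_fst))).aemeasurable
    _ = _ := by
        congr 1; ext a
        rw [lintegral_const_mul _ (m2 a)]; rfl

theorem kap_tail {p r : ℝ} (hp : 0 < p) (hr : 0 < r) : ∫⁻ a in Ioi r, kap p a = oR (r ^ (-p)) := by
  unfold kap
  have i1 : IntegrableOn (fun a : ℝ => p * a ^ (-p - 1)) (Ioi r) := (integrableOn_Ioi_rpow_of_lt (by linarith) hr).const_mul p
  rw [← ofReal_integral_eq_lintegral_ofReal i1 ((ae_restrict_mem measurableSet_Ioi).mono fun a ha => by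
    have : 0 < a := hr.trans ha
    show 0 ≤ p * a ^ (-p - 1)
    positivity), integral_const_mul, integral_Ioi_rpow_of_lt (by linarith) hr]
  congr 1; rw [sub_add_cancel]; field_simp

theorem lint_Ioi_ind {f : ℝ → ℝ≥0∞} {r : ℝ} (hr : 0 ≤ r) :
    ∫⁻ a in Ioi (0:ℝ), f a * ind (Iio a) r = ∫⁻ a in Ioi r, f a := by
  rw [← lintegral_indicator measurableSet_Ioi, ← lintegral_indicator measurableSet_Ioi]
  congr 1; ext a
  by_cases h : r < a
  · rw [indicator_of_mem (show a ∈ Ioi 0 from hr.trans_lt h), indicator_of_mem (show a ∈ Ioi r from h), ind_of_mem (show r ∈ Iio a from h), mul_one]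
  · rw [indicator_of_notMem (show a ∉ Ioi r from h)]
    apply indicator_apply_eq_zero.2; intro _
    rw [ind_of_not (show ¬ r ∈ Iio a from h), mul_zero]

theorem ae_ne_zero [Nontrivial X] : ∀ᵐ h : X, h ≠ 0 := by
  rw [ae_iff]; simp

theorem PP_eq [Nontrivial X] {E : Set X} (hE : MeasurableSet E) {p : ℝ} (hp : 0 < p) : PP p E = ∫⁻ a in Ioi (0:ℝ), kap p a * JJ E a := by
  rw [← layer hE (kap_meas p)]
  apply lintegral_congr_ae
  filter_upwards [ae_ne_zero (X := X)] with h hh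
  rw [lint_Ioi_ind (norm_nonneg h), kap_tail hp (norm_pos_iff.2 hh)]

theorem PP_add [Nontrivial X] {E : Set X} (hE : MeasurableSet E) (hv : volume E = volume (Bal (0:X) 1)) {p : ℝ} (hp : 0 < p) :
    PP p E = PP p (Bal (0:X) 1) + ∫⁻ a in Ioi (0:ℝ), kap p a * df E a := by
  rw [PP_eq hE hp, PP_eq measurableSet_ball hp, ← lintegral_add_left]
  · congr 1; ext a; rw [← mul_add, df_add hE hv]
  · exact (kap_meas p).mul (JJ_meas _)
/-- tail of the kernel -/

theorem tail_int [Nontrivial X] {n : ℕ} (hn : frk X = n + 1) {t : ℝ} (ht : 0 < t) :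
    oR t * ∫⁻ h : X, oR (‖h‖ ^ (-((n:ℝ)+1+t))) * ind (Ici 1) ‖h‖ = oR ((n+1)*om (n+1)) := by
  rw [lint_radial hn (f := fun r => oR (r ^ (-((n:ℝ)+1+t))) * ind (Ici 1) r) (by
    exact Measurable.mul (by fun_prop) (ind_meas measurableSet_Ici)), mul_left_comm]
  conv_rhs => rw [← mul_one (oR _)]
  congr 1
  have := kap_tail ht one_pos
  rw [Real.one_rpow, ofReal_one] at this
  rw [← this, ← lintegral_const_mul, ← lintegral_indicator measurableSet_Ioi, ← lintegral_indicator measurableSet_Ioi]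
  · apply lintegral_congr_ae
    have : ∀ᵐ r : ℝ, r ≠ 1 := by rw [ae_iff]; simp
    filter_upwards [this] with r hr
    by_cases h : 1 < r
    · have r0 : 0 < r := by linarith
      rw [indicator_of_mem (show r ∈ Ioi 0 from r0), indicator_of_mem (show r ∈ Ioi 1 from h), ind_of_mem (show r ∈ Ici 1 from h.le), mul_one, kap, ← ofReal_mul (by positivity), ← ofReal_mul (by positivity)]
      congr 2
      rw [← Real.rpow_natCast, ← Real.rpow_add r0]; congr 1; ring
    · rw [indicator_of_notMem (show r ∉ Ioi 1 from h)]
      apply indicator_apply_eq_zero.2; intro _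
      rw [ind_of_not (show ¬ r ∈ Ici 1 from fun h' => h (lt_of_le_of_ne h' hr.symm)), mul_zero, mul_zero, mul_zero]
  · exact Measurable.mul (by fun_prop) (Measurable.mul (by fun_prop) (ind_meas measurableSet_Ici))

theorem near_int [Nontrivial X] {n : ℕ} (hn : frk X = n + 1) {t : ℝ} (ht : t < 1) :
    oR (1-t) * ∫⁻ h : X, oR (‖h‖ ^ (-((n:ℝ)+1+t))) * (oR ‖h‖ * ind (Iio 1) ‖h‖) = oR ((n+1)*om (n+1)) := by
  rw [lint_radial hn (f := fun r => oR (r ^ (-((n:ℝ)+1+t))) * (oR r * ind (Iio 1) r)) (by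
    exact Measurable.mul (by fun_prop) (Measurable.mul (by fun_prop) (ind_meas measurableSet_Iio))), mul_left_comm]
  conv_rhs => rw [← mul_one (oR _)]
  congr 1
  have h1 := lint_rpow (p := -t) (by linarith) zero_le_one
  rw [Real.one_rpow] at h1
  calc _ = oR (1-t) * oR (1 / (-t+1)) := by
        rw [← h1]; congr 1
        apply setLIntegral_congr_fun measurableSet_Ioi
        intro r (r0 : 0 < r)
        show oR (r^n) * (oR (r ^ (-((n:ℝ)+1+t))) * (oR r * ind (Iio 1) r)) = oR (r ^ (-t)) * ind (Iio 1) r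
        rw [← mul_assoc, ← mul_assoc, ← ofReal_mul (by positivity), ← ofReal_mul (by positivity)]
        congr 2
        rw [← Real.rpow_natCast, ← Real.rpow_add r0, ← Real.rpow_add_one r0.ne']; congr 1; ring
    _ = 1 := by
        rw [← ofReal_mul (by linarith), show (1-t) * (1/(-t+1)) = 1 by field_simp [show (-t+1) ≠ 0 by linarith]; ring, ofReal_one]

theorem ind_IC (r : ℝ) : ind (Iio 1) r + ind (Ici 1) r = 1 := by
  rw [← ind_add (Iio (1:ℝ)) r]; congr 2; ext; simp

theorem PP_split {E : Set X} (hE : MeasurableSet E) (p : ℝ) :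
    PP p E = (∫⁻ h, oR (‖h‖ ^ (-p)) * (ee E h * ind (Iio 1) ‖h‖)) + ∫⁻ h, oR (‖h‖ ^ (-p)) * (ee E h * ind (Ici 1) ‖h‖) := by
  rw [← lintegral_add_left]
  · unfold PP; congr 1; ext h; rw [← mul_add, ← mul_add, ind_IC, mul_one]
  · exact Measurable.mul (by fun_prop) ((ee_meas hE).mul ((ind_meas measurableSet_Iio).comp measurable_norm))

theorem tail_le [Nontrivial X] {n : ℕ} (hn : frk X = n + 1) {t : ℝ} (ht : 0 < t) {E : Set X} (hE : MeasurableSet E) :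
    oR t * ∫⁻ h : X, oR (‖h‖ ^ (-((n:ℝ)+1+t))) * (ee E h * ind (Ici 1) ‖h‖) ≤ oR ((n+1)*om (n+1)) * volume E := by
  rw [← tail_int hn ht, mul_assoc, ← lintegral_mul_const]
  · refine mul_le_mul_right (lintegral_mono fun h => ?_) _
    dsimp only
    rw [mul_assoc]; refine mul_le_mul_right ?_ _
    rw [mul_comm]; exact mul_le_mul_right (ee_le hE h) _
  · exact Measurable.mul (by fun_prop) ((ind_meas measurableSet_Ici).comp measurable_norm)

theorem PB_bounds [Nontrivial X] {n : ℕ} (hn : frk X = n + 1) {δ t : ℝ} (hδ : 0 < δ) (hδt : δ ≤ t) (ht : t < 1) :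
    oR (((n+1)*om (n+1)) * (om n * (1/2)^n)) ≤ oR (1-t) * PP (n+1+t) (Bal (0:X) 1) ∧
    oR (1-t) * PP (n+1+t) (Bal (0:X) 1) ≤ oR (((n+1)*om (n+1)) * om n + ((n+1)*om (n+1)) * om (n+1) / δ) := by
  have o1 := om_pos n
  have o2 := om_pos (n+1)
  have hb : MeasurableSet (Bal (0:X) 1) := measurableSet_ball
  have mm : Measurable fun h : X => oR (‖h‖ ^ (-((n:ℝ)+1+t))) * (oR ‖h‖ * ind (Iio 1) ‖h‖) :=
    Measurable.mul (by fun_prop) (Measurable.mul (by fun_prop) ((ind_meas measurableSet_Iio).comp measurable_norm))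
  constructor
  · rw [ofReal_mul (by positivity), ← near_int hn ht, mul_assoc, ← lintegral_mul_const _ mm]
    unfold PP
    refine mul_le_mul_right (lintegral_mono fun h => ?_) _
    dsimp only
    rw [mul_assoc]; refine mul_le_mul_right ?_ _
    by_cases h1 : ‖h‖ < 1
    · rw [ind_of_mem (show ‖h‖ ∈ Iio 1 from h1), mul_one, ← ofReal_mul (norm_nonneg _)]
      refine (ee_ball hn one_pos h).2 (1/2) (by norm_num) ?_
      have := norm_nonneg h
      nlinarith
    · rw [ind_of_not (show ¬ ‖h‖ ∈ Iio 1 from h1), mul_zero, zero_mul]; exact zero_le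
  · rw [PP_split hb, mul_add, ofReal_add (by positivity) (by positivity)]
    gcongr
    · rw [ofReal_mul (by positivity), ← near_int hn ht, mul_assoc, ← lintegral_mul_const _ mm]
      refine mul_le_mul_right (lintegral_mono fun h => ?_) _
      dsimp only
      rw [mul_assoc]; refine mul_le_mul_right ?_ _
      rw [mul_right_comm]; refine mul_le_mul_left ?_ _
      rw [← ofReal_mul (norm_nonneg _)]
      simpa using (ee_ball hn one_pos h).1
    · have h1 := tail_le hn (hδ.trans_le hδt) hb
      rw [vol_ball_om hn 0 one_pos, one_pow, mul_one, ← ofReal_mul (by positivity)] at h1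
      calc _ ≤ oR (1/δ) * (oR t * ∫⁻ h : X, oR (‖h‖ ^ (-((n:ℝ)+1+t))) * (ee (Bal (0:X) 1) h * ind (Ici 1) ‖h‖)) := by
            rw [← mul_assoc, ← ofReal_mul (by positivity)]
            gcongr
            rw [one_div_mul_eq_div, le_div_iff₀ hδ]; nlinarith
        _ ≤ _ := by
            refine (mul_le_mul_right h1 _).trans ?_
            rw [← ofReal_mul (by positivity)]
            apply le_of_eq; congr 1; ring

theorem lint_scale {f : X → ℝ≥0∞} (hf : Measurable f) {r : ℝ} (hr : 0 < r) :
    ∫⁻ x, f x = oR (r ^ frk X) * ∫⁻ x, f (r • x) := by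
  have h := Measure.map_addHaar_smul (volume : Measure X) hr.ne'
  have h2 : ∫⁻ x, f (r • x) = ∫⁻ x, f x ∂(Measure.map (r • ·) (volume : Measure X)) :=
    (lintegral_map hf (measurable_const_smul r)).symm
  rw [h2, h, lintegral_smul_measure, smul_eq_mul, ← mul_assoc, ← ofReal_mul (by positivity), abs_of_pos (by positivity), mul_inv_cancel₀ (by positivity), ofReal_one, one_mul]

noncomputable def WW (p : ℝ) (E : Set X) (x : ℝ) : ℝ≥0∞ := ∫⁻ h, ind (Iio x) ‖h‖ * (oR (‖h‖ ^ (-p)) * ee E h)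

theorem WW_meas {E : Set X} (hE : MeasurableSet E) (p x : ℝ) : Measurable fun h : X => ind (Iio x) ‖h‖ * (oR (‖h‖ ^ (-p)) * ee E h) :=
  ((ind_meas measurableSet_Iio).comp measurable_norm).mul (Measurable.mul (by fun_prop) (ee_meas hE))

theorem WW_half {n : ℕ} (hn : frk X = n + 1) {E : Set X} (hE : MeasurableSet E) (t x : ℝ) :
    WW (n+1+t) E x ≤ oR (2^(1-t)) * WW (n+1+t) E (x/2) := by
  unfold WW
  rw [lint_scale (WW_meas hE _ _) two_pos, hn, ← lintegral_const_mul _ (WW_meas hE _ _), ← lintegral_const_mul _ (by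
    exact (WW_meas hE _ _).comp (measurable_const_smul (2:ℝ)))]
  apply lintegral_mono; intro h
  dsimp only
  rw [norm_smul, Real.norm_of_nonneg zero_le_two]
  have i : ind (Iio x) (2 * ‖h‖) = ind (Iio (x/2)) ‖h‖ := by
    by_cases a : 2 * ‖h‖ < x
    · rw [ind_of_mem (show _ ∈ Iio x from a), ind_of_mem (show _ ∈ Iio (x/2) from by rw [mem_Iio]; linarith)]
    · rw [ind_of_not (show ¬ _ ∈ Iio x from a), ind_of_not (show ¬ _ ∈ Iio (x/2) from by rw [mem_Iio]; intro; apply a; linarith)]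
  have e2 : ee E ((2:ℝ) • h) ≤ 2 * ee E h := by rw [two_smul, two_mul]; exact ee_add hE h h
  rw [i]
  calc _ ≤ oR (2^(n+1)) * (ind (Iio (x/2)) ‖h‖ * (oR ((2 * ‖h‖) ^ (-((n:ℝ)+1+t))) * (oR 2 * ee E h))) := by
        gcongr; simpa using e2
    _ = (oR (2^(n+1)) * (oR ((2 * ‖h‖) ^ (-((n:ℝ)+1+t))) * oR 2)) * (ind (Iio (x/2)) ‖h‖ * ee E h) := by ring
    _ = (oR (2^(1-t)) * oR (‖h‖ ^ (-((n:ℝ)+1+t)))) * (ind (Iio (x/2)) ‖h‖ * ee E h) := by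
        congr 1
        rw [← ofReal_mul (by positivity), ← ofReal_mul (by positivity), ← ofReal_mul (by positivity)]
        congr 1
        rw [Real.mul_rpow zero_le_two (norm_nonneg _), ← Real.rpow_natCast]
        have : (2:ℝ)^((1:ℝ)-t) = 2 ^ (((n+1:ℕ):ℝ)) * 2 ^ (-((n:ℝ)+1+t)) * 2 := by
          rw [← Real.rpow_add two_pos, ← Real.rpow_add_one two_ne_zero]; congr 1; push_cast; ring
        rw [this]; ring
    _ = _ := by ring

theorem WW_split {E : Set X} (hE : MeasurableSet E) (p : ℝ) {x y : ℝ} (h : x ≤ y) :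
    WW p E y = WW p E x + ∫⁻ h, ind (Ico x y) ‖h‖ * (oR (‖h‖ ^ (-p)) * ee E h) := by
  unfold WW
  rw [← lintegral_add_left (WW_meas hE _ _)]
  congr 1; ext z; rw [← add_mul]; congr 1
  by_cases h1 : ‖z‖ < x
  · rw [ind_of_mem (show _ ∈ Iio x from h1), ind_of_mem (show _ ∈ Iio y from h1.trans_le h), ind_of_not (show ¬ _ ∈ Ico x y from fun a => absurd a.1 (not_le.2 h1)), add_zero]
  · rw [ind_of_not (show ¬ _ ∈ Iio x from h1), zero_add]
    by_cases h2 : ‖z‖ < y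
    · rw [ind_of_mem (show _ ∈ Iio y from h2), ind_of_mem (show _ ∈ Ico x y from ⟨not_lt.1 h1, h2⟩)]
    · rw [ind_of_not (show ¬ _ ∈ Iio y from h2), ind_of_not (show ¬ _ ∈ Ico x y from fun a => h2 a.2)]

theorem WW_le_PP (E : Set X) (p x : ℝ) : WW p E x ≤ PP p E :=
  lintegral_mono fun h => mul_le_of_le_one_left' (ind_le_one _ _)

theorem ring_le {n : ℕ} (hn : frk X = n + 1) {E : Set X} (hE : MeasurableSet E) {t : ℝ} (ht : t < 1) {x : ℝ} (hx : 0 < x)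
    (hf : PP (n+1+t) E ≠ ⊤) :
    ∫⁻ h, ind (Ico (x/2) x) ‖h‖ * (oR (‖h‖ ^ (-((n:ℝ)+1+t))) * ee E h) ≤ oR (1-t) * PP (n+1+t) E := by
  have h1 := WW_half hn hE t x
  have h2 := WW_split hE (n+1+t) (show x/2 ≤ x by linarith)
  have f1 := ne_top_of_le_ne_top hf (WW_le_PP E (n+1+t) x)
  have f2 := ne_top_of_le_ne_top hf (WW_le_PP E (n+1+t) (x/2))
  refine le_trans ?_ (mul_le_mul_right (WW_le_PP E (n+1+t) x) _)
  set r := ∫⁻ h, ind (Ico (x/2) x) ‖h‖ * (oR (‖h‖ ^ (-((n:ℝ)+1+t))) * ee E h)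
  have f3 : r ≠ ⊤ := ne_top_of_le_ne_top f1 (h2 ▸ le_add_self)
  lift WW (n+1+t) E x to NNReal using f1 with a
  lift WW (n+1+t) E (x/2) to NNReal using f2 with b
  lift r to NNReal using f3 with c
  rw [← ENNReal.coe_add, ENNReal.coe_inj] at h2
  have h1' : (a:ℝ) ≤ 2^(1-t) * b := by
    have := ENNReal.toReal_mono (by exact mul_ne_top ofReal_ne_top coe_ne_top) h1
    rwa [toReal_mul, toReal_ofReal (by positivity)] at this
  have h2' : (a:ℝ) = b + c := by rw [h2]; push_cast; rfl
  rw [← ENNReal.ofReal_coe_nnreal (p := c), ← ENNReal.ofReal_coe_nnreal (p := a), ← ofReal_mul (by linarith)]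
  apply ofReal_le_ofReal
  have h3 : 1 - (1-t) ≤ (2:ℝ)^(-(1-t)) := by
    rw [Real.rpow_def_of_pos two_pos]
    have := Real.add_one_le_exp (Real.log 2 * -(1-t))
    have l2 : Real.log 2 < 1 := Real.log_two_lt_d9.trans (by norm_num)
    nlinarith
  have h4 : (2:ℝ)^(-(1-t)) * 2^(1-t) = 1 := by rw [← Real.rpow_add two_pos]; simp
  have h5 : (2:ℝ)^(-(1-t)) * a ≤ b := by
    calc _ ≤ (2:ℝ)^(-(1-t)) * (2^(1-t) * b) := by gcongr
      _ = b := by rw [← mul_assoc, h4, one_mul]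
  nlinarith [a.2, show (0:ℝ) ≤ a from a.2]

theorem U1 [Nontrivial X] {n : ℕ} (hn : frk X = n + 1) {δ : ℝ} (hδ : 0 < δ) : ∃ C > (0:ℝ), ∀ (E : Set X), MeasurableSet E → 
    volume E = volume (Bal (0:X) 1) → ∀ s t : ℝ, 0 < s → t < 1 → δ ≤ t - s → PP (n+1+t) E ≠ ⊤ →
    oR s * PP (n+1+s) E ≤ oR C * (oR (1-t) * PP (n+1+t) E + 1) := by
  have o1 := om_pos (n+1)
  set q : ℝ := (1/2)^δ
  have q0 : 0 < q := by positivity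
  have q1 : q < 1 := Real.rpow_lt_one (by norm_num) (by norm_num) hδ
  have q2 : 0 < 1 - q := by linarith
  refine ⟨1/(1-q) + (n+1)*om (n+1) * om (n+1), by positivity, fun E hE hv s t hs ht hst hf => ?_⟩
  have h1 : ∫⁻ h, oR (‖h‖ ^ (-((n:ℝ)+1+s))) * (ee E h * ind (Iio 1) ‖h‖) ≤ oR (1/(1-q)) * (oR (1-t) * PP (n+1+t) E) := by
    have mj : ∀ j : ℕ, Measurable fun h : X => ind (Ico ((1/2)^j/2) ((1/2)^j)) ‖h‖ * (oR (‖h‖ ^ (-((n:ℝ)+1+t))) * ee E h) := fun j =>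
      ((ind_meas measurableSet_Ico).comp measurable_norm).mul (Measurable.mul (by fun_prop) (ee_meas hE))
    calc _ ≤ ∫⁻ h, ∑' j : ℕ, oR q ^ j * (ind (Ico ((1/2)^j/2) ((1/2)^j)) ‖h‖ * (oR (‖h‖ ^ (-((n:ℝ)+1+t))) * ee E h)) := by
          apply lintegral_mono_ae
          filter_upwards [ae_ne_zero (X := X)] with h hh
          have h0 := norm_pos_iff.2 hh
          by_cases a : ‖h‖ < 1
          · obtain ⟨j, j1, j2⟩ : ∃ j : ℕ, (1/2:ℝ)^j/2 ≤ ‖h‖ ∧ ‖h‖ < (1/2:ℝ)^j := by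
              obtain ⟨j, j1, j2⟩ := exists_nat_pow_near_of_lt_one h0 a.le (show (0:ℝ) < 1/2 by norm_num) (by norm_num)
              rw [pow_succ] at j1
              rcases eq_or_lt_of_le j2 with e | e
              · cases j with
                | zero => rw [pow_zero] at e; linarith
                | succ i => rw [pow_succ] at e; exact ⟨i, by linarith, by have : 0 < (1/2:ℝ)^i := by positivity
                                                                          linarith⟩
              · exact ⟨j, by linarith, e⟩
            refine le_trans ?_ (ENNReal.le_tsum j)
            rw [ind_of_mem (show ‖h‖ ∈ Iio (1:ℝ) from a), ind_of_mem (show ‖h‖ ∈ Ico ((1/2)^j/2) ((1/2)^j) from ⟨j1, j2⟩), one_mul, mul_one, ← mul_assoc]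
            refine mul_le_mul_left ?_ _
            rw [← ofReal_pow q0.le, ← ofReal_mul (by positivity)]
            apply ofReal_le_ofReal
            have e1 : ‖h‖ ^ (-((n:ℝ)+1+s)) = ‖h‖ ^ (t-s) * ‖h‖ ^ (-((n:ℝ)+1+t)) := by
              rw [← Real.rpow_add h0]; congr 1; ring
            rw [e1]
            gcongr
            calc ‖h‖ ^ (t-s) ≤ ‖h‖ ^ δ := Real.rpow_le_rpow_of_exponent_ge h0 a.le hst
              _ ≤ ((1/2)^j) ^ δ := by gcongr
              _ = q ^ j := by rw [← Real.rpow_natCast, ← Real.rpow_mul (by norm_num), mul_comm, Real.rpow_mul (by norm_num), Real.rpow_natCast]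
          · rw [ind_of_not (show ¬ ‖h‖ ∈ Iio (1:ℝ) from a), mul_zero, mul_zero]; exact zero_le
      _ = ∑' j : ℕ, oR q ^ j * ∫⁻ h, (ind (Ico ((1/2)^j/2) ((1/2)^j)) ‖h‖ * (oR (‖h‖ ^ (-((n:ℝ)+1+t))) * ee E h)) := by
          rw [lintegral_tsum fun j => ((mj j).const_mul _).aemeasurable]
          congr 1; ext j; rw [lintegral_const_mul _ (mj j)]
      _ ≤ ∑' j : ℕ, oR q ^ j * (oR (1-t) * PP (n+1+t) E) := by
          refine ENNReal.tsum_le_tsum fun j => mul_le_mul_right (ring_le hn hE ht (by positivity) hf) _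
      _ = _ := by
          rw [ENNReal.tsum_mul_right, ENNReal.tsum_geometric, one_div, ENNReal.ofReal_inv_of_pos q2, ENNReal.ofReal_sub _ q0.le, ofReal_one]
  have h2 := tail_le hn hs hE
  rw [hv, vol_ball_om hn 0 one_pos, one_pow, mul_one, ← ofReal_mul (by positivity)] at h2
  rw [PP_split hE, mul_add]
  calc _ ≤ 1 * (oR (1/(1-q)) * (oR (1-t) * PP (n+1+t) E)) + oR ((n+1)*om (n+1) * om (n+1)) * 1 := by
        rw [mul_one]
        exact add_le_add (mul_le_mul' (by rw [← ofReal_one]; apply ofReal_le_ofReal; linarith) h1) h2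
    _ ≤ oR (1/(1-q) + (n+1)*om (n+1) * om (n+1)) * (oR (1-t) * PP (n+1+t) E) + oR (1/(1-q) + (n+1)*om (n+1) * om (n+1)) * 1 := by
        rw [one_mul]
        gcongr
        · linarith [show 0 < (n+1)*om (n+1) * om (n+1) by positivity]
        · linarith [show 0 < 1/(1-q) by positivity]
    _ = _ := by rw [mul_add]

noncomputable def DP (p : ℝ) (E : Set X) : ℝ≥0∞ := ∫⁻ a in Ioi (0:ℝ), kap p a * df E a

theorem U3 [Nontrivial X] {n : ℕ} (hn : frk X = n + 1) {δ : ℝ} (hδ : 0 < δ) : ∃ C > (0:ℝ), ∃ ε₁ > (0:ℝ), ∀ (E : Set X), MeasurableSet E → 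
    volume E = volume (Bal (0:X) 1) → ∀ s t ε : ℝ, 0 < s → t < 1 → δ ≤ t - s → 0 < ε → ε ≤ ε₁ → PP (n+1+t) E ≠ ⊤ →
    oR (1-t) * DP (n+1+t) E ≤ oR (s * ε) * DP (n+1+s) E →
    oR (1-t) * DP (n+1+t) E ≤ oR (C * ε) := by
  obtain ⟨C1, C10, h1⟩ := U1 hn hδ
  set C2 := ((n+1)*om (n+1)) * om n + ((n+1)*om (n+1)) * om (n+1) / δ
  have o1 := om_pos n
  have o2 := om_pos (n+1)
  have C20 : 0 < C2 := by positivity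
  refine ⟨2*C1*(C2+1), by positivity, 1/(2*C1), by positivity, fun E hE hv s t ε hs ht hst hε hε1 hf H => ?_⟩
  have a1 := h1 E hE hv s t hs ht hst hf
  have a2 := (PB_bounds (X := X) hn hδ (show δ ≤ t by linarith) ht).2
  have n0 : (0:ℝ) ≤ n := Nat.cast_nonneg n
  have pt : (0:ℝ) < n+1+t := by linarith
  have ps : (0:ℝ) < n+1+s := by linarith
  have et := PP_add hE hv pt
  have es := PP_add hE hv ps
  change _ = _ + DP (n+1+t) E at et
  change _ = _ + DP (n+1+s) E at es
  have f1 : DP (n+1+t) E ≠ ⊤ := ne_top_of_le_ne_top hf (et ▸ le_add_self)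
  have f2 : oR (1-t) * DP (n+1+t) E ≠ ⊤ := mul_ne_top ofReal_ne_top f1
  have a3 : oR (1-t) * DP (n+1+t) E ≤ oR ε * (oR C1 * (oR C2 + oR (1-t) * DP (n+1+t) E + 1)) := by
    refine H.trans ?_
    rw [mul_comm s, ofReal_mul hε.le, mul_assoc]
    refine mul_le_mul_right ?_ _
    refine (mul_le_mul_right (es ▸ le_add_self : DP (n+1+s) E ≤ PP (n+1+s) E) _).trans (a1.trans ?_)
    rw [et, mul_add (oR (1-t))]
    exact mul_le_mul_right (add_le_add (add_le_add a2 le_rfl) le_rfl) _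
  lift oR (1-t) * DP (n+1+t) E to NNReal using f2 with y
  rw [← ENNReal.ofReal_coe_nnreal (p := y)] at a3 ⊢
  rw [← ofReal_add C20.le y.coe_nonneg, ← ofReal_one, ← ofReal_add (by positivity) zero_le_one, ← ofReal_mul C10.le, ← ofReal_mul hε.le, ofReal_le_ofReal_iff (by positivity)] at a3
  apply ofReal_le_ofReal
  rw [le_div_iff₀ (by positivity)] at hε1
  have y0 : (0:ℝ) ≤ y := y.2
  nlinarith [mul_le_mul_of_nonneg_right hε1 y0]

theorem JJ_WW (E : Set X) (x : ℝ) : JJ E x = WW 0 E x := by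
  unfold JJ WW; simp

theorem ee_ball_far (h : X) (hh : 2 ≤ ‖h‖) : ee (Bal (0:X) 1) h = volume (Bal (0:X) 1) := by
  rw [vol_ind measurableSet_ball]
  unfold ee; congr 1; ext x
  by_cases a : x ∈ Bal (0:X) 1
  · rw [ind_of_mem a, ind_of_mem (show x + h ∈ (Bal (0:X) 1)ᶜ from ?_), one_mul]
    intro b
    rw [mem_ball_zero_iff] at a b
    have := norm_sub_le (x+h) x
    rw [add_sub_cancel_left] at this; linarith
  · rw [ind_of_not a, zero_mul]

theorem df_anti [Nontrivial X] {E : Set X} (hE : MeasurableSet E) (hv : volume E = volume (Bal (0:X) 1)) {a b : ℝ} (ha : 2 ≤ a) (hab : a ≤ b) :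
    df E b ≤ df E a := by
  have h1 := df_add hE hv a
  unfold df at h1 ⊢
  rw [tsub_le_iff_right]
  have hb : MeasurableSet (Bal (0:X) 1) := measurableSet_ball
  rw [JJ_WW E b, JJ_WW _ b, WW_split hE 0 hab, WW_split hb 0 hab, ← JJ_WW, ← JJ_WW, ← add_assoc, add_comm (_ - _), ← h1]
  refine add_le_add le_rfl (lintegral_mono fun h => ?_)
  dsimp only
  by_cases c : ‖h‖ ∈ Ico a b
  · rw [ee_ball_far h (ha.trans c.1), ← hv]; gcongr; exact ee_le hE h
  · rw [ind_of_not c, zero_mul, zero_mul]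

theorem good [Nontrivial X] {n : ℕ} {E : Set X} (hE : MeasurableSet E) (hv : volume E = volume (Bal (0:X) 1))
    {s t ε : ℝ} (hs : 0 < s) (hst : s < t) (ht : t < 1) (hε : 0 < ε) (h4 : 4 * ε ≤ 1 - t) (hf : DP (n+1+t) E ≠ ⊤)
    (H : oR (1-t) * DP (n+1+t) E ≤ oR (s * ε) * DP (n+1+s) E) (p : ℝ) :
    ∫⁻ a in Ioc (0:ℝ) 2, kap p a * df E a = 0 := by
  have n0 : (0:ℝ) ≤ n := Nat.cast_nonneg n
  have pt : (0:ℝ) < n+1+t := by linarith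
  have ps : (0:ℝ) < n+1+s := by linarith
  have t1 : 0 < 1 - t := by linarith
  set U : ℝ → ℝ := fun a => (1-t) * ((n+1+t) * a ^ (-((n:ℝ)+1+t)-1))
  set V : ℝ → ℝ := fun a => (s*ε) * ((n+1+s) * a ^ (-((n:ℝ)+1+s)-1))
  set u : ℝ → ℝ≥0∞ := fun a => oR (U a)
  set v : ℝ → ℝ≥0∞ := fun a => oR (V a)
  have hu : ∀ a, u a = oR (1-t) * kap (n+1+t) a := fun a => by rw [kap, ← ofReal_mul t1.le]
  have hv' : ∀ a, v a = oR (s*ε) * kap (n+1+s) a := fun a => by rw [kap, ← ofReal_mul (by positivity)]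
  have um : Measurable u := by rw [show u = _ from funext hu]; exact (kap_meas _).const_mul _
  have vm : Measurable v := by rw [show v = _ from funext hv']; exact (kap_meas _).const_mul _
  have dm := df_meas E
  have kd : ∀ p, Measurable fun a => kap p a * df E a := fun p => (kap_meas p).mul dm
  have ud : Measurable fun a => u a * df E a := um.mul dm
  have vd : Measurable fun a => v a * df E a := vm.mul dm
  set c : ℝ := s * ε * (n+1+s) / ((1-t) * (n+1+t))
  have c0 : 0 < c := by positivity
  have hVU : ∀ a, 0 < a → V a = c * a^(t-s) * U a := by
    intro a ha
    have : a ^ (-((n:ℝ)+1+s)-1) = a^(t-s) * a ^ (-((n:ℝ)+1+t)-1) := by rw [← Real.rpow_add ha]; congr 1; ring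
    simp only [U, V, c]; rw [this]; field_simp
  have U0 : ∀ a, 0 < a → 0 ≤ U a := fun a ha => by positivity
  have c2 : c * 2^(t-s) ≤ 1/2 := by
    have h2 : (2:ℝ)^(t-s) ≤ 2 := by
      calc (2:ℝ)^(t-s) ≤ 2^(1:ℝ) := Real.rpow_le_rpow_of_exponent_le one_le_two (by linarith)
        _ = 2 := Real.rpow_one _
    have : c ≤ 1/4 := by
      rw [div_le_iff₀ (by positivity)]
      have : s * (ε * (n+1+s)) ≤ 1 * (ε * (n+1+t)) := by gcongr; linarith
      nlinarith
    nlinarith [Real.rpow_pos_of_pos two_pos (t-s)]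
  have key : ∫⁻ a in Ioi (2:ℝ), v a * df E a ≤ ∫⁻ a in Ioi (2:ℝ), u a * df E a := by
    set as : ℝ := (1/c)^(1/(t-s))
    have as0 : 0 < as := by positivity
    have hts : 0 < t - s := by linarith
    have as1 : c * as^(t-s) = 1 := by
      rw [← Real.rpow_mul (by positivity), one_div_mul_cancel hts.ne', Real.rpow_one]; field_simp
    have as2 : 2 ≤ as := by
      by_contra hh; push Not at hh
      have : c * as^(t-s) ≤ c * 2^(t-s) := by gcongr
      linarith
    have iu : ∫⁻ a in Ioi (2:ℝ), u a = oR (1-t) * oR (2 ^ (-((n:ℝ)+1+t))) := by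
      simp_rw [hu]; rw [lintegral_const_mul _ (kap_meas _), kap_tail pt two_pos]
    have iv : ∫⁻ a in Ioi (2:ℝ), v a = oR (s*ε) * oR (2 ^ (-((n:ℝ)+1+s))) := by
      simp_rw [hv']; rw [lintegral_const_mul _ (kap_meas _), kap_tail ps two_pos]
    have ivu : ∫⁻ a in Ioi (2:ℝ), v a ≤ ∫⁻ a in Ioi (2:ℝ), u a := by
      rw [iu, iv, ← ofReal_mul (by positivity), ← ofReal_mul (by positivity)]
      apply ofReal_le_ofReal
      have h2 : (2:ℝ)^(t-s) ≤ 2 := by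
        calc (2:ℝ)^(t-s) ≤ 2^(1:ℝ) := Real.rpow_le_rpow_of_exponent_le one_le_two (by linarith)
          _ = 2 := Real.rpow_one _
      have : (2:ℝ) ^ (-((n:ℝ)+1+s)) = 2^(t-s) * 2 ^ (-((n:ℝ)+1+t)) := by rw [← Real.rpow_add two_pos]; congr 1; ring
      rw [this, ← mul_assoc]; gcongr
      have : s * ε ≤ 1 * ε := by gcongr; linarith
      nlinarith [Real.rpow_pos_of_pos two_pos (t-s)]
    have d1 : df E as ≠ ⊤ := ne_top_of_le_ne_top (JJ_lt_top hE (by rw [hv]; exact (vol_ball_lt_top _ _).ne) as) tsub_le_self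
    have pw : ∫⁻ a in Ioi (2:ℝ), (v a * df E a + u a * df E as) ≤ ∫⁻ a in Ioi (2:ℝ), (u a * df E a + v a * df E as) := by
      apply setLIntegral_mono' measurableSet_Ioi
      intro a (ha : 2 < a)
      have a0 : 0 < a := by linarith
      rcases le_total a as with h | h
      · have e1 : v a ≤ u a := by
          apply ofReal_le_ofReal; rw [hVU a a0]
          apply mul_le_of_le_one_left (U0 a a0)
          rw [← as1]; gcongr
        have e2 := df_anti hE hv ha.le h
        obtain ⟨x, hx⟩ := exists_add_of_le e1
        obtain ⟨y, hy⟩ := exists_add_of_le e2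
        rw [hx, hy]
        calc _ ≤ v a * (df E as + y) + (v a + x) * df E as + x * y := le_self_add
          _ = _ := by ring
      · have e1 : u a ≤ v a := by
          apply ofReal_le_ofReal; rw [hVU a a0]
          apply le_mul_of_one_le_left (U0 a a0)
          rw [← as1]; gcongr
        have e2 := df_anti hE hv as2 h
        obtain ⟨x, hx⟩ := exists_add_of_le e1
        obtain ⟨y, hy⟩ := exists_add_of_le e2
        rw [hx, hy]
        calc _ ≤ (u a + x) * df E a + u a * (df E a + y) + x * y := le_self_add
          _ = _ := by ring
    rw [lintegral_add_left vd, lintegral_add_left ud, lintegral_mul_const _ um, lintegral_mul_const _ vm] at pw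
    have fin : (∫⁻ a in Ioi (2:ℝ), u a) * df E as ≠ ⊤ := by rw [iu]; exact mul_ne_top (mul_ne_top ofReal_ne_top ofReal_ne_top) d1
    exact (ENNReal.add_le_add_iff_right fin).1 (pw.trans (add_le_add le_rfl (mul_le_mul_left ivu _)))
  have spl : ∀ f : ℝ → ℝ≥0∞, ∫⁻ a in Ioi (0:ℝ), f a = (∫⁻ a in Ioc (0:ℝ) 2, f a) + ∫⁻ a in Ioi (2:ℝ), f a := by
    intro f
    rw [← lintegral_union measurableSet_Ioi (Ioc_disjoint_Ioi le_rfl), Ioc_union_Ioi_eq_Ioi zero_le_two]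
  have Hu : oR (1-t) * DP (n+1+t) E = ∫⁻ a in Ioi (0:ℝ), u a * df E a := by
    unfold DP; rw [← lintegral_const_mul _ (kd _)]; simp_rw [hu, mul_assoc]
  have Hv : oR (s*ε) * DP (n+1+s) E = ∫⁻ a in Ioi (0:ℝ), v a * df E a := by
    unfold DP; rw [← lintegral_const_mul _ (kd _)]; simp_rw [hv', mul_assoc]
  have fu : ∫⁻ a in Ioi (0:ℝ), u a * df E a ≠ ⊤ := Hu ▸ mul_ne_top ofReal_ne_top hf
  rw [Hu, Hv] at H
  have fu' := fu
  rw [spl] at H fu'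
  rw [spl (fun a => v a * df E a)] at H
  have H2 := (ENNReal.add_le_add_iff_right (add_ne_top.1 fu').2).1 (H.trans (add_le_add le_rfl key))
  have H3 : ∫⁻ a in Ioc (0:ℝ) 2, v a * df E a ≤ oR (1/2) * ∫⁻ a in Ioc (0:ℝ) 2, u a * df E a := by
    rw [← lintegral_const_mul _ ud]
    apply setLIntegral_mono' measurableSet_Ioc
    intro a ⟨a0, a2⟩
    rw [← mul_assoc]; refine mul_le_mul_left ?_ _
    simp only [u, v]; rw [← ofReal_mul (by norm_num), hVU a a0]
    apply ofReal_le_ofReal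
    have : c * a^(t-s) ≤ c * 2^(t-s) := by gcongr
    exact mul_le_mul_of_nonneg_right (this.trans c2) (U0 a a0)
  have H4 : ∫⁻ a in Ioc (0:ℝ) 2, u a * df E a = 0 := by
    have f := (add_ne_top.1 fu').1
    have h := H2.trans H3
    lift ∫⁻ a in Ioc (0:ℝ) 2, u a * df E a to NNReal using f with y
    rw [← ENNReal.ofReal_coe_nnreal (p := y), ← ofReal_mul (by norm_num), ofReal_le_ofReal_iff (by positivity)] at h
    have : (y:ℝ) = 0 := by have := y.2; linarith [show (0:ℝ) ≤ y from y.2]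
    rw [ENNReal.coe_eq_zero]; exact_mod_cast this
  rw [lintegral_eq_zero_iff ud] at H4
  rw [lintegral_eq_zero_iff (kd p)]
  filter_upwards [H4, ae_restrict_mem measurableSet_Ioc] with a ha ha2
  have : 0 < U a := by have := ha2.1; positivity
  rcases mul_eq_zero.1 ha with h | h
  · exact absurd (ofReal_eq_zero.1 h) (not_le.2 this)
  · show kap p a * df E a = 0
    rw [h, mul_zero]

theorem psq_deriv (u : ℝ) : HasDerivAt (fun u : ℝ => (max u 0)^2) (2 * max u 0) u := by
  rcases lt_trichotomy u 0 with h | h | h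
  · rw [max_eq_right h.le, mul_zero]
    refine (hasDerivAt_const u (0:ℝ)).congr_of_eventuallyEq ?_
    filter_upwards [gt_mem_nhds h] with v hv
    rw [max_eq_right (le_of_lt hv)]; simp
  · subst h
    have : (fun u : ℝ => (max u 0)^2) =O[𝓝 0] fun x => ‖x - 0‖^2 := by
      apply Asymptotics.IsBigO.of_bound 1
      filter_upwards with v
      rw [sub_zero, norm_pow, norm_pow, norm_norm, one_mul]
      gcongr
      rw [Real.norm_of_nonneg (le_max_right _ _), Real.norm_eq_abs]
      exact max_le (le_abs_self v) (abs_nonneg v)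
    have h2 := (this.hasFDerivAt (𝕜 := ℝ) (by norm_num)).hasDerivAt
    simpa using h2
  · rw [max_eq_left h.le]
    have : HasDerivAt (fun u : ℝ => u^2) (2*u) u := by simpa using hasDerivAt_pow 2 u
    refine this.congr_of_eventuallyEq ?_
    filter_upwards [lt_mem_nhds h] with v hv
    rw [max_eq_left (le_of_lt hv)]

noncomputable def psi (l : ℝ) (y : X) : ℝ := (max (l^2 - ‖y‖^2) 0)^2

theorem psi_contDiff (l : ℝ) : ContDiff ℝ 1 (psi l : X → ℝ) := by
  have h := cd1 psq_deriv (by fun_prop)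
  exact h.comp (contDiff_const.sub (contDiff_norm_sq ℝ))

theorem psi_nonneg (l : ℝ) (y : X) : 0 ≤ psi l y := sq_nonneg _

theorem psi_supp {l : ℝ} (hl : 0 < l) {y : X} (hy : l ≤ ‖y‖) : psi l y = 0 := by
  unfold psi; rw [max_eq_right (by nlinarith [norm_nonneg y])]; simp

theorem psi_cs {l : ℝ} (hl : 0 < l) : HasCompactSupport (psi l : X → ℝ) := by
  refine HasCompactSupport.intro (isCompact_closedBall (0:X) l) fun x hx => psi_supp hl ?_
  rw [mem_closedBall_zero_iff] at hx; exact (not_le.1 hx).le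

theorem psi_fderiv (l : ℝ) (y z : X) : fdv (psi l) y z = -(4 * max (l^2 - ‖y‖^2) 0 * inn y z) := by
  have h1 : HasFDerivAt (fun y : X => l^2 - ‖y‖^2) (-(2 • innerSL ℝ y)) y := by
    simpa using (hasStrictFDerivAt_norm_sq y).hasFDerivAt.const_sub (l^2)
  have h2 := (psq_deriv (l^2 - ‖y‖^2)).comp_hasFDerivAt y h1
  have h3 : fdv (psi l) y = (2 * max (l^2 - ‖y‖^2) 0) • -(2 • innerSL ℝ y) := h2.fderiv
  rw [h3]; simp; ring

noncomputable def I0 (X : Type*) [NormedAddCommGroup X] [InnerProductSpace ℝ X] [FiniteDimensional ℝ X] [MeasurableSpace X] [BorelSpace X] : ℝ := ∫ y : X, psi 1 y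

theorem I0_pos : 0 < I0 X := by
  refine (psi_contDiff 1).continuous.integral_pos_of_hasCompactSupport_nonneg_nonzero (psi_cs one_pos) (psi_nonneg 1) (x := (0:X)) ?_
  simp [psi]

theorem psi_int {n : ℕ} (hn : frk X = n + 1) {l : ℝ} (hl : 0 < l) : ∫ y : X, psi l y = l^(n+5) * I0 X := by
  have h1 : ∀ y : X, psi l y = l^4 * psi 1 (l⁻¹ • y) := by
    intro y; unfold psi
    rw [norm_smul, norm_inv, Real.norm_of_nonneg hl.le]
    have : l^2 - ‖y‖^2 = l^2 * (1^2 - (l⁻¹ * ‖y‖)^2) := by field_simp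
    rw [this, show (0:ℝ) = l^2 * 0 by ring, ← mul_max_of_nonneg _ _ (sq_nonneg l), mul_zero]; ring
  simp_rw [h1]
  rw [integral_const_mul, Measure.integral_comp_smul volume (fun y : X => psi 1 y), hn, I0, smul_eq_mul, inv_pow, inv_inv, abs_of_pos (by positivity)]
  ring

noncomputable def phi (l : ℝ) (y : X) : ℝ := (l^(frk X + 4) * I0 X)⁻¹ * psi l y

theorem phi_contDiff (l : ℝ) : ContDiff ℝ 1 (phi l : X → ℝ) := contDiff_const.mul (psi_contDiff l)

theorem phi_cs {l : ℝ} (hl : 0 < l) : HasCompactSupport (phi l : X → ℝ) := (psi_cs hl).mul_left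

theorem phi_nonneg {l : ℝ} (hl : 0 < l) (y : X) : 0 ≤ phi l y := mul_nonneg (inv_nonneg.2 (mul_nonneg (by positivity) I0_pos.le)) (psi_nonneg l y)

theorem phi_int {n : ℕ} (hn : frk X = n + 1) {l : ℝ} (hl : 0 < l) : ∫ y : X, phi l y = 1 := by
  unfold phi
  rw [integral_const_mul, psi_int hn hl, hn]
  have := I0_pos (X := X)
  field_simp

theorem phi_fderiv {n : ℕ} (hn : frk X = n + 1) (l : ℝ) (y z : X) : fdv (phi l) y z = -((l^(n+5) * I0 X)⁻¹ * (4 * max (l^2 - ‖y‖^2) 0 * inn z y)) := by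
  have h := ((psi_contDiff (X := X) l).differentiable one_ne_zero y).hasFDerivAt.const_mul ((l^(frk X + 4) * I0 X)⁻¹)
  have h3 : fdv (phi l) y = _ := h.fderiv
  rw [h3, hn, real_inner_comm]; simp only [ContinuousLinearMap.smul_apply, smul_eq_mul, psi_fderiv]; ring

noncomputable def KK (X : Type*) [NormedAddCommGroup X] [InnerProductSpace ℝ X] [FiniteDimensional ℝ X] [MeasurableSpace X] [BorelSpace X] (n : ℕ) (l r : ℝ) : ℝ :=
  2 * (l^(n+5) * I0 X)⁻¹ * (2 * om n / (n+2)) * r * √(l^2 - (r/2)^2)^(n+2) / r^n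

theorem KK_nonneg {n : ℕ} {l r : ℝ} (hl : 0 < l) (hr : 0 ≤ r) : 0 ≤ KK X n l r := by
  have := I0_pos (X := X)
  have := om_pos n
  unfold KK; positivity

theorem KK_meas (n : ℕ) (l : ℝ) : Measurable (KK X n l) := by unfold KK; fun_prop

theorem lint_even {f : ℝ → ℝ≥0∞} (hf : Measurable f) (he : ∀ x, f (-x) = f x) : ∫⁻ x, f x = 2 * ∫⁻ x in Ioi (0:ℝ), f x := by
  have h1 : ∫⁻ x, f x = (∫⁻ x in Ioi (0:ℝ), f x) + ∫⁻ x in Iic (0:ℝ), f x := by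
    rw [← lintegral_add_compl f measurableSet_Ioi, compl_Ioi]
  have h2 : ∫⁻ x in Iic (0:ℝ), f x = ∫⁻ x in Ioi (0:ℝ), f x := by
    rw [restrict_Iio_eq_restrict_Iic.symm, ← lintegral_indicator measurableSet_Iio, ← lintegral_indicator measurableSet_Ioi, ← lintegral_neg_eq_self]
    congr 1; ext x
    by_cases h : 0 < x
    · rw [indicator_of_mem (show -x ∈ Iio 0 by simpa using h), indicator_of_mem (show x ∈ Ioi 0 from h), he]
    · rw [indicator_of_notMem (show -x ∉ Iio 0 by simpa using h), indicator_of_notMem (show x ∉ Ioi 0 from h)]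
  rw [h1, h2, two_mul]

theorem slice_K {n : ℕ} (hn : frk X = n + 1) {l : ℝ} (hl : 0 < l) {z : X} (hz : ‖z‖ = 1)
    {g : X → ℝ≥0∞} (hg : Measurable g) (ge : ∀ h, g (-h) = g h) :
    ∫⁻ y, oR |fdv (phi l) y z| * g ((2 * inn z y) • z) = ∫⁻ r in Ioi (0:ℝ), oR (r^n) * (oR (KK X n l r) * g (r • z)) := by
  have i0 := I0_pos (X := X)
  have o0 := om_pos n
  set c := (l^(n+5) * I0 X)⁻¹ with hc
  have c0 : 0 < c := by positivity
  have mg : Measurable fun y : X => oR |fdv (phi l) y z| * g ((2 * inn z y) • z) := by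
    refine Measurable.mul ?_ (hg.comp (by fun_prop))
    have := ((phi_contDiff (X := X) l).continuous_fderiv one_ne_zero)
    have c1 : Continuous fun y : X => fdv (phi l) y z := this.clm_apply continuous_const
    exact (c1.abs.measurable).ennreal_ofReal
  rw [lint_sl hz mg]
  have e1 : ∀ τ : ℝ, ∫⁻ y : (ℝ ∙ z)ᗮ, oR |fdv (phi l) (sl z (τ, y)) z| * g ((2 * inn z (sl z (τ, y))) • z) =
      oR (4 * c * |τ| * (2 * om n / (n+2) * √(l^2 - τ^2)^(n+2))) * g ((2 * τ) • z) := by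
    intro τ
    have a : ∀ y : (ℝ ∙ z)ᗮ, oR |fdv (phi l) (sl z (τ, y)) z| * g ((2 * inn z (sl z (τ, y))) • z) =
        oR (√(l^2 - τ^2)^2 - ‖y‖^2) * (oR (4 * c * |τ|) * g ((2 * τ) • z)) := by
      intro y
      rw [sl_inner hz, ← mul_assoc, phi_fderiv hn, sl_inner hz, ← hc]
      congr 1
      show oR |-(c * (4 * max (l^2 - ‖τ • z + (y:X)‖^2) 0 * τ))| = _
      rw [slice_norm hz, abs_neg, abs_mul, abs_mul, abs_mul, abs_of_pos c0, abs_of_nonneg (le_max_right _ (0:ℝ)), abs_of_nonneg (show (0:ℝ) ≤ 4 by norm_num), show c * (4 * max (l ^ 2 - (τ ^ 2 + ‖y‖ ^ 2)) 0 * |τ|) = max (l ^ 2 - (τ ^ 2 + ‖y‖ ^ 2)) 0 * (4 * c * |τ|) by ring, ofReal_mul (le_max_right _ _)]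
      congr 1
      rcases le_total (l^2 - τ^2) 0 with h | h
      · rw [Real.sqrt_eq_zero_of_nonpos h, max_eq_right (by nlinarith [sq_nonneg ‖y‖]), ofReal_zero, ofReal_of_nonpos (by nlinarith [sq_nonneg ‖y‖])]
      · rw [Real.sq_sqrt h, show l ^ 2 - (τ ^ 2 + ‖y‖ ^ 2) = l ^ 2 - τ ^ 2 - ‖y‖ ^ 2 by ring]
        rcases le_total (l ^ 2 - τ ^ 2 - ‖y‖ ^ 2) 0 with h | h
        · rw [max_eq_right h, ofReal_zero, ofReal_of_nonpos h]
        · rw [max_eq_left h]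
    simp_rw [a]
    rw [lintegral_mul_const _ (by fun_prop), y_sq (yo_finrank hz hn) (Real.sqrt_nonneg _), ← mul_assoc, ← ofReal_mul (by positivity)]
    congr 2; ring
  simp_rw [e1]
  have m2 : Measurable fun τ : ℝ => oR (4 * c * |τ| * (2 * om n / (n+2) * √(l^2 - τ^2)^(n+2))) * g ((2 * τ) • z) :=
    Measurable.mul (by fun_prop) (hg.comp (by fun_prop))
  rw [lint_even m2 (fun x => by
    have : (2 * -x) • z = -((2 * x) • z) := by rw [← neg_smul]; congr 1; ring
    rw [this, ge, abs_neg, neg_sq]), ← lintegral_indicator measurableSet_Ioi,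
    lint_scale (m2.indicator measurableSet_Ioi) (show (0:ℝ) < 1/2 by norm_num), ← mul_assoc]
  have : (2:ℝ≥0∞) * oR ((1/2)^frk ℝ) = 1 := by
    rw [Module.finrank_self, pow_one, ← ofReal_ofNat, ← ofReal_mul (by norm_num)]; norm_num
  rw [this, one_mul, ← lintegral_indicator measurableSet_Ioi]
  congr 1; ext r
  by_cases h : 0 < r
  · rw [indicator_of_mem (show (1/2:ℝ) • r ∈ Ioi 0 by rw [smul_eq_mul, mem_Ioi]; positivity), indicator_of_mem (show r ∈ Ioi 0 from h), ← mul_assoc (oR (r^n)), ← ofReal_mul (by positivity)]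
    rw [smul_eq_mul, show 2 * (1/2*r) = r by ring, abs_of_pos (show 0 < 1/2*r by positivity), show (1/2*r)^2 = (r/2)^2 by ring]
    congr 2
    unfold KK; rw [← hc]; field_simp; norm_num
  · rw [indicator_of_notMem (show (1/2:ℝ) • r ∉ Ioi 0 by rw [smul_eq_mul, mem_Ioi]; linarith), indicator_of_notMem (show r ∉ Ioi 0 from h)]

theorem sphere_K [Nontrivial X] {n : ℕ} (hn : frk X = n + 1) {l : ℝ} (hl : 0 < l) 
    {g : X → ℝ≥0∞} (hg : Measurable g) (ge : ∀ h, g (-h) = g h) :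
    ∫⁻ z : Metric.sphere (0:X) 1, (∫⁻ y : X, oR |fdv (phi l) y (z:X)| * g ((2 * inn (z:X) y) • (z:X))) ∂(volume : Measure X).toSphere = ∫⁻ h, oR (KK X n l ‖h‖) * g h := by
  rw [lint_polar hn (f := fun h => oR (KK X n l ‖h‖) * g h) (((KK_meas n l).comp measurable_norm).ennreal_ofReal.mul hg)]
  congr 1; ext z
  have hz : ‖(z:X)‖ = 1 := by simpa using z.2
  rw [slice_K hn hl hz hg ge]
  apply setLIntegral_congr_fun measurableSet_Ioi
  intro r (hr : 0 < r)
  dsimp only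
  rw [norm_smul, hz, mul_one, Real.norm_of_nonneg hr.le]

theorem sphere_clm [Nontrivial X] {n : ℕ} (hn : frk X = n + 1) (L : X →L[ℝ] ℝ) :
    ∫⁻ z : Metric.sphere (0:X) 1, oR |L z| ∂(volume : Measure X).toSphere = oR (2 * om n * ‖L‖) := by
  have o0 := om_pos n
  have h1 := ball_clm hn L (r := 1) zero_le_one
  rw [lint_polar hn (f := fun h => oR |L h| * ind (Bal (0:X) 1) h) (Measurable.mul (by fun_prop) (ind_meas measurableSet_ball))] at h1
  have h2 : ∀ z : Metric.sphere (0:X) 1, ∫⁻ r in Ioi (0:ℝ), oR (r^n) * (oR |L (r • (z:X))| * ind (Bal (0:X) 1) (r • (z:X))) = oR |L z| * oR (1/(n+2)) := by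
    intro z
    have hz : ‖(z:X)‖ = 1 := by simpa using z.2
    have h3 := lint_pow (n+1) (x := 1) zero_le_one
    calc _ = ∫⁻ r in Ioi (0:ℝ), oR |L z| * (oR (r^(n+1)) * ind (Iio 1) r) := by
          apply setLIntegral_congr_fun measurableSet_Ioi
          intro r (hr : 0 < r)
          dsimp only
          rw [ind_ball, norm_smul, hz, mul_one, Real.norm_of_nonneg hr.le, map_smul, smul_eq_mul, abs_mul, abs_of_pos hr, ← mul_assoc, ← mul_assoc, ← ofReal_mul (by positivity), ← ofReal_mul (by positivity)]
          congr 2; ring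
      _ = _ := by
          have mm : Measurable fun r : ℝ => oR (r^(n+1)) * ind (Iio 1) r := Measurable.mul (by fun_prop) (ind_meas measurableSet_Iio)
          rw [lintegral_const_mul _ mm, h3]
          congr 2; push_cast; rw [one_pow]; congr 1; ring
  simp_rw [h2] at h1
  have mz : Measurable fun z : Metric.sphere (0:X) 1 => oR |L z| := by fun_prop
  rw [lintegral_mul_const _ mz, one_pow] at h1
  have h4 : oR (1/((n:ℝ)+2)) ≠ 0 := by rw [Ne, ofReal_eq_zero, not_le]; positivity
  refine (ENNReal.mul_left_inj h4 ofReal_ne_top).1 (h1.trans ?_)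
  rw [← ofReal_mul (by positivity)]; congr 1; ring

noncomputable def iE (E : Set X) (x : X) : ℝ := E.indicator (fun _ => (1:ℝ)) x

noncomputable def wl (E : Set X) (l : ℝ) (x : X) : ℝ := ∫ y, phi l y * iE E (x - y)

theorem iE_meas {E : Set X} (hE : MeasurableSet E) : Measurable (iE E) := measurable_const.indicator hE

theorem iE_01 (E : Set X) (x : X) : 0 ≤ iE E x ∧ iE E x ≤ 1 := by
  by_cases h : x ∈ E <;> simp [iE, h]

theorem iE_int {E : Set X} (hE : MeasurableSet E) (hv : volume E ≠ ⊤) : Integrable (iE E) :=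
  (integrable_indicator_iff hE).2 (integrableOn_const hv)

theorem phi_intg {l : ℝ} (hl : 0 < l) : Integrable (phi l : X → ℝ) := (phi_contDiff l).continuous.integrable_of_hasCompactSupport (phi_cs hl)

theorem wl_conv (E : Set X) (l : ℝ) : wl E l = convolution (phi l) (iE E) (ContinuousLinearMap.mul ℝ ℝ) volume := rfl

theorem wl_contDiff {E : Set X} (hE : MeasurableSet E) (hv : volume E ≠ ⊤) {l : ℝ} (hl : 0 < l) : ContDiff ℝ 1 (wl E l) := by
  rw [wl_conv]
  exact (phi_cs hl).contDiff_convolution_left _ (phi_contDiff l) (iE_int hE hv).locallyIntegrable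

theorem dphi_intg {l : ℝ} (hl : 0 < l) (z : X) : Integrable (fun y : X => fdv (phi l) y z) := by
  have c1 : Continuous fun y : X => fdv (phi l) y z := ((phi_contDiff (X := X) l).continuous_fderiv one_ne_zero).clm_apply continuous_const
  exact c1.integrable_of_hasCompactSupport ((phi_cs hl).fderiv_apply (𝕜 := ℝ) z)

theorem mul_iE {E : Set X} (hE : MeasurableSet E) {f : X → ℝ} (hf : Integrable f) {T : X → X} (hT : Measurable T) : Integrable (fun y => f y * iE E (T y)) := by
  refine hf.mul_bdd (c := 1) ((iE_meas hE).comp hT).aestronglyMeasurable (ae_of_all _ fun y => ?_)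
  rw [Real.norm_of_nonneg (iE_01 E _).1]; exact (iE_01 E _).2

theorem wl_deriv {E : Set X} (hE : MeasurableSet E) (hv : volume E ≠ ⊤) {l : ℝ} (hl : 0 < l) (x z : X) :
    fdv (wl E l) x z = ∫ y, fdv (phi l) y z * iE E (x - y) := by
  have cs : HasCompactSupport (fdv (phi l : X → ℝ)) := (phi_cs hl).fderiv (𝕜 := ℝ)
  have ci : ConvolutionExists (fdv (phi l)) (iE E) ((ContinuousLinearMap.mul ℝ ℝ).precompL X) volume :=
    cs.convolutionExists_left _ ((phi_contDiff l).continuous_fderiv one_ne_zero) (iE_int hE hv).locallyIntegrable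
  rw [wl_conv, ((phi_cs hl).hasFDerivAt_convolution_left (ContinuousLinearMap.mul ℝ ℝ) (phi_contDiff l) (iE_int hE hv).locallyIntegrable x).fderiv, convolution]
  rw [ContinuousLinearMap.integral_apply]
  · rfl
  · exact ci x

theorem wl_01 {n : ℕ} (hn : frk X = n + 1) {E : Set X} (hE : MeasurableSet E) {l : ℝ} (hl : 0 < l) (x : X) : 0 ≤ wl E l x ∧ wl E l x ≤ 1 := by
  refine ⟨integral_nonneg fun y => mul_nonneg (phi_nonneg hl y) (iE_01 E _).1, ?_⟩
  rw [← phi_int hn hl]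
  refine integral_mono (mul_iE hE (phi_intg hl) (by fun_prop)) (phi_intg hl) fun y => ?_
  exact mul_le_of_le_one_right (phi_nonneg hl y) (iE_01 E _).2

theorem wl_int {n : ℕ} (hn : frk X = n + 1) {E : Set X} (hE : MeasurableSet E) (hv : volume E ≠ ⊤) {l : ℝ} (hl : 0 < l) :
    Integrable (wl E l) ∧ ∫ x, wl E l x = (volume E).toReal := by
  refine ⟨by rw [wl_conv]; exact (phi_intg hl).integrable_convolution _ (iE_int hE hv), ?_⟩
  rw [wl_conv, integral_convolution _ (phi_intg hl) (iE_int hE hv), phi_int hn hl]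
  simp only [iE, ContinuousLinearMap.mul_apply', one_mul]
  rw [integral_indicator_const _ hE]; simp [Measure.real]

noncomputable def gE2 (E : Set X) (a h : X) : ℝ≥0∞ := ind E a * ind Eᶜ (a + h) + ind E (a + h) * ind Eᶜ a

theorem gE2_meas {E : Set X} (hE : MeasurableSet E) : Measurable fun p : X × X => gE2 E p.1 p.2 := by
  unfold gE2
  exact (((ind_meas hE).comp measurable_fst).mul ((ind_meas hE.compl).comp (by fun_prop))).add (((ind_meas hE).comp (by fun_prop)).mul ((ind_meas hE.compl).comp measurable_fst))

theorem gE2_lint {E : Set X} (hE : MeasurableSet E) (hv : volume E ≠ ⊤) (h : X) : ∫⁻ a, gE2 E a h = 2 * ee E h := by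
  unfold gE2
  have m1 : Measurable fun a => ind E a * ind Eᶜ (a + h) := (ind_meas hE).mul ((ind_meas hE.compl).comp (by fun_prop))
  rw [lintegral_add_left m1, two_mul]
  congr 1
  rw [← ee_neg hE hv h, ← lintegral_sub_right_eq_self _ h]
  unfold ee
  congr 1; ext a; simp [sub_eq_add_neg]

theorem gE2_abs (E : Set X) (a h : X) : oR |iE E a - iE E (a + h)| = gE2 E a h := by
  unfold gE2 ind iE
  by_cases h1 : a ∈ E <;> by_cases h2 : a + h ∈ E <;> simp [h1, h2]

theorem of_abs_int_le (f : X → ℝ) : oR |∫ x, f x| ≤ ∫⁻ x, oR |f x| := by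
  have := enorm_integral_le_lintegral_enorm (μ := (volume : Measure X)) f
  simpa only [Real.enorm_eq_ofReal_abs] using this

theorem wl_dz {n : ℕ} (hn : frk X = n + 1) {E : Set X} (hE : MeasurableSet E) (hv : volume E ≠ ⊤) {l : ℝ} (hl : 0 < l) {z : X} (hz : ‖z‖ = 1) :
    ∫⁻ x, oR |fdv (wl E l) x z| ≤ ∫⁻ y, oR |fdv (phi l) y z| * ee E ((2 * inn z y) • z) := by
  set ρ := ((ℝ ∙ z).reflection) with hρ
  have r1 : ∀ y, ρ y = (2 * inn z y) • z - y := fun y => by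
    rw [hρ, Submodule.reflection_singleton_apply, hz]; simp [mul_smul, two_smul]
  have r2 : ∀ y, fdv (phi l) (-ρ y) z = - fdv (phi l) y z := fun y => by
    rw [phi_fderiv hn, phi_fderiv hn, norm_neg, LinearIsometryEquiv.norm_map, inner_neg_right, r1, inner_sub_right, inner_smul_right, real_inner_self_eq_norm_sq, hz]; ring
  have k1 : ∀ x, 2 * oR |fdv (wl E l) x z| ≤ ∫⁻ y, oR |fdv (phi l) y z| * gE2 E (x - y) ((2 * inn z y) • z) := by
    intro x
    have a1 := wl_deriv hE hv hl x z
    have a2 : ∫ y, fdv (phi l) y z * iE E (x - y) = -∫ y, fdv (phi l) y z * iE E (x - y + (2 * inn z y) • z) := by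
      have mp : MeasurePreserving ρ := ρ.measurePreserving
      rw [← integral_neg_eq_self, ← mp.integral_comp ρ.toHomeomorph.measurableEmbedding, ← integral_neg]
      congr 1; ext y
      rw [r2, neg_mul, sub_neg_eq_add, r1]; congr 3; abel
    have i1 := mul_iE hE (dphi_intg hl z) (T := fun y => x - y) (by fun_prop)
    have i2 := mul_iE hE (dphi_intg hl z) (T := fun y => x - y + (2 * inn z y) • z) (by fun_prop)
    have a3 : 2 * fdv (wl E l) x z = ∫ y, fdv (phi l) y z * (iE E (x - y) - iE E (x - y + (2 * inn z y) • z)) := by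
      simp_rw [mul_sub]
      rw [integral_sub i1 i2, a1]; linarith
    calc _ = oR |2 * fdv (wl E l) x z| := by
          rw [abs_mul, ofReal_mul (abs_nonneg _), abs_two, ofReal_ofNat]
      _ ≤ _ := by
          rw [a3]; refine (of_abs_int_le _).trans_eq ?_
          congr 1; ext y
          rw [abs_mul, ofReal_mul (abs_nonneg _), gE2_abs]
  have c1 : Continuous fun y : X => fdv (phi l) y z := ((phi_contDiff (X := X) l).continuous_fderiv one_ne_zero).clm_apply continuous_const
  have c2 : Continuous fun y : X => fdv (wl E l) y z := ((wl_contDiff hE hv hl).continuous_fderiv one_ne_zero).clm_apply continuous_const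
  have k2 := lintegral_mono (μ := volume) k1
  have m0 : Measurable fun x => oR |fdv (wl E l) x z| := c2.abs.measurable.ennreal_ofReal
  have m1 : Measurable fun p : X × X => oR |fdv (phi l) p.2 z| * gE2 E (p.1 - p.2) ((2 * inn z p.2) • z) :=
    Measurable.mul ((c1.comp continuous_snd).abs.measurable.ennreal_ofReal) ((gE2_meas hE).comp (f := fun p : X × X => (p.1 - p.2, (2 * inn z p.2) • z)) (by fun_prop))
  rw [lintegral_const_mul _ m0, lintegral_lintegral_swap m1.aemeasurable] at k2
  have k3 : ∀ y, ∫⁻ x, oR |fdv (phi l) y z| * gE2 E (x - y) ((2 * inn z y) • z) = 2 * (oR |fdv (phi l) y z| * ee E ((2 * inn z y) • z)) := by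
    intro y
    have m3 : Measurable fun x => gE2 E (x - y) ((2 * inn z y) • z) := (gE2_meas hE).comp (f := fun x : X => (x - y, (2 * inn z y) • z)) (by fun_prop)
    rw [lintegral_const_mul _ m3, lintegral_sub_right_eq_self (fun x => gE2 E x ((2 * inn z y) • z)), gE2_lint hE hv]; ring
  simp_rw [k3] at k2
  have m4 : Measurable fun y => oR |fdv (phi l) y z| * ee E ((2 * inn z y) • z) := Measurable.mul c1.abs.measurable.ennreal_ofReal ((ee_meas hE).comp (by fun_prop))
  rw [lintegral_const_mul _ m4] at k2
  exact (ENNReal.mul_le_mul_iff_right two_ne_zero ofNat_ne_top).1 k2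

theorem wl_grad [Nontrivial X] {n : ℕ} (hn : frk X = n + 1) {E : Set X} (hE : MeasurableSet E) (hv : volume E ≠ ⊤) {l : ℝ} (hl : 0 < l) :
    oR (2 * om n) * ∫⁻ x, oR ‖fdv (wl E l) x‖ ≤ ∫⁻ h, oR (KK X n l ‖h‖) * ee E h := by
  have o0 := om_pos n
  have c3 := (wl_contDiff hE hv hl).continuous_fderiv one_ne_zero
  have m0 : Measurable fun x => oR ‖fdv (wl E l) x‖ := c3.norm.measurable.ennreal_ofReal
  rw [← lintegral_const_mul _ m0, ← sphere_K hn hl (ee_meas hE) (ee_neg hE hv)]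
  have e1 : ∀ x, oR (2 * om n) * oR ‖fdv (wl E l) x‖ = ∫⁻ z : Metric.sphere (0:X) 1, oR |fdv (wl E l) x (z:X)| ∂(volume : Measure X).toSphere := by
    intro x
    rw [sphere_clm hn, ← ofReal_mul (by positivity)]
  simp_rw [e1]
  have m1 : Measurable fun p : X × Metric.sphere (0:X) 1 => oR |fdv (wl E l) p.1 (p.2:X)| :=
    ((c3.comp continuous_fst).clm_apply (continuous_subtype_val.comp continuous_snd)).abs.measurable.ennreal_ofReal
  rw [lintegral_lintegral_swap m1.aemeasurable]
  refine lintegral_mono fun z => wl_dz hn hE hv hl (by simpa using z.2)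

theorem wl_sub {n : ℕ} (hn : frk X = n + 1) {E : Set X} (hE : MeasurableSet E) (hv : volume E ≠ ⊤) {l : ℝ} (hl : 0 < l) :
    ∫⁻ x, oR |wl E l x - iE E x| ≤ 2 * ∫⁻ y, oR (phi l y) * ee E y := by
  have k1 : ∀ x, oR |wl E l x - iE E x| ≤ ∫⁻ y, oR (phi l y) * gE2 E (x - y) y := by
    intro x
    have i1 := mul_iE hE (phi_intg hl) (T := fun y => x - y) (by fun_prop)
    have a3 : wl E l x - iE E x = ∫ y, phi l y * (iE E (x - y) - iE E (x - y + y)) := by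
      simp_rw [mul_sub, sub_add_cancel]
      rw [integral_sub i1 ((phi_intg hl).mul_const _), integral_mul_const, phi_int hn hl, one_mul, wl]
    rw [a3]; refine (of_abs_int_le _).trans_eq ?_
    congr 1; ext y
    rw [abs_mul, ofReal_mul (abs_nonneg _), gE2_abs, abs_of_nonneg (phi_nonneg hl y)]
  have c1 := (phi_contDiff (X := X) l).continuous
  have m1 : Measurable fun p : X × X => oR (phi l p.2) * gE2 E (p.1 - p.2) p.2 :=
    Measurable.mul ((c1.comp continuous_snd).measurable.ennreal_ofReal) ((gE2_meas hE).comp (f := fun p : X × X => (p.1 - p.2, p.2)) (by fun_prop))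
  have k2 := lintegral_mono (μ := volume) k1
  rw [lintegral_lintegral_swap m1.aemeasurable] at k2
  have m4 : Measurable fun y => oR (phi l y) * ee E y := Measurable.mul c1.measurable.ennreal_ofReal (ee_meas hE)
  rw [← lintegral_const_mul _ m4]
  refine k2.trans_eq ?_
  congr 1; ext y
  have m3 : Measurable fun x => gE2 E (x - y) y := (gE2_meas hE).comp (f := fun x : X => (x - y, y)) (by fun_prop)
  rw [lintegral_const_mul _ m3, lintegral_sub_right_eq_self (fun x => gE2 E x y), gE2_lint hE hv]; ring

theorem KK_norm [Nontrivial X] {n : ℕ} (hn : frk X = n + 1) {l : ℝ} (hl : 0 < l) :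
    ∫⁻ h : X, oR (KK X n l ‖h‖) * oR ‖h‖ = oR (2 * ((n+1) * om (n+1))) := by
  rw [← sphere_K hn hl (g := fun h => oR ‖h‖) (by fun_prop) (fun h => by rw [norm_neg])]
  have : ∀ z : Metric.sphere (0:X) 1, ∫⁻ y : X, oR |fdv (phi l) y (z:X)| * oR ‖(2 * inn (z:X) y) • (z:X)‖ = oR 2 := by
    intro z
    have hz : ‖(z:X)‖ = 1 := by simpa using z.2
    have i0 := I0_pos (X := X)
    have e1 := ibp (phi_contDiff (X := X) l) (phi_cs hl) (f := fun y : X => inn (z:X) y) (e := (z:X)) (f' := fun _ => 1) (contDiff_const.inner ℝ contDiff_id) (fun x => by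
      have : ∀ s : ℝ, inn (z:X) (x + s • (z:X)) = inn (z:X) x + s := fun s => by
        rw [inner_add_right, inner_smul_right, real_inner_self_eq_norm_sq, hz]; ring
      simp_rw [this]
      exact (hasDerivAt_id (0:ℝ)).const_add _)
    simp only [one_mul] at e1
    rw [phi_int hn hl] at e1
    have c1 : Continuous fun y : X => fdv (phi l) y (z:X) := ((phi_contDiff (X := X) l).continuous_fderiv one_ne_zero).clm_apply continuous_const
    have c2 : Continuous fun y : X => -2 * (inn (z:X) y * fdv (phi l) y (z:X)) := by fun_prop
    have i1 := Continuous.integrable_of_hasCompactSupport (μ := (volume : Measure X)) c2 (((phi_cs hl).fderiv_apply (𝕜 := ℝ) (z:X)).mul_left.mul_left)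
    have e2 : ∀ y : X, |fdv (phi l) y (z:X)| * ‖(2 * inn (z:X) y) • (z:X)‖ = -2 * (inn (z:X) y * fdv (phi l) y (z:X)) := by
      intro y
      rw [norm_smul, hz, mul_one, Real.norm_eq_abs, ← abs_mul, phi_fderiv hn]
      rw [show -((l^(n+5) * I0 X)⁻¹ * (4 * max (l^2 - ‖y‖^2) 0 * inn (z:X) y)) * (2 * inn (z:X) y) = -((l^(n+5) * I0 X)⁻¹ * (8 * max (l^2 - ‖y‖^2) 0 * (inn (z:X) y)^2)) by ring, abs_neg, abs_of_nonneg (mul_nonneg (by positivity) (mul_nonneg (mul_nonneg (by norm_num) (le_max_right _ _)) (sq_nonneg _)))]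
      ring
    calc _ = ∫⁻ y : X, oR (-2 * (inn (z:X) y * fdv (phi l) y (z:X))) := by
          congr 1; ext y; rw [← ofReal_mul (abs_nonneg _), e2]
      _ = _ := by
          rw [← ofReal_integral_eq_lintegral_ofReal i1 (ae_of_all _ fun y => by dsimp only; rw [← e2]; positivity), integral_const_mul, e1]; norm_num
  simp_rw [this]
  rw [lintegral_const, sphere_vol hn, ← ofReal_mul (by norm_num)]

theorem KK_ball [Nontrivial X] {n : ℕ} (hn : frk X = n + 1) {l : ℝ} (hl : 0 < l) :
    ∫⁻ h : X, oR (KK X n l ‖h‖) * ee (Bal (0:X) 1) h ≤ oR (2 * om n * ((n+1) * om (n+1))) := by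
  have o0 := om_pos n
  have m : Measurable fun h : X => oR (KK X n l ‖h‖) * oR ‖h‖ := (((KK_meas n l).comp measurable_norm).ennreal_ofReal).mul (by fun_prop)
  calc _ ≤ ∫⁻ h : X, oR (KK X n l ‖h‖) * oR ‖h‖ * oR (om n) := by
        refine lintegral_mono fun h => ?_
        dsimp only
        rw [mul_assoc]
        refine mul_le_mul_right ?_ _
        rw [← ofReal_mul (norm_nonneg _)]
        have := (ee_ball hn (R := 1) one_pos h).1
        rwa [one_pow, mul_one] at this
    _ = _ := by
        rw [lintegral_mul_const _ m, KK_norm hn hl, ← ofReal_mul' o0.le]; congr 1; ring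

noncomputable def kq (X : Type*) [NormedAddCommGroup X] [InnerProductSpace ℝ X] [FiniteDimensional ℝ X] [MeasurableSpace X] [BorelSpace X] (n : ℕ) (l a : ℝ) : ℝ :=
  2 * (l^(n+5) * I0 X)⁻¹ * (2 * om n / (n+2)) * (((n:ℝ) - 1) * √(l^2 - (a/2)^2)^(n+2) + (n+2)/4 * a^2 * √(l^2 - (a/2)^2)^n) / a^n

theorem kq_meas (n : ℕ) (l : ℝ) : Measurable (kq X n l) := by unfold kq; fun_prop

theorem kq_nonneg {n : ℕ} (h1 : 1 ≤ n) {l a : ℝ} (hl : 0 < l) (ha : 0 < a) : 0 ≤ kq X n l a := by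
  have := I0_pos (X := X)
  have := om_pos n
  have : (0:ℝ) ≤ n - 1 := by rw [sub_nonneg]; exact_mod_cast h1
  unfold kq; positivity

theorem sS_zero {l a : ℝ} (hl : 0 < l) (h : 2 * l ≤ a) : √(l^2 - (a/2)^2) = 0 := Real.sqrt_eq_zero_of_nonpos (by nlinarith)

theorem sS_le {l a : ℝ} (hl : 0 < l) : √(l^2 - (a/2)^2) ≤ l := by
  rw [Real.sqrt_le_left hl.le]; nlinarith [sq_nonneg (a/2)]

theorem kq_le {n : ℕ} (h1 : 1 ≤ n) {l a : ℝ} (hl : 0 < l) (ha : 0 < a) :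
    oR (kq X n l a) ≤ oR (2 * (2 * om n / (n+2)) * (2*n+1) / I0 X) * (oR ((l^3)⁻¹ * (a^n)⁻¹) * ind (Iio (2*l)) a) := by
  have i0 := I0_pos (X := X)
  have o0 := om_pos n
  have n0 : (0:ℝ) ≤ n - 1 := by rw [sub_nonneg]; exact_mod_cast h1
  by_cases h : a < 2*l
  · rw [ind_of_mem (show a ∈ Iio (2*l) from h), mul_one, ← ofReal_mul (by positivity)]
    apply ofReal_le_ofReal
    have s0 := Real.sqrt_nonneg (l^2 - (a/2)^2)
    have s1 := sS_le (a := a) hl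
    unfold kq
    calc _ ≤ 2 * (l^(n+5) * I0 X)⁻¹ * (2 * om n / (n+2)) * (((n:ℝ) - 1) * l^(n+2) + (n+2)/4 * (2*l)^2 * l^n) / a^n := by gcongr
      _ = _ := by field_simp; ring
  · unfold kq
    rw [sS_zero hl (not_lt.1 h), zero_pow (by omega), zero_pow (by omega)]; simp

theorem KK_deriv {n : ℕ} {l a : ℝ} (hl : 0 < l) (ha : 0 < a) (h : a < 2*l) : HasDerivAt (fun a => -KK X n l a) (kq X n l a) a := by
  have i0 := I0_pos (X := X)
  have u0 : 0 < l^2 - (a/2)^2 := by nlinarith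
  have s0 := Real.sqrt_pos.2 u0
  have d1 : HasDerivAt (fun a : ℝ => l^2 - (a/2)^2) (-(a/2)) a := by
    have := (((hasDerivAt_id a).div_const 2).pow 2).const_sub (l^2)
    exact this.congr_deriv (by simp; ring)
  have d2 := d1.sqrt u0.ne'
  have d3 := ((((hasDerivAt_id a).const_mul (2 * (l^(n+5) * I0 X)⁻¹ * (2 * om n / (n+2)))).mul (d2.pow (n+2))).div (hasDerivAt_pow n a) (by positivity)).neg
  refine d3.congr_deriv ?_
  unfold kq
  simp only [id, Pi.mul_apply, Pi.pow_apply]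
  generalize √(l^2 - (a/2)^2) = S at s0
  rcases n with _ | k
  · simp; field_simp; ring
  · push_cast; field_simp; ring

theorem KK_layer {n : ℕ} (h1 : 1 ≤ n) {l r : ℝ} (hl : 0 < l) (hr : 0 < r) :
    oR (KK X n l r) = ∫⁻ a in Ioi (0:ℝ), oR (kq X n l a) * ind (Iio a) r := by
  rw [lint_Ioi_ind hr.le]
  have z1 : ∀ a, 2 * l ≤ a → kq X n l a = 0 := fun a h => by
    unfold kq
    rw [sS_zero hl h, zero_pow (by omega), zero_pow (by omega)]; simp
  have z2 : ∀ a, 2 * l ≤ a → KK X n l a = 0 := fun a h => by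
    unfold KK
    rw [sS_zero hl h, zero_pow (by omega)]; simp
  rcases le_total (2*l) r with h | h
  · rw [z2 r h, ofReal_zero, setLIntegral_congr_fun measurableSet_Ioi (g := fun _ => 0) (fun a ha => by dsimp only; rw [z1 a (h.trans (le_of_lt ha)), ofReal_zero])]; simp
  · have cK : ContinuousOn (fun a => -KK X n l a) (Icc r (2*l)) := by
      intro a ha
      have : a^n ≠ 0 := pow_ne_zero _ (hr.trans_le ha.1).ne'
      unfold KK
      apply ContinuousAt.continuousWithinAt
      fun_prop (disch := assumption)
    have ck : ContinuousOn (kq X n l) (Icc r (2*l)) := by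
      intro a ha
      have : a^n ≠ 0 := pow_ne_zero _ (hr.trans_le ha.1).ne'
      unfold kq
      apply ContinuousAt.continuousWithinAt
      fun_prop (disch := assumption)
    have ii : IntervalIntegrable (kq X n l) volume r (2*l) := ContinuousOn.intervalIntegrable (by rwa [uIcc_of_le h])
    have ft := intervalIntegral.integral_eq_sub_of_hasDerivAt_of_le h cK (fun a ha => KK_deriv hl (hr.trans ha.1) ha.2) ii
    rw [z2 _ le_rfl, intervalIntegral.integral_of_le h] at ft
    rw [← Ioc_union_Ioi_eq_Ioi h, lintegral_union measurableSet_Ioi (Ioc_disjoint_Ioi le_rfl)]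
    rw [setLIntegral_congr_fun measurableSet_Ioi (g := fun _ => 0) (fun a (ha : 2*l < a) => by dsimp only; rw [z1 a ha.le, ofReal_zero]), lintegral_zero, add_zero,
      ← ofReal_integral_eq_lintegral_ofReal ((intervalIntegrable_iff_integrableOn_Ioc_of_le h).1 ii) ((ae_restrict_iff' measurableSet_Ioc).2 (ae_of_all _ fun a ha => kq_nonneg h1 hl (hr.trans ha.1))), ft]
    congr 1; ring

noncomputable def DL (n : ℕ) (E : Set X) (l : ℝ) : ℝ≥0∞ := ∫⁻ a in Ioi (0:ℝ), oR ((l^3)⁻¹ * (a^n)⁻¹) * ind (Iio (2*l)) a * df E a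

theorem KK_E [Nontrivial X] {n : ℕ} (hn : frk X = n + 1) (h1 : 1 ≤ n) {E : Set X} (hE : MeasurableSet E) (hv : volume E = volume (Bal (0:X) 1)) {l : ℝ} (hl : 0 < l) :
    ∫⁻ h, oR (KK X n l ‖h‖) * ee E h ≤ oR (2 * om n * ((n+1) * om (n+1))) + oR (2 * (2 * om n / (n+2)) * (2*n+1) / I0 X) * DL n E l := by
  have mk : Measurable fun a => oR (kq X n l a) := (kq_meas n l).ennreal_ofReal
  have lay : ∀ E : Set X, MeasurableSet E → ∫⁻ h, oR (KK X n l ‖h‖) * ee E h = ∫⁻ a in Ioi (0:ℝ), oR (kq X n l a) * JJ E a := by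
    intro E hE
    rw [← layer hE mk]
    apply lintegral_congr_ae
    filter_upwards [ae_ne_zero (X := X)] with h hh
    rw [KK_layer h1 hl (norm_pos_iff.2 hh)]
  rw [lay E hE]
  have mm : Measurable fun a => oR (kq X n l a) * JJ (Bal (0:X) 1) a := mk.mul (JJ_meas _)
  have ex : ∀ a, oR (kq X n l a) * JJ E a = oR (kq X n l a) * JJ (Bal (0:X) 1) a + oR (kq X n l a) * df E a := fun a => by rw [df_add hE hv, mul_add]
  simp_rw [ex]
  rw [lintegral_add_left mm, ← lay _ measurableSet_ball]
  refine add_le_add (KK_ball hn hl) ?_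
  have m3 : Measurable fun a : ℝ => oR ((l^3)⁻¹ * (a^n)⁻¹) * ind (Iio (2*l)) a * df E a := Measurable.mul (Measurable.mul (by fun_prop) (ind_meas measurableSet_Iio)) (df_meas E)
  unfold DL
  rw [← lintegral_const_mul _ m3]
  refine setLIntegral_mono' measurableSet_Ioi fun a ha => ?_
  rw [← mul_assoc]
  exact mul_le_mul_left (kq_le (X := X) h1 hl ha) _

theorem phi_le_KK {n : ℕ} (hn : frk X = n + 1) (h1 : 1 ≤ n) {l : ℝ} (hl : 0 < l) {y : X} (hy : y ≠ 0) :
    phi l y ≤ 2^(n+1) / (2 * om n / (n+2)) * l * KK X n l ‖y‖ := by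
  have i0 := I0_pos (X := X)
  have o0 := om_pos n
  have y0 := norm_pos_iff.2 hy
  have k0 := KK_nonneg (X := X) (n := n) hl y0.le
  rcases le_total l ‖y‖ with h | h
  · unfold phi; rw [psi_supp hl h, mul_zero]; positivity
  · obtain ⟨k, rfl⟩ : ∃ k, n = k + 1 := ⟨n - 1, by omega⟩
    have s1 : l/2 ≤ √(l^2 - (‖y‖/2)^2) := Real.le_sqrt_of_sq_le (by nlinarith)
    have p1 : psi l y ≤ l^4 := by
      unfold psi
      have : max (l^2 - ‖y‖^2) 0 ≤ l^2 := max_le (by nlinarith) (by positivity)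
      calc _ ≤ (l^2)^2 := pow_le_pow_left₀ (le_max_right _ _) this 2
        _ = _ := by ring
    have p2 : ‖y‖^k ≤ l^k := pow_le_pow_left₀ y0.le h k
    unfold phi KK
    rw [hn]
    set A := 2 * om (k+1) / (((k+1 : ℕ):ℝ)+2) with hA
    have A0 : 0 < A := by positivity
    calc _ ≤ (l^(k+1+1+4) * I0 X)⁻¹ * l^4 := by gcongr
      _ = 2^(k+1+1) / A * l * (2 * (l^(k+1+5) * I0 X)⁻¹ * A * (l/2)^(k+1+2) / l^k) := by rw [div_pow]; field_simp; ring
      _ ≤ 2^(k+1+1) / A * l * (2 * (l^(k+1+5) * I0 X)⁻¹ * A * √(l^2 - (‖y‖/2)^2)^(k+1+2) / ‖y‖^k) := by gcongr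
      _ = _ := by generalize √(l^2 - (‖y‖/2)^2) = S; field_simp; ring

theorem wl_bounds [Nontrivial X] {n : ℕ} (hn : frk X = n + 1) (h1 : 1 ≤ n) : ∃ C : ℝ, 0 < C ∧ ∀ E : Set X, MeasurableSet E → volume E = volume (Bal (0:X) 1) → ∀ l : ℝ, 0 < l →
    ∫⁻ x, oR ‖fdv (wl E l) x‖ ≤ oR ((n+1) * om (n+1)) + oR C * DL n E l ∧
    ∫⁻ x, oR |wl E l x - iE E x| ≤ oR (C * l) * (1 + DL n E l) := by
  have i0 := I0_pos (X := X)
  have o0 := om_pos n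
  have o1 := om_pos (n+1)
  set K1 := 2 * (2 * om n / (n+2)) * (2*n+1) / I0 X with hK1
  set K2 := 2^(n+1) / (2 * om n / (n+2)) with hK2
  set K3 := 2 * om n * ((n+1) * om (n+1)) with hK3
  have k1 : 0 < K1 := by positivity
  have k2 : 0 < K2 := by positivity
  have k3 : 0 < K3 := by positivity
  refine ⟨K1 / (2 * om n) + 2 * K2 * (K3 + K1), by positivity, fun E hE hv l hl => ?_⟩
  have hv' : volume E ≠ ⊤ := by rw [hv]; exact (vol_ball_lt_top _ _).ne
  have hK := KK_E hn h1 hE hv hl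
  rw [← hK1, ← hK3] at hK
  constructor
  · have g := (wl_grad hn hE hv' hl).trans hK
    have q0 : oR (2 * om n) ≠ 0 := by rw [Ne, ofReal_eq_zero, not_le]; positivity
    refine (ENNReal.mul_le_mul_iff_right q0 ofReal_ne_top).1 (g.trans ?_)
    rw [mul_add, ← mul_assoc, ← ofReal_mul (by positivity), ← ofReal_mul (by positivity)]
    refine add_le_add le_rfl (mul_le_mul_left (ofReal_le_ofReal ?_) _)
    rw [mul_add, mul_div_cancel₀ _ (by positivity)]
    linarith [show 0 ≤ 2 * om n * (2 * K2 * (K3 + K1)) by positivity]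
  · refine (wl_sub hn hE hv' hl).trans ?_
    calc _ ≤ 2 * (oR (K2 * l) * ∫⁻ h, oR (KK X n l ‖h‖) * ee E h) := by
          refine mul_le_mul_right ?_ _
          have m : Measurable fun h : X => oR (KK X n l ‖h‖) * ee E h := (((KK_meas n l).comp measurable_norm).ennreal_ofReal).mul (ee_meas hE)
          rw [← lintegral_const_mul _ m]
          apply lintegral_mono_ae
          filter_upwards [ae_ne_zero (X := X)] with y hy
          rw [← mul_assoc, ← ofReal_mul (by positivity)]
          exact mul_le_mul_left (ofReal_le_ofReal (phi_le_KK hn h1 hl hy)) _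
      _ ≤ 2 * (oR (K2 * l) * (oR (K3 + K1) * (1 + DL n E l))) := by
          refine mul_le_mul_right (mul_le_mul_right (hK.trans ?_) _) _
          rw [mul_add, mul_one]
          exact add_le_add (ofReal_le_ofReal (by linarith)) (mul_le_mul_left (ofReal_le_ofReal (by linarith)) _)
      _ = oR (2 * K2 * (K3 + K1) * l) * (1 + DL n E l) := by
          rw [← ofReal_ofNat, ← mul_assoc, ← mul_assoc, ← ofReal_mul (by norm_num), ← ofReal_mul (by positivity)]
          congr 2; ring
      _ ≤ _ := by
          refine mul_le_mul_left (ofReal_le_ofReal ?_) _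
          refine mul_le_mul_of_nonneg_right ?_ hl.le
          linarith [show 0 ≤ K1 / (2 * om n) by positivity]

theorem eps_pow {ε τ : ℝ} (h0 : 0 < ε) (h1 : ε ≤ 1) (t0 : 0 < τ) (ht : τ ≤ 4 * ε) : Real.exp (-16) ≤ (ε^4)^τ := by
  rw [Real.rpow_def_of_pos (by positivity), Real.exp_le_exp, Real.log_pow]
  have l1 := Real.one_sub_inv_le_log_of_pos h0
  have l2 : Real.log ε ≤ 0 := Real.log_nonpos h0.le h1
  have l3 : -1 ≤ ε * Real.log ε := by
    have := mul_le_mul_of_nonneg_left l1 h0.le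
    rw [mul_sub, mul_inv_cancel₀ h0.ne'] at this; linarith
  push_cast
  nlinarith

theorem pick {n : ℕ} {E : Set X} {K ε τ : ℝ} (hK : 0 < K) (h0 : 0 < ε) (h1 : ε ≤ 1) (t0 : 0 < τ) (t1 : τ ≤ 1) (ht : τ ≤ 4 * ε)
    (H : oR τ * ∫⁻ a in Ioc (0:ℝ) 2, kap (n+2-τ) a * df E a ≤ oR (K * ε)) :
    ∃ l, 0 < l ∧ l ≤ ε^4 ∧ DL n E l ≤ oR ((8 * K * Real.exp 16 + 1) * ε) := by
  by_contra! hc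
  set M := oR ((8 * K * Real.exp 16 + 1) * ε) with hM
  set Q := ∫⁻ a in Ioc (0:ℝ) 2, kap (n+2-τ) a * df E a with hQ
  have e4 : ε^4 ≤ 1 := pow_le_one₀ h0.le h1
  have mI : Measurable fun p : ℝ × ℝ => (ind (Iio (2*p.1)) p.2 : ℝ≥0∞) := by
    have : (fun p : ℝ × ℝ => (ind (Iio (2*p.1)) p.2 : ℝ≥0∞)) = {p : ℝ × ℝ | p.2 < 2*p.1}.indicator 1 := by
      ext p; simp only [ind, indicator, mem_Iio, mem_setOf_eq]
      rfl
    rw [this]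
    exact measurable_one.indicator (measurableSet_lt (by fun_prop) (by fun_prop))
  have mJ : Measurable fun p : ℝ × ℝ => oR (p.1^(τ-1)) * (oR ((p.1^3)⁻¹ * (p.2^n)⁻¹) * ind (Iio (2*p.1)) p.2 * df E p.2) :=
    Measurable.mul (by fun_prop) (Measurable.mul (Measurable.mul (by fun_prop) mI) ((df_meas E).comp measurable_snd))
  have s1 : ∫⁻ l in Ioi (0:ℝ), oR (l^(τ-1)) * ind (Iio (ε^4)) l = oR ((ε^4)^τ/τ) := by
    have := lint_rpow (p := τ - 1) (x := ε^4) (by linarith) (by positivity)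
    rwa [sub_add_cancel] at this
  have mi : Measurable fun l : ℝ => oR (l^(τ-1)) * ind (Iio (ε^4)) l := Measurable.mul (by fun_prop) (ind_meas measurableSet_Iio)
  have s2 : oR ((ε^4)^τ/τ) * M ≤ ∫⁻ l in Ioi (0:ℝ), ∫⁻ a in Ioi (0:ℝ), ind (Iio (ε^4)) l * (oR (l^(τ-1)) * (oR ((l^3)⁻¹ * (a^n)⁻¹) * ind (Iio (2*l)) a * df E a)) := by
    rw [← s1, ← lintegral_mul_const _ mi]
    refine setLIntegral_mono' measurableSet_Ioi fun l (hl : 0 < l) => ?_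
    have m3 : Measurable fun a : ℝ => oR ((l^3)⁻¹ * (a^n)⁻¹) * ind (Iio (2*l)) a * df E a := Measurable.mul (Measurable.mul (by fun_prop) (ind_meas measurableSet_Iio)) (df_meas E)
    have m4 : Measurable fun a : ℝ => oR (l^(τ-1)) * (oR ((l^3)⁻¹ * (a^n)⁻¹) * ind (Iio (2*l)) a * df E a) := m3.const_mul _
    rw [lintegral_const_mul _ m4, lintegral_const_mul _ m3]
    by_cases h : l < ε^4
    · rw [ind_of_mem (show l ∈ Iio (ε^4) from h), mul_one, one_mul]
      exact mul_le_mul_right (hc l hl h.le).le _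
    · rw [ind_of_not (show l ∉ Iio (ε^4) from h)]; simp
  have mJ' : Measurable fun p : ℝ × ℝ => ind (Iio (ε^4)) p.1 * (oR (p.1^(τ-1)) * (oR ((p.1^3)⁻¹ * (p.2^n)⁻¹) * ind (Iio (2*p.1)) p.2 * df E p.2)) := ((ind_meas measurableSet_Iio).comp measurable_fst).mul mJ
  rw [lintegral_lintegral_swap mJ'.aemeasurable] at s2
  have s3 : ∀ a : ℝ, 0 < a → ∫⁻ l in Ioi (0:ℝ), ind (Iio (ε^4)) l * (oR (l^(τ-1)) * (oR ((l^3)⁻¹ * (a^n)⁻¹) * ind (Iio (2*l)) a * df E a)) ≤ (Ioc (0:ℝ) 2).indicator (fun a => 8 * (kap (n+2-τ) a * df E a)) a := by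
    intro a ha
    by_cases h2 : a ≤ 2
    · rw [indicator_of_mem (show a ∈ Ioc (0:ℝ) 2 from ⟨ha, h2⟩)]
      calc _ ≤ ∫⁻ l in Ioi (0:ℝ), (kap (3-τ) l * ind (Iio l) (a/2)) * (oR (a^n)⁻¹ * df E a) := by
            refine setLIntegral_mono' measurableSet_Ioi fun l (hl : 0 < l) => ?_
            by_cases h : a < 2 * l
            · rw [ind_of_mem (show a ∈ Iio (2*l) from h), ind_of_mem (show a/2 ∈ Iio l by rw [mem_Iio]; linarith), mul_one, mul_one, ofReal_mul (by positivity), mul_assoc, ← mul_assoc (oR (l^(τ-1)))]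
              refine (mul_le_mul_left (ind_le_one _ _) _).trans ?_
              rw [one_mul]
              refine mul_le_mul_left ?_ _
              rw [← ofReal_mul (by positivity), kap]
              apply ofReal_le_ofReal
              have : l^(τ-1) * (l^3)⁻¹ = l^(-(3-τ)-1) := by
                rw [← Real.rpow_natCast l 3, ← Real.rpow_neg hl.le, ← Real.rpow_add hl]; congr 1; push_cast; ring
              rw [this]
              have p0 : 0 ≤ l^(-(3-τ)-1) := by positivity
              nlinarith
            · rw [ind_of_not (show a ∉ Iio (2*l) from h)]; simp
        _ = oR ((a/2)^(-(3-τ))) * (oR (a^n)⁻¹ * df E a) := by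
            have m5 : Measurable fun l => kap (3-τ) l * ind (Iio l) (a/2) := (kap_meas _).mul (by
              have : (fun l : ℝ => (ind (Iio l) (a/2) : ℝ≥0∞)) = (Ioi (a/2)).indicator 1 := by
                ext p; simp only [ind, indicator, mem_Iio, mem_Ioi]; rfl
              rw [this]; exact measurable_one.indicator measurableSet_Ioi)
            rw [lintegral_mul_const _ m5, lint_Ioi_ind (by positivity), kap_tail (by linarith) (by positivity)]
        _ ≤ _ := by
            rw [← mul_assoc, ← mul_assoc, ← ofReal_mul (by positivity), kap, ← ofReal_ofNat, ← ofReal_mul (by norm_num)]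
            refine mul_le_mul_left (ofReal_le_ofReal ?_) _
            have q1 : (a/2)^(-(3-τ)) * (a^n)⁻¹ = a^(-(n+2-τ)-1) * (2:ℝ)^(3-τ) := by
              rw [Real.div_rpow ha.le (by norm_num), div_eq_mul_inv, ← Real.rpow_neg (by norm_num : (0:ℝ) ≤ 2), neg_neg, ← Real.rpow_natCast a n, ← Real.rpow_neg ha.le, mul_right_comm, ← Real.rpow_add ha]; congr 2; ring
            have q2 : (2:ℝ)^(3-τ) ≤ 8 := by
              calc (2:ℝ)^(3-τ) ≤ (2:ℝ)^(3:ℝ) := Real.rpow_le_rpow_of_exponent_le (by norm_num) (by linarith)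
                _ = 8 := by norm_num
            have p0 : 0 ≤ a^(-((n:ℝ)+2-τ)-1) := by positivity
            have p2 : (1:ℝ) ≤ n + 2 - τ := by linarith [show (0:ℝ) ≤ n from Nat.cast_nonneg n]
            rw [q1]
            calc _ ≤ a^(-((n:ℝ)+2-τ)-1) * 8 := mul_le_mul_of_nonneg_left q2 p0
              _ ≤ _ := by linarith [mul_le_mul_of_nonneg_right p2 p0]
    · rw [indicator_of_notMem (fun h => h2 h.2)]
      refine le_of_eq ?_
      rw [setLIntegral_congr_fun measurableSet_Ioi (g := fun _ => 0), lintegral_zero]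
      intro l hl
      dsimp only
      by_cases h : l < ε^4
      · rw [ind_of_not (show a ∉ Iio (2*l) by rw [mem_Iio]; linarith)]; simp
      · rw [ind_of_not (show l ∉ Iio (ε^4) from h)]; simp
  have mk : Measurable fun a => kap (n+2-τ) a * df E a := (kap_meas _).mul (df_meas E)
  have s4 : oR ((ε^4)^τ/τ) * M ≤ 8 * Q := by
    refine s2.trans ((setLIntegral_mono' measurableSet_Ioi fun a ha => s3 a ha).trans ?_)
    refine (setLIntegral_le_lintegral _ _).trans ?_
    rw [lintegral_indicator measurableSet_Ioc, lintegral_const_mul _ mk]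
  have s5 : oR ((ε^4)^τ) * M ≤ 8 * oR (K * ε) := by
    calc _ = oR τ * (oR ((ε^4)^τ/τ) * M) := by
          rw [← mul_assoc, ← ofReal_mul t0.le, mul_div_cancel₀ _ t0.ne']
      _ ≤ oR τ * (8 * Q) := mul_le_mul_right s4 _
      _ = 8 * (oR τ * Q) := by ring
      _ ≤ _ := mul_le_mul_right H _
  rw [hM, ← ofReal_mul (by positivity), ← ofReal_ofNat, ← ofReal_mul (by norm_num), ofReal_le_ofReal_iff (by positivity)] at s5
  have e1 := eps_pow h0 h1 t0 ht
  have e2 : Real.exp (-16) * Real.exp 16 = 1 := by rw [← Real.exp_add]; simp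
  have e3 := mul_le_mul_of_nonneg_right e1 (show 0 ≤ (8 * K * Real.exp 16 + 1) * ε by positivity)
  have e5 : Real.exp (-16) * ((8 * K * Real.exp 16 + 1) * ε) = 8 * (K * ε) + Real.exp (-16) * ε := by
    linear_combination (8 * K * ε) * e2
  have e6 : 0 < Real.exp (-16) * ε := by positivity
  linarith

theorem cut {w : X → ℝ} (hw : ContDiff ℝ 1 w) (hi : Integrable w) (w0 : ∀ x, 0 ≤ w x) (w1 : ∀ x, w x ≤ 1)
    (hd : Integrable fun x => ‖fdv w x‖) {η : ℝ} (hη : 0 < η) :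
    ∃ v : X → ℝ, ContDiff ℝ 1 v ∧ HasCompactSupport v ∧ (∀ x, 0 ≤ v x) ∧ (∀ x, v x ≤ w x) ∧ (∫ x, (w x - v x)) ≤ η ∧ (∀ x, v x * (1 - v x) ≤ w x * (1 - w x) + (w x - v x)) ∧
      ∫ x, ‖fdv v x‖ ≤ (∫ x, ‖fdv w x‖) + η := by
  let f : ContDiffBump (0:X) := ⟨1, 2, by norm_num, by norm_num⟩
  have fc : ContDiff ℝ 1 f := f.contDiff
  have fcs : HasCompactSupport f := f.hasCompactSupport
  obtain ⟨M, hM⟩ := (fcs.fderiv (𝕜 := ℝ)).exists_bound_of_continuous (fc.continuous_fderiv one_ne_zero)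
  have M0 : 0 ≤ M := (norm_nonneg _).trans (hM 0)
  let χ : ℕ → X → ℝ := fun k x => f (((k:ℝ)+1)⁻¹ • x)
  have χc : ∀ k, ContDiff ℝ 1 (χ k) := fun k => fc.comp (contDiff_const_smul _)
  have χd : ∀ k x, ‖fdv (χ k) x‖ ≤ ((k:ℝ)+1)⁻¹ * M := by
    intro k x
    have h1 : HasFDerivAt (χ k) ((fdv f (((k:ℝ)+1)⁻¹ • x)).comp (((k:ℝ)+1)⁻¹ • ContinuousLinearMap.id ℝ X)) x :=
      ((fc.differentiable one_ne_zero _).hasFDerivAt).comp x ((hasFDerivAt_id x).const_smul _)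
    rw [h1.fderiv, ContinuousLinearMap.comp_smul, ContinuousLinearMap.comp_id, norm_smul, norm_inv, Real.norm_of_nonneg (by positivity)]
    gcongr; exact hM _
  have χ01 : ∀ k x, 0 ≤ χ k x ∧ χ k x ≤ 1 := fun k x => ⟨f.nonneg, f.le_one⟩
  have T1 : Tendsto (fun k : ℕ => ∫ x, (w x - w x * χ k x)) atTop (𝓝 0) := by
    rw [show (0:ℝ) = ∫ x : X, (0:ℝ) by simp]
    refine tendsto_integral_of_dominated_convergence (fun x => w x) (fun k => ?_) hi (fun k => ae_of_all _ fun x => ?_) (ae_of_all _ fun x => ?_)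
    · exact (hw.continuous.sub (hw.continuous.mul (χc k).continuous)).aestronglyMeasurable
    · have := χ01 k x
      rw [Real.norm_of_nonneg (by nlinarith [w0 x])]; nlinarith [w0 x]
    · apply tendsto_const_nhds.congr'
      obtain ⟨m, hm⟩ := exists_nat_ge ‖x‖
      filter_upwards [eventually_ge_atTop m] with k hk
      have : χ k x = 1 := by
        apply f.one_of_mem_closedBall
        rw [mem_closedBall_zero_iff, norm_smul, norm_inv, Real.norm_of_nonneg (by positivity)]
        show _ ≤ (1:ℝ)
        rw [inv_mul_le_iff₀ (by positivity)]
        have : (m:ℝ) ≤ k := by exact_mod_cast hk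
        linarith
      rw [this]; ring
  have T2 : Tendsto (fun k : ℕ => ((k:ℝ)+1)⁻¹ * M * ∫ x, w x) atTop (𝓝 0) := by
    have : Tendsto (fun k : ℕ => ((k:ℝ)+1)⁻¹) atTop (𝓝 0) := by simpa using tendsto_one_div_add_atTop_nhds_zero_nat (𝕜 := ℝ)
    simpa using (this.mul_const M).mul_const (∫ x, w x)
  obtain ⟨k, k1, k2⟩ := ((T1.eventually (gt_mem_nhds hη)).and (T2.eventually (gt_mem_nhds hη))).exists
  refine ⟨fun x => w x * χ k x, hw.mul (χc k), ?_, fun x => mul_nonneg (w0 x) (χ01 k x).1, fun x => mul_le_of_le_one_right (w0 x) (χ01 k x).2, k1.le, fun x => ?_, ?_⟩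
  · have : HasCompactSupport (χ k) := fcs.comp_homeomorph (Homeomorph.smulOfNeZero ((k:ℝ)+1)⁻¹ (by positivity))
    exact this.mul_left
  · have a := w0 x; have b := w1 x; have c := χ01 k x
    have e1 : 0 ≤ w x * (1 - w x) * (1 - χ k x) := mul_nonneg (mul_nonneg a (by linarith)) (by linarith)
    have e2 : 0 ≤ w x * (1 - χ k x) * (1 - w x * χ k x) := mul_nonneg (mul_nonneg a (by linarith)) (by nlinarith)
    nlinarith
  · have dd : ∀ x, ‖fdv (fun x => w x * χ k x) x‖ ≤ ‖fdv w x‖ + ((k:ℝ)+1)⁻¹ * M * w x := by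
      intro x
      have := fderiv_mul (hw.differentiable one_ne_zero x) ((χc k).differentiable one_ne_zero x)
      have e : fdv (fun x => w x * χ k x) x = _ := this
      rw [e]
      refine (norm_add_le _ _).trans ?_
      rw [norm_smul, norm_smul, Real.norm_of_nonneg (w0 x), Real.norm_of_nonneg (χ01 k x).1]
      have h1 := mul_le_mul_of_nonneg_left (χd k x) (w0 x)
      have h2 := mul_le_of_le_one_left (norm_nonneg (fdv w x)) (χ01 k x).2
      linarith
    calc _ ≤ ∫ x, (‖fdv w x‖ + ((k:ℝ)+1)⁻¹ * M * w x) := integral_mono_of_nonneg (ae_of_all _ fun x => norm_nonneg _) (hd.add (hi.const_mul _)) (ae_of_all _ dd)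
      _ = (∫ x, ‖fdv w x‖) + ((k:ℝ)+1)⁻¹ * M * ∫ x, w x := by
          rw [integral_add hd (hi.const_mul _), integral_const_mul]
      _ ≤ _ := by linarith

theorem int_of_lint {f : X → ℝ} (hf : Measurable f) (f0 : ∀ x, 0 ≤ f x) {A : ℝ} (hA : 0 ≤ A) (h : ∫⁻ x, oR (f x) ≤ oR A) :
    Integrable f ∧ ∫ x, f x ≤ A := by
  constructor
  · refine ⟨hf.aestronglyMeasurable, ?_⟩
    rw [hasFiniteIntegral_iff_ofReal (ae_of_all _ f0)]
    exact h.trans_lt ofReal_lt_top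
  · rw [integral_eq_lintegral_of_nonneg_ae (ae_of_all _ f0) hf.aestronglyMeasurable]
    exact toReal_le_of_le_ofReal hA h
set_option maxHeartbeats 1000000 in

theorem bad [Nontrivial X] {n : ℕ} (hn : frk X = n + 1) (h1 : 1 ≤ n) {K : ℝ} (hK : 0 < K) : ∃ C > (0:ℝ), ∃ ε₀ > (0:ℝ), ∀ E : Set X, MeasurableSet E → volume E = volume (Bal (0:X) 1) →
    ∀ ε τ : ℝ, 0 < ε → ε ≤ ε₀ → 0 < τ → τ ≤ 1 → τ ≤ 4 * ε →
    oR τ * ∫⁻ a in Ioc (0:ℝ) 2, kap (n+2-τ) a * df E a ≤ oR (K * ε) →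
    ∃ c, volume (symmDiff E (Bal c 1)) ≤ oR (C * √ε) := by
  obtain ⟨C1, c1, H1⟩ := wl_bounds hn h1
  obtain ⟨CW, cW, εW, eW, HW⟩ := W_main hn h1
  have o1 := om_pos (n+1)
  set M1 := 8 * K * Real.exp 16 + 1 with hM1
  have m1 : 0 < M1 := by positivity
  set C2 := C1 * (1 + M1) with hC2
  have c2 : 0 < C2 := by positivity
  set C' := C1 * M1 + C2 + 2 with hC'
  have c'0 : 0 < C1 * M1 := by positivity
  have c'1 : 1 ≤ C' := by linarith
  refine ⟨C2 + 1 + CW * √C', by positivity, min 1 (εW / C'), lt_min one_pos (by positivity), ?_⟩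
  intro E hE hv ε τ e0 he t0 t1 ht H
  have e1 : ε ≤ 1 := he.trans (min_le_left _ _)
  have e2 : C' * ε ≤ εW := by
    have := he.trans (min_le_right _ _)
    rw [le_div_iff₀ (by positivity)] at this; linarith
  have e3 : ε^3 ≤ ε := by
    calc ε^3 = ε * ε^2 := by ring
      _ ≤ ε * 1 := mul_le_mul_of_nonneg_left (pow_le_one₀ e0.le e1) e0.le
      _ = ε := mul_one _
  have e4 : ε^4 ≤ ε^3 := pow_le_pow_of_le_one e0.le e1 (by norm_num)
  have p3 : 0 < ε^3 := by positivity
  obtain ⟨l, l0, l1, hD⟩ := pick hK e0 e1 t0 t1 ht H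
  rw [← hM1] at hD
  obtain ⟨g1, g2⟩ := H1 E hE hv l l0
  have hv' : volume E ≠ ⊤ := by rw [hv]; exact (vol_ball_lt_top _ _).ne
  have hw := wl_contDiff hE hv' l0
  obtain ⟨wi, wv⟩ := wl_int hn hE hv' l0
  have w01 := wl_01 hn hE l0
  obtain ⟨gi, gb⟩ := int_of_lint (f := fun x => ‖fdv (wl E l) x‖) (hw.continuous_fderiv one_ne_zero).norm.measurable (fun x => norm_nonneg _) (A := (n+1) * om (n+1) + C1 * M1 * ε) (by positivity)
    (g1.trans (by
      rw [ofReal_add (by positivity) (by positivity), mul_assoc, ofReal_mul c1.le]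
      exact add_le_add le_rfl (mul_le_mul_right hD _)))
  obtain ⟨di, db⟩ := int_of_lint (f := fun x => |wl E l x - iE E x|) (hw.continuous.measurable.sub (iE_meas hE)).abs (fun x => abs_nonneg _) (A := C2 * ε^3) (by positivity)
    (g2.trans (by
      calc _ ≤ oR (C1 * l) * oR (1 + M1 * ε) := by
            rw [ofReal_add (by norm_num) (by positivity), ofReal_one]
            exact mul_le_mul_right (add_le_add le_rfl hD) _
        _ ≤ _ := by
            rw [← ofReal_mul (by positivity)]
            apply ofReal_le_ofReal
            calc C1 * l * (1 + M1 * ε) ≤ C1 * ε^3 * (1 + M1 * 1) := by gcongr; exact l1.trans e4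
              _ = _ := by rw [hC2]; ring))
  obtain ⟨v, vc, vs, v0, vw, vI, vq, vd⟩ := cut hw wi (fun x => (w01 x).1) (fun x => (w01 x).2) gi p3
  have vi : Integrable v := vc.continuous.integrable_of_hasCompactSupport vs
  have om1 : (volume E).toReal = om (n+1) := by
    rw [hv, vol_ball_om hn _ one_pos, one_pow, mul_one, toReal_ofReal o1.le]
  have vI' : (∫ x, wl E l x) - ∫ x, v x ≤ ε^3 := by
    rw [← integral_sub wi vi]; exact vI
  have vI0 : ∫ x, v x ≤ ∫ x, wl E l x := integral_mono vi wi vw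
  have WHv : WH n v (C' * ε) := by
    refine ⟨vc, vs, v0, fun x => (vw x).trans (w01 x).2, ?_, ?_, ?_⟩
    · rw [abs_le, ← om1, ← wv]
      have : ε^3 ≤ C' * ε := e3.trans (le_mul_of_one_le_left e0.le c'1)
      constructor <;> linarith
    · have b1 : ∀ x, v x * (1 - v x) ≤ |wl E l x - iE E x| + (wl E l x - v x) := by
        intro x
        refine (vq x).trans (add_le_add ?_ le_rfl)
        obtain ⟨a, b⟩ := w01 x
        by_cases h : x ∈ E
        · have : iE E x = 1 := by simp [iE, h]
          rw [this, abs_sub_comm, abs_of_nonneg (by linarith)]; nlinarith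
        · have : iE E x = 0 := by simp [iE, h]
          rw [this, sub_zero, abs_of_nonneg a]; nlinarith
      calc _ ≤ ∫ x, (|wl E l x - iE E x| + (wl E l x - v x)) := integral_mono_of_nonneg (ae_of_all _ fun x => mul_nonneg (v0 x) (by linarith [vw x, (w01 x).2])) (di.add (wi.sub vi)) (ae_of_all _ b1)
        _ = (∫ x, |wl E l x - iE E x|) + ∫ x, (wl E l x - v x) := integral_add di (wi.sub vi)
        _ ≤ C2 * ε^3 + ε^3 := add_le_add db vI
        _ ≤ C' * ε^3 := by linarith [mul_le_mul_of_nonneg_right (show C2 + 1 ≤ C' by linarith) p3.le]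
        _ ≤ C'^3 * ε^3 := mul_le_mul_of_nonneg_right (le_self_pow₀ c'1 (by norm_num)) p3.le
        _ = _ := by ring
    · refine vd.trans ?_
      have : ε^3 ≤ C2 * ε + 2 * ε := by linarith [mul_pos c2 e0]
      rw [hC']; linarith
  obtain ⟨c, hc⟩ := HW v (C' * ε) (by positivity) e2 WHv
  refine ⟨c, ?_⟩
  have bi : Integrable (iE (Bal c 1)) := iE_int measurableSet_ball (vol_ball_lt_top _ _).ne
  have hc' : ∫ x, |v x - iE (Bal c 1) x| ≤ CW * √(C' * ε) := hc
  have ei := iE_int hE hv'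
  have i3 : Integrable fun x => |v x - iE (Bal c 1) x| := (vi.sub bi).abs
  have fin : ∫ x, |iE E x - iE (Bal c 1) x| ≤ (C2 + 1 + CW * √C') * √ε := by
    calc _ ≤ ∫ x, (|wl E l x - iE E x| + (wl E l x - v x) + |v x - iE (Bal c 1) x|) := by
          refine integral_mono_of_nonneg (ae_of_all _ fun x => abs_nonneg _) ((di.add (wi.sub vi)).add i3) (ae_of_all _ fun x => ?_)
          dsimp only
          have q1 := abs_sub_comm (wl E l x) (iE E x)
          have q2 := abs_sub_le (iE E x) (wl E l x) (iE (Bal c 1) x)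
          have q3 := abs_sub_le (wl E l x) (v x) (iE (Bal c 1) x)
          have q4 := abs_of_nonneg (sub_nonneg.2 (vw x))
          linarith
      _ = (∫ x, |wl E l x - iE E x|) + (∫ x, (wl E l x - v x)) + ∫ x, |v x - iE (Bal c 1) x| := by
          have a1 : ∫ x, (|wl E l x - iE E x| + (wl E l x - v x) + |v x - iE (Bal c 1) x|) = (∫ x, (|wl E l x - iE E x| + (wl E l x - v x))) + ∫ x, |v x - iE (Bal c 1) x| := integral_add (di.add (wi.sub vi)) i3
          have a2 : ∫ x, (|wl E l x - iE E x| + (wl E l x - v x)) = (∫ x, |wl E l x - iE E x|) + ∫ x, (wl E l x - v x) := integral_add di (wi.sub vi)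
          rw [a1, a2]
      _ ≤ C2 * ε^3 + ε^3 + CW * √(C' * ε) := add_le_add (add_le_add db vI) hc'
      _ ≤ _ := by
          rw [Real.sqrt_mul (by linarith)]
          have : ε^3 ≤ √ε := e3.trans (Real.le_sqrt_of_sq_le (by nlinarith))
          linarith [mul_le_mul_of_nonneg_left this c2.le]
  calc volume (symmDiff E (Bal c 1)) = ∫⁻ x, oR |iE E x - iE (Bal c 1) x| := by
        rw [← lintegral_indicator_one (hE.symmDiff measurableSet_ball)]
        congr 1; ext x
        unfold iE
        by_cases h1 : x ∈ E <;> by_cases h2 : x ∈ Bal c 1 <;> simp only [indicator, mem_symmDiff, h1, h2] <;> simp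
    _ = oR (∫ x, |iE E x - iE (Bal c 1) x|) := (ofReal_integral_eq_lintegral_ofReal (ei.sub bi).abs (ae_of_all _ fun x => abs_nonneg _)).symm
    _ ≤ _ := ofReal_le_ofReal fin

theorem U_main [Nontrivial X] {n : ℕ} (hn : frk X = n + 1) (h1 : 1 ≤ n) {δ : ℝ} (hδ : 0 < δ) : ∃ C > (0:ℝ), ∃ ε₀ > (0:ℝ), ∀ (E : Set X), MeasurableSet E →
    volume E = volume (Bal (0:X) 1) → ∀ s t ε : ℝ, 0 < s → t < 1 → δ ≤ t - s → 0 < ε → ε ≤ ε₀ → PP (n+1+t) E ≠ ⊤ →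
    oR (1-t) * DP (n+1+t) E ≤ oR (s * ε) * DP (n+1+s) E →
    DP (n+1+t) E ≤ oR (C * ε) * PP (n+1+t) (Bal (0:X) 1) ∧ ∃ c, volume (symmDiff E (Bal c 1)) ≤ oR (C * √ε) := by
  obtain ⟨C3, c3, ε₁, e1, H3⟩ := U3 hn hδ
  obtain ⟨C4, c4, ε₂, e2, H4⟩ := bad hn h1 c3
  have o0 := om_pos n
  have o1 := om_pos (n+1)
  set A := ((n+1)*om (n+1)) * (om n * (1/2)^n) with hA
  have A0 : 0 < A := by positivity
  refine ⟨C3 / A + C4, by positivity, min 1 (min ε₁ ε₂), by positivity, ?_⟩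
  intro E hE hv s t ε hs ht hd e0 he hf H
  have q1 : ε ≤ 1 := he.trans (min_le_left _ _)
  have q2 : ε ≤ ε₁ := he.trans ((min_le_right _ _).trans (min_le_left _ _))
  have q3 : ε ≤ ε₂ := he.trans ((min_le_right _ _).trans (min_le_right _ _))
  have t1 : 0 < 1 - t := by linarith
  have K := H3 E hE hv s t ε hs ht hd e0 q2 hf H
  constructor
  · have b := (PB_bounds (X := X) hn hδ (show δ ≤ t by linarith) ht).1
    have z : oR (1-t) ≠ 0 := by rw [Ne, ofReal_eq_zero, not_le]; exact t1
    refine (ENNReal.mul_le_mul_iff_right z ofReal_ne_top).1 (K.trans ?_)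
    calc oR (C3 * ε) = oR (C3 / A * ε) * oR A := by
          rw [← ofReal_mul (by positivity)]; congr 1; field_simp
      _ ≤ oR ((C3 / A + C4) * ε) * (oR (1-t) * PP (n+1+t) (Bal (0:X) 1)) := by
          refine mul_le_mul' (ofReal_le_ofReal ?_) b
          exact mul_le_mul_of_nonneg_right (by linarith) e0.le
      _ = _ := by ring
  · have fin : ∀ τ : ℝ, 0 < τ → τ ≤ 1 → τ ≤ 4 * ε → oR τ * ∫⁻ a in Ioc (0:ℝ) 2, kap (n+2-τ) a * df E a ≤ oR (C3 * ε) →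
        ∃ c, volume (symmDiff E (Bal c 1)) ≤ oR ((C3 / A + C4) * √ε) := by
      intro τ a b c d
      obtain ⟨x, hx⟩ := H4 E hE hv ε τ e0 q3 a b c d
      refine ⟨x, hx.trans (ofReal_le_ofReal (mul_le_mul_of_nonneg_right ?_ (Real.sqrt_nonneg _)))⟩
      linarith [show 0 < C3 / A by positivity]
    by_cases h4 : 4 * ε ≤ 1 - t
    · have fD : DP (n+1+t) E ≠ ⊤ := fun h => hf (by rw [PP_add hE hv (by linarith [show (0:ℝ) ≤ n from Nat.cast_nonneg n]), ← DP, h, add_top])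
      refine fin ε e0 q1 (by linarith) ?_
      rw [good hE hv hs (by linarith) ht e0 h4 fD H]; simp
    · refine fin (1-t) t1 (by linarith) (not_le.1 h4).le (le_trans ?_ K)
      rw [show (n:ℝ) + 2 - (1 - t) = n+1+t by ring]
      exact mul_le_mul_right (lintegral_mono_set fun a ha => ha.1) _

theorem ind_pre (F : Set X) (R : ℝ) (x : X) : ind ((fun x => R • x) ⁻¹' F) x = ind F (R • x) := rfl

theorem ee_scale {F : Set X} (hF : MeasurableSet F) {R : ℝ} (hR : 0 < R) (h : X) :
    ee F (R • h) = oR (R ^ frk X) * ee ((fun x => R • x) ⁻¹' F) h := by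
  unfold ee
  have m : Measurable fun x => ind F x * ind Fᶜ (x + R • h) := (ind_meas hF).mul ((ind_meas hF.compl).comp (by fun_prop))
  rw [lint_scale m hR]
  congr 2; ext x
  rw [← smul_add, ← preimage_compl, ind_pre, ind_pre]

theorem PP_scale {F : Set X} (hF : MeasurableSet F) {R : ℝ} (hR : 0 < R) (p : ℝ) :
    PP p F = oR (R ^ frk X * R ^ frk X * R ^ (-p)) * PP p ((fun x => R • x) ⁻¹' F) := by
  have hE : MeasurableSet ((fun x : X => R • x) ⁻¹' F) := hF.preimage (measurable_const_smul R)
  unfold PP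
  have m : Measurable fun h => oR (‖h‖ ^ (-p)) * ee F h := Measurable.mul (by fun_prop) (ee_meas hF)
  have m2 : Measurable fun h => oR (‖h‖ ^ (-p)) * ee ((fun x => R • x) ⁻¹' F) h := Measurable.mul (by fun_prop) (ee_meas hE)
  rw [lint_scale m hR, mul_assoc, ofReal_mul (by positivity), mul_assoc, ← lintegral_const_mul _ m2]
  congr 2; ext h
  rw [ee_scale hF hR, norm_smul, Real.norm_of_nonneg hR.le, Real.mul_rpow hR.le (norm_nonneg _), ofReal_mul (by positivity), ofReal_mul (by positivity)]
  ring

theorem vol_scale {F : Set X} (hF : MeasurableSet F) {R : ℝ} (hR : 0 < R) :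
    volume F = oR (R ^ frk X) * volume ((fun x => R • x) ⁻¹' F) := by
  have hE : MeasurableSet ((fun x : X => R • x) ⁻¹' F) := hF.preimage (measurable_const_smul R)
  rw [← lintegral_indicator_one hF, ← lintegral_indicator_one hE, lint_scale (measurable_one.indicator hF) hR]; rfl

theorem ball_pre {R : ℝ} (hR : 0 < R) : (fun x : X => R • x) ⁻¹' (Bal 0 R) = Bal 0 1 := by
  ext x
  rw [mem_preimage, mem_ball_zero_iff, mem_ball_zero_iff, norm_smul, Real.norm_of_nonneg hR.le]
  exact mul_lt_iff_lt_one_right hR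

theorem symm_scale {F : Set X} (hF : MeasurableSet F) {R : ℝ} (hR : 0 < R) (c : X) :
    volume (symmDiff ((fun y => -(R • c) + y) '' F) (Bal 0 R)) = oR (R ^ frk X) * volume (symmDiff ((fun x => R • x) ⁻¹' F) (Bal c 1)) := by
  have e : (fun y => -(R • c) + y) '' F = (fun y => R • c + y) ⁻¹' F := by
    rw [image_add_left, neg_neg]
  have m : MeasurableSet ((fun y => R • c + y) ⁻¹' F) := hF.preimage (by fun_prop)
  rw [e, vol_scale (m.symmDiff measurableSet_ball) hR, ← measure_preimage_add volume c (symmDiff ((fun x => R • x) ⁻¹' F) (Bal c 1))]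
  congr 2
  ext y
  have h1 := Set.ext_iff.1 (ball_pre (X := X) hR) y
  rw [mem_preimage] at h1
  simp only [mem_preimage, mem_symmDiff, h1, mem_ball_zero_iff, Metric.mem_ball, dist_eq_norm, add_sub_cancel_left, smul_add, sub_zero]
end main

theorem fracPer_PP (N : ℕ) (α : ℝ) {E : Set (EuclideanSpace ℝ (Fin N))} (hE : MeasurableSet E) : fracPer N α E = PP (N+α) E := by
  have hk : Measurable fun r : ℝ => oR (r ^ (-((N:ℝ)+α))) := by fun_prop
  unfold PP
  rw [← PK_ee hk hE]
  unfold fracPer interEnergy PK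
  rw [← lintegral_indicator hE]
  congr 1; ext x
  by_cases h : x ∈ E
  · rw [indicator_of_mem h, ← lintegral_indicator hE.compl]
    congr 1; ext y
    by_cases h2 : y ∈ Eᶜ
    · rw [indicator_of_mem h2, ind_of_mem h, ind_of_mem h2, one_mul, one_mul]
    · rw [indicator_of_notMem h2, ind_of_not h2]; simp
  · rw [indicator_of_notMem h]
    simp_rw [ind_of_not h]; simp
theorem stmt12 (N : ℕ) (hN : 2 ≤ N) (δ₀ : ℝ) (hδ : δ₀ ∈ Set.Ioo (0 : ℝ) 1) :
    ∃ m₂ c₀ : ℝ, 0 < m₂ ∧ 0 < c₀ ∧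
      ∀ s t : ℝ, 0 < s → s < t → t < 1 → δ₀ ≤ t - s →
        ∀ m : ℝ, m ∈ Set.Ioo 0 m₂ →
          ∀ F : Set (EuclideanSpace ℝ (Fin N)), MeasurableSet F →
            volume F = ENNReal.ofReal m → fracPer N t F < ⊤ →
            freeEnergy N s t F ≤
              freeEnergy N s t (Metric.ball (0 : EuclideanSpace ℝ (Fin N)) (ballRad N m)) →
            ((fracPer N t F).toReal -
                  (fracPer N t (Metric.ball (0 : EuclideanSpace ℝ (Fin N)) (ballRad N m))).toReal) /
                (fracPer N t (Metric.ball (0 : EuclideanSpace ℝ (Fin N)) (ballRad N m))).toReal ≤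
              c₀ * m ^ ((t - s) / N) ∧
            ∃ x : EuclideanSpace ℝ (Fin N),
              volume (symmDiff ((fun y => x + y) '' F)
                  (Metric.ball (0 : EuclideanSpace ℝ (Fin N)) (ballRad N m))) ≤
                ENNReal.ofReal (c₀ * m ^ (1 + (t - s) / (2 * N))) := by
  obtain ⟨n, rfl⟩ : ∃ n, N = n + 1 := ⟨N - 1, by omega⟩
  have h1 : 1 ≤ n := by omega
  have hn : frk (EuclideanSpace ℝ (Fin (n+1))) = n + 1 := by simp
  haveI : Nontrivial (EuclideanSpace ℝ (Fin (n+1))) := Module.nontrivial_of_finrank_pos (R := ℝ) (by rw [hn]; omega)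
  obtain ⟨C, C0, ε₀, e0, U⟩ := U_main hn h1 hδ.1
  obtain ⟨CU, CU0, U1'⟩ := U1 hn hδ.1
  have w0 := om_pos (n+1)
  have wb : volume (Bal (0 : EuclideanSpace ℝ (Fin (n+1))) 1) = oR (om (n+1)) := by
    rw [vol_ball_om hn _ one_pos, one_pow, mul_one]
  set ω := om (n+1) with hω
  set W := max 1 ω⁻¹ with hW
  have W1 : 1 ≤ W := le_max_left _ _
  have Ww : ω⁻¹ ≤ W := le_max_right _ _
  set r1 := min 1 (ε₀ ^ (1/δ₀)) with hr1
  have r0 : 0 < r1 := lt_min one_pos (by positivity)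
  refine ⟨ω * r1^(n+1), C * W * W, by positivity, by positivity, ?_⟩
  intro s t hs hst ht hd m hm F hF hFm hFt hfree
  have m0 := hm.1
  set R := ballRad (n+1) m with hR
  have hRe : R = (m/ω) ^ ((1:ℝ)/((n+1:ℕ):ℝ)) := by rw [hR, ballRad, wb, toReal_ofReal w0.le]
  have mw : 0 < m / ω := by positivity
  have R0 : 0 < R := by rw [hRe]; positivity
  have N0 : (0:ℝ) < ((n+1:ℕ):ℝ) := by positivity
  have RN : R^(n+1) = m / ω := by
    rw [hRe, one_div, Real.rpow_inv_natCast_pow mw.le (by omega)]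
  have Rr : R ≤ r1 := by
    have : R^(n+1) < r1^(n+1) := by
      rw [RN, div_lt_iff₀ w0]; linarith [hm.2]
    exact (lt_of_pow_lt_pow_left₀ _ r0.le this).le
  have R1 : R ≤ 1 := Rr.trans (min_le_left _ _)
  set ε := R ^ (t-s) with hε
  have ε0 : 0 < ε := by positivity
  have εle : ε ≤ ε₀ := by
    calc ε ≤ R ^ δ₀ := Real.rpow_le_rpow_of_exponent_ge R0 R1 hd
      _ ≤ (ε₀ ^ (1/δ₀)) ^ δ₀ := Real.rpow_le_rpow R0.le (Rr.trans (min_le_right _ _)) hδ.1.le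
      _ = ε₀ := by rw [← Real.rpow_mul e0.le, one_div_mul_cancel hδ.1.ne', Real.rpow_one]
  have sc : ∀ q : ℝ, 0 ≤ q → q ≤ 1 → (m/ω) ^ q ≤ W * m ^ q := by
    intro q q0 q1
    rw [div_eq_mul_inv, Real.mul_rpow m0.le (by positivity), mul_comm]
    refine mul_le_mul_of_nonneg_right ?_ (by positivity)
    calc (ω⁻¹)^q ≤ W^q := Real.rpow_le_rpow (by positivity) Ww q0
      _ ≤ W^(1:ℝ) := Real.rpow_le_rpow_of_exponent_le W1 q1
      _ = W := Real.rpow_one W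
  have εm : ∀ u : ℝ, R ^ u = (m/ω) ^ (u/((n+1:ℕ):ℝ)) := by
    intro u; rw [hRe, ← Real.rpow_mul mw.le]; congr 1; ring
  have N1 : (1:ℝ) ≤ ((n+1:ℕ):ℝ) := by exact_mod_cast Nat.le_add_left 1 n
  set E := (fun x : EuclideanSpace ℝ (Fin (n+1)) => R • x) ⁻¹' F with hE'
  have hE : MeasurableSet E := hF.preimage (measurable_const_smul R)
  have zR : oR (R^(n+1)) ≠ 0 := by rw [Ne, ofReal_eq_zero, not_le]; positivity
  have hv : volume E = volume (Bal (0 : EuclideanSpace ℝ (Fin (n+1))) 1) := by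
    have := vol_scale hF R0
    rw [hn, hFm] at this
    refine (ENNReal.mul_right_inj zR ofReal_ne_top).1 (this.symm.trans ?_)
    rw [wb, ← ofReal_mul (by positivity), RN, div_mul_cancel₀ _ w0.ne']
  have fp : ∀ (α : ℝ) (G : Set (EuclideanSpace ℝ (Fin (n+1)))), MeasurableSet G → fracPer (n+1) α G = PP (n+1+α) G := fun α G hG => by
    have := fracPer_PP (n+1) α hG
    push_cast at this; exact this
  set ρ : ℝ → ℝ := fun α => R^(n+1) * R^(n+1) * R^(-((n:ℝ)+1+α)) with hρ
  have ρ0 : ∀ α, 0 < ρ α := fun α => by positivity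
  have fF : ∀ α, fracPer (n+1) α F = oR (ρ α) * PP (n+1+α) E := fun α => by
    rw [fp α F hF, PP_scale hF R0, hn]
  have fB : ∀ α, fracPer (n+1) α (Bal (0 : EuclideanSpace ℝ (Fin (n+1))) R) = oR (ρ α) * PP (n+1+α) (Bal (0 : EuclideanSpace ℝ (Fin (n+1))) 1) := fun α => by
    rw [fp α _ measurableSet_ball, PP_scale measurableSet_ball R0, hn, ball_pre R0]
  have zρ : ∀ α, oR (ρ α) ≠ 0 := fun α => by rw [Ne, ofReal_eq_zero, not_le]; exact ρ0 α
  have n0 : (0:ℝ) ≤ n := Nat.cast_nonneg n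
  have Pt : PP (n+1+t) E ≠ ⊤ := fun h => by
    rw [fF, h, mul_top (zρ t)] at hFt; exact lt_irrefl _ hFt
  have Ps : PP (n+1+s) E ≠ ⊤ := fun h => by
    have := U1' E hE hv s t hs ht hd Pt
    rw [h, mul_top (by rw [Ne, ofReal_eq_zero, not_le]; exact hs), top_le_iff] at this
    exact mul_ne_top ofReal_ne_top (add_ne_top.2 ⟨mul_ne_top ofReal_ne_top Pt, one_ne_top⟩) this
  have At : PP (n+1+t) E = PP (n+1+t) (Bal (0 : EuclideanSpace ℝ (Fin (n+1))) 1) + DP (n+1+t) E := PP_add hE hv (by linarith)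
  have As : PP (n+1+s) E = PP (n+1+s) (Bal (0 : EuclideanSpace ℝ (Fin (n+1))) 1) + DP (n+1+s) E := PP_add hE hv (by linarith)
  have Pt' := Pt
  have Ps' := Ps
  rw [At] at Pt'
  rw [As] at Ps'
  obtain ⟨bt, dt⟩ := add_ne_top.1 Pt'
  obtain ⟨bs, ds⟩ := add_ne_top.1 Ps'
  have Ft : (fracPer (n+1) t F).toReal = ρ t * ((PP (n+1+t) (Bal (0 : EuclideanSpace ℝ (Fin (n+1))) 1)).toReal + (DP (n+1+t) E).toReal) := by
    rw [fF, At, toReal_mul, toReal_ofReal (ρ0 t).le, toReal_add bt dt]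
  have Fs : (fracPer (n+1) s F).toReal = ρ s * ((PP (n+1+s) (Bal (0 : EuclideanSpace ℝ (Fin (n+1))) 1)).toReal + (DP (n+1+s) E).toReal) := by
    rw [fF, As, toReal_mul, toReal_ofReal (ρ0 s).le, toReal_add bs ds]
  have Bt : (fracPer (n+1) t (Bal (0 : EuclideanSpace ℝ (Fin (n+1))) R)).toReal = ρ t * (PP (n+1+t) (Bal (0 : EuclideanSpace ℝ (Fin (n+1))) 1)).toReal := by
    rw [fB, toReal_mul, toReal_ofReal (ρ0 t).le]
  have Bs : (fracPer (n+1) s (Bal (0 : EuclideanSpace ℝ (Fin (n+1))) R)).toReal = ρ s * (PP (n+1+s) (Bal (0 : EuclideanSpace ℝ (Fin (n+1))) 1)).toReal := by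
    rw [fB, toReal_mul, toReal_ofReal (ρ0 s).le]
  have ρst : ρ s = ε * ρ t := by
    have : R^(-((n:ℝ)+1+s)) = R^(t-s) * R^(-((n:ℝ)+1+t)) := by rw [← Real.rpow_add R0]; congr 1; ring
    simp only [hρ]; rw [this, hε]; ring
  have key : (1-t) * (DP (n+1+t) E).toReal ≤ s * ε * (DP (n+1+s) E).toReal := by
    unfold freeEnergy at hfree
    rw [Ft, Fs, Bt, Bs, ρst] at hfree
    refine le_of_mul_le_mul_left ?_ (ρ0 t)
    linarith
  have H : oR (1-t) * DP (n+1+t) E ≤ oR (s * ε) * DP (n+1+s) E := by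
    rw [← ofReal_toReal dt, ← ofReal_toReal ds, ← ofReal_mul (by linarith), ← ofReal_mul (by positivity)]
    exact ofReal_le_ofReal key
  obtain ⟨V1, c, V2⟩ := U E hE hv s t ε hs ht hd ε0 εle Pt H
  have q0 : 0 ≤ (t-s)/((n+1:ℕ):ℝ) := div_nonneg (by linarith) N0.le
  have q1 : (t-s)/((n+1:ℕ):ℝ) ≤ 1 := by rw [div_le_one N0]; linarith
  constructor
  · have V1' : (DP (n+1+t) E).toReal ≤ C * ε * (PP (n+1+t) (Bal (0 : EuclideanSpace ℝ (Fin (n+1))) 1)).toReal := by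
      have := toReal_mono (mul_ne_top ofReal_ne_top bt) V1
      rwa [toReal_mul, toReal_ofReal (by positivity)] at this
    rw [Ft, Bt]
    have e1 : ρ t * ((PP (n+1+t) (Bal (0 : EuclideanSpace ℝ (Fin (n+1))) 1)).toReal + (DP (n+1+t) E).toReal) - ρ t * (PP (n+1+t) (Bal (0 : EuclideanSpace ℝ (Fin (n+1))) 1)).toReal = ρ t * (DP (n+1+t) E).toReal := by ring
    rw [e1, mul_div_mul_left _ _ (ρ0 t).ne']
    refine (div_le_of_le_mul₀ toReal_nonneg (by positivity) V1').trans ?_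
    rw [hε, εm, mul_assoc C W W, mul_assoc C]
    refine mul_le_mul_of_nonneg_left ((sc _ q0 q1).trans ?_) C0.le
    exact mul_le_mul_of_nonneg_right (le_mul_of_one_le_left (by linarith) W1) (by positivity)
  · refine ⟨-(R • c), ?_⟩
    rw [symm_scale hF R0, hn]
    refine (mul_le_mul_right V2 _).trans ?_
    rw [← ofReal_mul (by positivity)]
    apply ofReal_le_ofReal
    have e2 : √ε = (m/ω) ^ ((t-s)/(2*((n+1:ℕ):ℝ))) := by
      rw [Real.sqrt_eq_rpow, hε, ← Real.rpow_mul R0.le, εm]; congr 1; field_simp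
    have q2 : (t-s)/(2*((n+1:ℕ):ℝ)) ≤ 1 := by rw [div_le_one (by positivity)]; linarith
    have q3 : 0 ≤ (t-s)/(2*((n+1:ℕ):ℝ)) := div_nonneg (by linarith) (by positivity)
    have e3 := sc _ q3 q2
    rw [RN, e2, Real.rpow_add m0, Real.rpow_one]
    calc m / ω * (C * (m/ω) ^ ((t-s)/(2*((n+1:ℕ):ℝ)))) ≤ m * W * (C * (W * m ^ ((t-s)/(2*((n+1:ℕ):ℝ))))) := by
          rw [div_eq_mul_inv m ω] at e3 ⊢
          gcongr
      _ = _ := by ring
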